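/- For every natural number K ≥ 1 there exist N₂(K), N₃(K) ∈ ℕ such that for every ring R and every finite K-approximate subring X ⊆ R there exists a finite (K^510 + K^22)-approximate subring Y ⊆ 4X + X·4X which is N₂(K)-commensurable with X, and a two-sided ideal I of the subring ⟨Y⟩ generated by Y with I ⊆ Y_{N₃(K)}, such that ⟨Y⟩/I is nilpotent of class at most ⌊4·log₂ K⌋. -/

import Mathlib

open Pointwise

universe u

/-- A subset of a ring is additively symmetric if it contains `0` and equals its negation. -/
def AddSymm {R : Type u} [NonUnitalRing R] (X : Set R) : Prop :=
  (0 : R) ∈ X ∧ X = -X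

/-- `X` is a `K`-approximate subring: it is additively symmetric and `X·X ∪ (X+X)` is covered
by at most `K` additive translates of `X`. -/
def IsApproxSubringWith {R : Type u} [NonUnitalRing R] (K : ℕ) (X : Set R) : Prop :=
  AddSymm X ∧ ∃ F : Finset R, F.card ≤ K ∧ (X * X) ∪ (X + X) ⊆ (F : Set R) + X

/-- `A` and `B` are `N`-commensurable: each is covered by at most `N` additive translates
of the other. -/
def NCommensurable {R : Type u} [NonUnitalRing R] (N : ℕ) (A B : Set R) : Prop :=
  (∃ F : Finset R, F.card ≤ N ∧ A ⊆ (F : Set R) + B) ∧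
  (∃ G : Finset R, G.card ≤ N ∧ B ⊆ (G : Set R) + A)

/-- `mulIter S n` is the set of (left-nested) products of `n+1` elements of `S`. -/
def mulIter {R : Type u} [NonUnitalRing R] (S : Set R) : ℕ → Set R
  | 0 => S
  | n + 1 => mulIter S n * S

/-- `I` is a two-sided ideal of the subring `S` (both given as sets). -/
def IsTwoSidedIdealIn {R : Type u} [NonUnitalRing R] (I S : Set R) : Prop :=
  I ⊆ S ∧ (0 : R) ∈ I ∧ (∀ x ∈ I, ∀ y ∈ I, x + y ∈ I) ∧ (∀ x ∈ I, -x ∈ I) ∧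
    ∀ r ∈ S, ∀ x ∈ I, r * x ∈ I ∧ x * r ∈ I

/-- `iterX Y n` is `Yₙ` where `Y₀ = Y` and `Y_{n+1} = Y_n + Y_n + Y_n · Y_n`. -/
def iterX {R : Type u} [NonUnitalRing R] (X : Set R) : ℕ → Set R
  | 0 => X
  | n + 1 => iterX X n + iterX X n + iterX X n * iterX X n


/-- local norms: symmetric subadditive functions which are homogeneous near zero. -/
structure LN (G : Type u) [AddCommGroup G] where
  f : G → ℝ
  nonneg : ∀ x, 0 ≤ f x
  le_half : ∀ x, f x ≤ 1/2
  neg : ∀ x, f (-x) = f x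
  add_le : ∀ x y, f (x+y) ≤ f x + f y
  hom : ∀ (l : ℕ) x, l * f x ≤ 1/2 → f (l • x) = l * f x

namespace LN
variable {G : Type u} [AddCommGroup G]

lemma zero' (p : LN G) : p.f 0 = 0 := by
  have := p.hom 0 0 (by norm_num)
  simpa using this

lemma sub_le (p : LN G) (x y : G) : p.f (x - y) ≤ p.f x + p.f y := by
  rw [sub_eq_add_neg]
  have := p.add_le x (-y)
  rwa [p.neg] at this

lemma nsmul_le (p : LN G) (l : ℕ) (x : G) : p.f (l • x) ≤ l * p.f x := by
  induction l with
  | zero => simp [p.zero']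
  | succ n ih =>
    rw [succ_nsmul]
    have := p.add_le (n • x) x
    push_cast
    linarith

lemma zsmul_le (p : LN G) (l : ℤ) (x : G) : p.f (l • x) ≤ |(l : ℝ)| * p.f x := by
  rcases Int.eq_nat_or_neg l with ⟨n, rfl | rfl⟩
  · have := p.nsmul_le n x
    simpa using this
  · have := p.nsmul_le n x
    rw [neg_smul, p.neg]
    simpa using this

lemma sum_le (p : LN G) {ι : Type*} (s : Finset ι) (g : ι → G) :
    p.f (∑ i ∈ s, g i) ≤ ∑ i ∈ s, p.f (g i) := by
  classical
  induction s using Finset.induction_on with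
  | empty => simp [p.zero']
  | insert a s ha ih =>
    rw [Finset.sum_insert ha, Finset.sum_insert ha]
    have := p.add_le (g a) (∑ i ∈ s, g i)
    linarith

lemma hom_of_small (p : LN G) (x : G) (θ : ℝ) (hθ : θ ≤ 1/4) (L : ℕ)
    (h : ∀ l : ℕ, 1 ≤ l → l ≤ L → p.f (l • x) ≤ θ) :
    ∀ l : ℕ, l ≤ L → p.f (l • x) = l * p.f x := by
  intro l
  induction l with
  | zero => intro _; simp [p.zero']
  | succ n ih =>
    intro hn
    have h1 : p.f x ≤ θ := by simpa using h 1 le_rfl (by omega)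
    apply p.hom
    rcases Nat.eq_zero_or_pos n with rfl | hn0
    · norm_num; linarith
    · have h2 := ih (by omega)
      have h3 := h n hn0 (by omega)
      push_cast
      linarith

lemma small_of_multiples (p : LN G) (x : G) (θ : ℝ) (hθ : θ ≤ 1/4) (L : ℕ) (hL : 1 ≤ L)
    (h : ∀ l : ℕ, 1 ≤ l → l ≤ L → p.f (l • x) ≤ θ) : p.f x * L ≤ θ := by
  have := p.hom_of_small x θ hθ L h L le_rfl
  have h2 := h L hL le_rfl
  linarith

/-- the zero local norm -/
def zero (G : Type u) [AddCommGroup G] : LN G where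
  f := fun _ => 0
  nonneg := by simp
  le_half := by norm_num
  neg := by simp
  add_le := by simp
  hom := by simp

/-- pull back of a local norm -/
def comp {H : Type*} [AddCommGroup H] (p : LN H) (φ : G →+ H) : LN G where
  f := fun x => p.f (φ x)
  nonneg := fun x => p.nonneg _
  le_half := fun x => p.le_half _
  neg := fun x => by rw [map_neg, p.neg]
  add_le := fun x y => by rw [map_add]; exact p.add_le _ _
  hom := fun l x h => by rw [map_nsmul]; exact p.hom _ _ h

lemma bdd {ι : Type*} (p : ι → LN G) (x : G) : BddAbove (Set.range fun i => (p i).f x) :=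
  ⟨1/2, by rintro _ ⟨i, rfl⟩; exact (p i).le_half x⟩

/-- supremum of a family of local norms -/
noncomputable def sup {ι : Type*} [Nonempty ι] (p : ι → LN G) : LN G where
  f := fun x => ⨆ i, (p i).f x
  nonneg := fun x => Real.iSup_nonneg fun i => (p i).nonneg x
  le_half := fun x => ciSup_le fun i => (p i).le_half x
  neg := fun x => by simp only [(p _).neg]
  add_le := fun x y => ciSup_le fun i =>
    ((p i).add_le x y).trans (add_le_add (le_ciSup (bdd p x) i) (le_ciSup (bdd p y) i))
  hom := fun l x h => by
    have h1 : ∀ i, (p i).f (l • x) = l * (p i).f x := fun i => (p i).hom l x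
      ((mul_le_mul_of_nonneg_left (le_ciSup (bdd p x) i) (by positivity)).trans h)
    simp only [h1]
    rw [Real.mul_iSup_of_nonneg (by positivity)]

lemma le_sup {ι : Type*} [Nonempty ι] (p : ι → LN G) (i : ι) (x : G) :
    (p i).f x ≤ (sup p).f x := le_ciSup (bdd p x) i

lemma sup_le {ι : Type*} [Nonempty ι] (p : ι → LN G) (x : G) (c : ℝ)
    (h : ∀ i, (p i).f x ≤ c) : (sup p).f x ≤ c := ciSup_le h

/-- the norm on the circle -/
noncomputable def circ : LN (AddCircle (1:ℝ)) where
  f := fun x => ‖x‖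
  nonneg := fun x => norm_nonneg x
  le_half := fun x => by
    have := AddCircle.norm_le_half_period (1:ℝ) (x := x) (by norm_num)
    simpa using this
  neg := fun x => norm_neg x
  add_le := fun x y => norm_add_le x y
  hom := fun l x h => by
    induction x using QuotientAddGroup.induction_on with
    | H r =>
    -- choose a good representative
    obtain ⟨t, ht, hx⟩ : ∃ t : ℝ, |t| ≤ 1/2 ∧ ((r : ℝ) : AddCircle (1:ℝ)) = (t : AddCircle (1:ℝ)) := by
      refine ⟨r - round r, abs_sub_round r, ?_⟩
      rw [AddCircle.coe_sub]
      have : ((round r : ℝ) : AddCircle (1:ℝ)) = 0 := by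
        rw [AddCircle.coe_eq_zero_iff]
        exact ⟨round r, by simp⟩
      rw [this, sub_zero]
    change ‖l • ((r : ℝ) : AddCircle (1:ℝ))‖ = l * ‖((r : ℝ) : AddCircle (1:ℝ))‖
    change l * ‖((r : ℝ) : AddCircle (1:ℝ))‖ ≤ 1/2 at h
    rw [hx] at h ⊢
    have e1 : ‖(t : AddCircle (1:ℝ))‖ = |t| := by
      rw [AddCircle.norm_coe_eq_abs_iff (1:ℝ) (by norm_num)]; simpa using ht
    rw [e1] at h ⊢
    rw [← AddCircle.coe_nsmul]
    have e2 : ‖((l • t : ℝ) : AddCircle (1:ℝ))‖ = |l • t| := by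
      rw [AddCircle.norm_coe_eq_abs_iff (1:ℝ) (by norm_num)]
      simpa [abs_mul] using h
    rw [e2]; simp [abs_mul]

end LN

set_option linter.unusedSectionVars false
set_option linter.unusedSimpArgs false

section Fourier
variable {G : Type u} [AddCommGroup G]

/-- additive character evaluation -/
noncomputable def ev (γ : G →+ AddCircle (1:ℝ)) (x : G) : ℂ := ((AddCircle.toCircle (γ x) : Circle) : ℂ)

lemma ev_add (γ : G →+ AddCircle (1:ℝ)) (x y : G) : ev γ (x+y) = ev γ x * ev γ y := by
  simp [ev, AddCircle.toCircle_add]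

lemma ev_zero (γ : G →+ AddCircle (1:ℝ)) : ev γ 0 = 1 := by
  simp [ev]

lemma ev_neg (γ : G →+ AddCircle (1:ℝ)) (x : G) : ev γ (-x) = (starRingEnd ℂ) (ev γ x) := by
  simp only [ev, map_neg, AddCircle.toCircle_neg, Circle.coe_inv_eq_conj]

lemma ev_norm (γ : G →+ AddCircle (1:ℝ)) (x : G) : ‖ev γ x‖ = 1 := by
  exact Circle.norm_coe _

lemma circ_rep (x : AddCircle (1:ℝ)) : ∃ t : ℝ, |t| ≤ 1/2 ∧ x = (t : AddCircle (1:ℝ)) ∧ ‖x‖ = |t| := by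
  induction x using QuotientAddGroup.induction_on with
  | H r =>
    have hx : ((r : ℝ) : AddCircle (1:ℝ)) = ((r - round r : ℝ) : AddCircle (1:ℝ)) := by
      rw [AddCircle.coe_sub]
      have : ((round r : ℝ) : AddCircle (1:ℝ)) = 0 := by
        rw [AddCircle.coe_eq_zero_iff]
        exact ⟨round r, by simp⟩
      rw [this, sub_zero]
    refine ⟨r - round r, abs_sub_round r, hx, ?_⟩
    change ‖((r : ℝ) : AddCircle (1:ℝ))‖ = _
    rw [hx, AddCircle.norm_coe_eq_abs_iff (1:ℝ) (by norm_num)]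
    simpa using abs_sub_round r

lemma toCircle_eq (t : ℝ) : ((AddCircle.toCircle (t : AddCircle (1:ℝ)) : Circle) : ℂ)
    = Complex.exp (Complex.I * ((2*Real.pi*t : ℝ) : ℂ)) := by
  rw [AddCircle.toCircle_apply_mk]
  simp [Circle.coe_exp]
  ring_nf

lemma norm_le_ev (γ : G →+ AddCircle (1:ℝ)) (x : G) : ‖γ x‖ ≤ ‖1 - ev γ x‖ := by
  obtain ⟨t, ht, hx, hn⟩ := circ_rep (γ x)
  rw [hn, ev, hx, toCircle_eq, norm_sub_rev, Complex.norm_exp_I_mul_ofReal_sub_one]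
  have h1 : 2*Real.pi*t/2 = Real.pi * t := by ring
  rw [h1]
  have hp := Real.pi_pos
  have h2 : |Real.pi * t| ≤ Real.pi/2 := by
    rw [abs_mul, abs_of_pos hp]; nlinarith
  have h3 := Real.mul_abs_le_abs_sin h2
  rw [abs_mul, abs_of_pos hp] at h3
  have h4 : 2 / Real.pi * (Real.pi * |t|) = 2*|t| := by field_simp
  rw [h4] at h3
  simp only [Real.norm_eq_abs, abs_mul]
  have := abs_nonneg t
  norm_num
  linarith

lemma re_ev_ge (γ : G →+ AddCircle (1:ℝ)) (x : G) (h : ‖γ x‖ ≤ 1/16) : 1/2 ≤ (ev γ x).re := by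
  obtain ⟨t, ht, hx, hn⟩ := circ_rep (γ x)
  rw [hn] at h
  rw [ev, hx, toCircle_eq, mul_comm, Complex.exp_ofReal_mul_I_re]
  have h1 := Real.one_sub_sq_div_two_le_cos (x := 2*Real.pi*t)
  have h2 : (2*Real.pi*t)^2 ≤ 1 := by
    rw [← sq_abs]
    have h5 : |2*Real.pi*t| ≤ 1 := by
      rw [abs_mul, abs_of_pos (by positivity)]
      have := Real.pi_lt_four
      have := Real.pi_pos
      have := abs_nonneg t
      nlinarith
    have := abs_nonneg (2*Real.pi*t)
    nlinarith
  linarith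

lemma exists_cell (n : ℕ) (hn : 0 < n) : ∃ cell : AddCircle (1:ℝ) → Fin n,
    ∀ x y, cell x = cell y → ‖x - y‖ ≤ 1/n := by
  have key : ∀ x : AddCircle (1:ℝ), ∃ (k : Fin n) (t : ℝ), x = (t : AddCircle (1:ℝ)) ∧ (k:ℝ) ≤ n*t ∧ n*t < k+1 := by
    intro x
    induction x using QuotientAddGroup.induction_on with
    | H r =>
      have hn' : (0:ℝ) < n := by exact_mod_cast hn
      have h0 := Int.fract_nonneg r
      have h1 := Int.fract_lt_one r
      have hlt : ⌊(n:ℝ) * Int.fract r⌋₊ < n := by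
        rw [Nat.floor_lt (by positivity)]
        nlinarith
      refine ⟨⟨_, hlt⟩, Int.fract r, ?_, ?_, ?_⟩
      · change ((r : ℝ) : AddCircle (1:ℝ)) = _
        rw [Int.fract, AddCircle.coe_sub]
        have : ((⌊r⌋ : ℝ) : AddCircle (1:ℝ)) = 0 := by
          rw [AddCircle.coe_eq_zero_iff]
          exact ⟨⌊r⌋, by simp⟩
        rw [this, sub_zero]
      · exact Nat.floor_le (by positivity)
      · exact Nat.lt_floor_add_one _
  choose k t h1 h2 h3 using key
  refine ⟨k, fun x y hxy => ?_⟩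
  have hn' : (0:ℝ) < n := by exact_mod_cast hn
  have e : x - y = ((t x - t y : ℝ) : AddCircle (1:ℝ)) := by
    rw [AddCircle.coe_sub, ← h1, ← h1]
  have a1 := h2 x
  have a2 := h3 x
  have a3 := h2 y
  have a4 := h3 y
  rw [hxy] at a1 a2
  have : ‖x - y‖ ≤ |t x - t y| := by
    rw [e]; exact QuotientAddGroup.norm_mk_le_norm
  refine this.trans ?_
  have e2 : |t x - t y| * n = |(t x - t y) * n| := by rw [abs_mul, abs_of_pos hn']
  rw [le_div_iff₀ hn', e2, abs_le]
  constructor <;> nlinarith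

lemma ratchar_exists (t : G) (ht : t ≠ 0) : ∃ ψ : G →+ AddCircle (1:ℝ), ψ t ≠ 0 ∧
    ∃ N : ℕ, 0 < N ∧ N • ψ t = 0 := by
  obtain ⟨c, hc⟩ := CharacterModule.exists_character_apply_ne_zero_of_ne_zero (A := G) ht
  let m : AddCircle (1:ℚ) →+ AddCircle (1:ℝ) :=
    QuotientAddGroup.map _ _ (Rat.castHom ℝ).toAddMonoidHom (by
      intro x hx
      obtain ⟨n, rfl⟩ := AddSubgroup.mem_zmultiples_iff.1 hx
      simp only [AddSubgroup.mem_comap]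
      exact AddSubgroup.mem_zmultiples_iff.2 ⟨n, by simp⟩)
  have hm : ∀ q : ℚ, m (q : AddCircle (1:ℚ)) = ((q:ℝ) : AddCircle (1:ℝ)) := fun q => rfl
  refine ⟨m.comp (c : G →+ AddCircle (1:ℚ)), ?_, ?_⟩
  · change m (c t) ≠ 0
    intro h0
    apply hc
    generalize hz : (c t) = z at *
    change AddCircle (1:ℚ) at z
    obtain ⟨q, rfl⟩ := QuotientAddGroup.mk_surjective z
    change m (q : AddCircle (1:ℚ)) = 0 at h0
    rw [hm, AddCircle.coe_eq_zero_iff] at h0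
    obtain ⟨n, hn⟩ := h0
    change ((q:ℚ) : AddCircle (1:ℚ)) = 0
    rw [AddCircle.coe_eq_zero_iff]
    refine ⟨n, ?_⟩
    have : (n:ℝ) = q := by simpa using hn
    have : (n:ℚ) = q := by exact_mod_cast this
    simpa using this
  · change ∃ N : ℕ, 0 < N ∧ N • m (c t) = 0
    generalize hz : (c t) = z
    change AddCircle (1:ℚ) at z
    obtain ⟨q, rfl⟩ := QuotientAddGroup.mk_surjective z
    refine ⟨q.den, q.den_pos, ?_⟩
    rw [hm, ← AddCircle.coe_nsmul, AddCircle.coe_eq_zero_iff]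
    refine ⟨q.num, ?_⟩
    have : (q.den : ℚ) * q = q.num := by rw [mul_comm]; exact Rat.mul_den_eq_num q
    have : (q.den : ℝ) * q = q.num := by exact_mod_cast this
    simp [this]

lemma exists_dual (T : Finset G) : ∃ (ι : Type) (_ : Fintype ι) (_ : Nonempty ι)
    (χ : ι → (G →+ AddCircle (1:ℝ))), ∀ t ∈ T, t ≠ 0 → ∑ i, ev (χ i) t = 0 := by
  classical
  induction T using Finset.induction_on with
  | empty => exact ⟨Unit, inferInstance, inferInstance, fun _ => 0, by simp⟩
  | insert a T _ ih =>
    obtain ⟨ι, _, _, χ, h⟩ := ih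
    by_cases ha : a = 0
    · refine ⟨ι, inferInstance, inferInstance, χ, fun t ht ht0 => ?_⟩
      rcases Finset.mem_insert.1 ht with rfl | ht
      · exact absurd ha ht0
      · exact h t ht ht0
    · obtain ⟨ψ, h1, N, hN, h2⟩ := ratchar_exists a ha
      have : Nonempty (Fin N) := ⟨⟨0, hN⟩⟩
      refine ⟨ι × Fin N, inferInstance, inferInstance, fun i => χ i.1 + (i.2 : ℕ) • ψ, ?_⟩
      intro t ht ht0
      have e : ∀ i : ι × Fin N, ev (χ i.1 + (i.2 : ℕ) • ψ) t = ev (χ i.1) t * (ev ψ t) ^ (i.2 : ℕ) := by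
        intro i
        simp [ev, AddCircle.toCircle_add, AddCircle.toCircle_nsmul]
      simp only [e]
      rw [Fintype.sum_prod_type]
      simp only [← Finset.mul_sum, ← Finset.sum_mul]
      rcases Finset.mem_insert.1 ht with rfl | ht
      · have z1 : ev ψ t ≠ 1 := by
          intro h
          apply h1
          apply AddCircle.injective_toCircle (T := 1) (by norm_num)
          rw [AddCircle.toCircle_zero]
          exact Subtype.ext (by simpa [ev] using h)
        have z2 : (ev ψ t)^N = 1 := by
          have : AddCircle.toCircle (N • ψ t) = 1 := by rw [h2, AddCircle.toCircle_zero]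
          rw [AddCircle.toCircle_nsmul] at this
          have := congrArg (fun c : Circle => (c:ℂ)) this
          simpa [ev] using this
        rw [Fin.sum_univ_eq_sum_range (fun k => (ev ψ t)^k), geom_sum_eq z1, z2]
        simp
      · rw [h t ht ht0, zero_mul]

lemma fiber_cs {J : Type*} [Fintype J] [DecidableEq G] (ψ : J → G) (S : Finset G) (hS : ∀ j, ψ j ∈ S) :
    (Fintype.card J : ℝ)^2 ≤ S.card * ((Finset.univ.filter fun ab : J × J => ψ ab.1 = ψ ab.2).card : ℝ) := by
  have h1 : (Fintype.card J : ℝ) = ∑ s ∈ S, ((Finset.univ.filter fun j => ψ j = s).card : ℝ) := by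
    rw [← Finset.card_univ, Finset.card_eq_sum_card_fiberwise (f := ψ) (t := S) (fun j _ => hS j)]
    simp
  have h2 : ((Finset.univ.filter fun ab : J × J => ψ ab.1 = ψ ab.2).card : ℝ)
      = ∑ s ∈ S, ((Finset.univ.filter fun j => ψ j = s).card : ℝ)^2 := by
    rw [Finset.card_eq_sum_card_fiberwise (f := fun ab : J × J => ψ ab.1) (t := S) (fun j _ => hS _)]
    push_cast
    refine Finset.sum_congr rfl fun s _ => ?_
    rw [sq, ← Nat.cast_mul, ← Finset.card_product]
    congr 2
    ext ⟨a, b⟩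
    simp only [Finset.mem_filter, Finset.mem_univ, true_and, Finset.mem_product]
    constructor
    · rintro ⟨h, rfl⟩; exact ⟨rfl, h.symm⟩
    · rintro ⟨rfl, h⟩; exact ⟨h.symm, rfl⟩
  rw [h1, h2]
  exact sq_sum_le_card_mul_sum_sq

lemma dual_count {J : Type*} [Fintype J] [DecidableEq G] {ι : Type} [Fintype ι] (χ : ι → (G →+ AddCircle (1:ℝ)))
    (g : J → G) (h : ∀ j, g j ≠ 0 → ∑ i, ev (χ i) (g j) = 0) :
    ∑ i, ∑ j, ev (χ i) (g j) = (Fintype.card ι : ℂ) * ((Finset.univ.filter fun j => g j = 0).card : ℂ) := by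
  rw [Finset.sum_comm, Finset.card_filter]
  push_cast
  rw [Finset.mul_sum]
  refine Finset.sum_congr rfl fun j _ => ?_
  by_cases hj : g j = 0
  · simp [hj, ev_zero]
  · simp [hj, h j hj]

lemma fourier_L {Ω : Type*} [Fintype Ω] [Nonempty Ω] [DecidableEq G] (φ : Ω → G) (M' C c : ℝ) (hM : 0 < M')
    (h2 : ((Finset.univ.filter fun ab : Ω × Ω => φ ab.1 = φ ab.2).card : ℝ) * M' ≤ (Fintype.card Ω : ℝ)^2)
    (S : Finset G) (hS : ∀ a b, φ a + φ b ∈ S) (hSC : (S.card : ℝ) ≤ C * M')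
    (hc : 4*c^2*C ≤ 1) (Dom : Finset G) :
    ∃ Γ : Finset (G →+ AddCircle (1:ℝ)), (∀ γ ∈ Γ, c * Fintype.card Ω ≤ ‖∑ ω, ev γ (φ ω)‖) ∧
      ∀ v ∈ Dom, (∀ γ ∈ Γ, ‖γ v‖ ≤ 1/16) → ∃ a b c d, v = φ a + φ b - φ c - φ d := by
  classical
  let T : Finset G := (Finset.univ.image fun x : Ω × Ω => φ x.1 - φ x.2) ∪
    ((Finset.univ : Finset ((Ω × Ω) × (Ω × Ω))) ×ˢ (insert 0 Dom)).image
      (fun x => φ x.1.1.1 + φ x.1.1.2 - (φ x.1.2.1 + φ x.1.2.2) - x.2)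
  obtain ⟨ι, _, _, χ, hχ⟩ := exists_dual T
  set n : ℝ := (Fintype.card Ω : ℝ) with hn
  have hnpos : 0 < n := by rw [hn]; exact_mod_cast Fintype.card_pos
  have hιpos : (0:ℝ) < Fintype.card ι := by exact_mod_cast Fintype.card_pos
  let F : ι → ℂ := fun i => ∑ ω, ev (χ i) (φ ω)
  refine ⟨(Finset.univ.filter fun i => c * n ≤ ‖F i‖).image χ, ?_, ?_⟩
  · intro γ hγ
    obtain ⟨i, hi, rfl⟩ := Finset.mem_image.1 hγ
    exact (Finset.mem_filter.1 hi).2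
  intro v hv hsmall
  by_contra hno
  push Not at hno
  -- second moment
  have sec : ∑ i, ‖F i‖^2 = Fintype.card ι * ((Finset.univ.filter fun ab : Ω × Ω => φ ab.1 = φ ab.2).card : ℝ) := by
    have := dual_count χ (fun x : Ω × Ω => φ x.1 - φ x.2) (fun j hj => hχ _ (by
      apply Finset.mem_union_left; exact Finset.mem_image_of_mem _ (Finset.mem_univ j)) hj)
    have e : ∀ i, ∑ x : Ω × Ω, ev (χ i) (φ x.1 - φ x.2) = ((‖F i‖^2 : ℝ) : ℂ) := by
      intro i
      have : ((‖F i‖^2 : ℝ) : ℂ) = F i * (starRingEnd ℂ) (F i) := by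
        rw [Complex.mul_conj, Complex.normSq_eq_norm_sq]
      rw [this, Fintype.sum_prod_type]
      simp only [sub_eq_add_neg, ev_add, ev_neg, F, map_sum, Finset.sum_mul_sum]
    simp only [e, sub_eq_zero] at this
    exact_mod_cast this
  have four : ∀ w ∈ insert 0 Dom, ∑ i, ((‖F i‖^4 : ℝ) : ℂ) * ev (χ i) (-w) = (Fintype.card ι : ℂ) *
      ((Finset.univ.filter fun x : (Ω × Ω) × (Ω × Ω) => φ x.1.1 + φ x.1.2 - (φ x.2.1 + φ x.2.2) - w = 0).card : ℂ) := by
    intro w hw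
    rw [← dual_count χ (fun x : (Ω × Ω) × (Ω × Ω) => φ x.1.1 + φ x.1.2 - (φ x.2.1 + φ x.2.2) - w) (fun j hj => hχ _ (by
      apply Finset.mem_union_right
      exact Finset.mem_image.2 ⟨(j, w), Finset.mem_product.2 ⟨Finset.mem_univ _, hw⟩, rfl⟩) hj)]
    refine Finset.sum_congr rfl fun i _ => ?_
    have : ((‖F i‖^4 : ℝ) : ℂ) = (F i * F i) * ((starRingEnd ℂ) (F i) * (starRingEnd ℂ) (F i)) := by
      have : ((‖F i‖^2 : ℝ) : ℂ) = F i * (starRingEnd ℂ) (F i) := by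
        rw [Complex.mul_conj, Complex.normSq_eq_norm_sq]
      have e : ((‖F i‖^4 : ℝ) : ℂ) = ((‖F i‖^2 : ℝ) : ℂ) * ((‖F i‖^2 : ℝ) : ℂ) := by
        push_cast; ring
      rw [e, this]; ring
    rw [this, Fintype.sum_prod_type]
    simp only [Fintype.sum_prod_type]
    simp only [sub_eq_add_neg, neg_add, ev_add, ev_neg, F, map_sum]
    rw [Finset.sum_mul_sum, Finset.sum_mul_sum]
    simp only [← Finset.sum_mul, ← Finset.mul_sum]
  have hv0 := four v (Finset.mem_insert_of_mem hv)
  have hz : (Finset.univ.filter fun x : (Ω × Ω) × (Ω × Ω) => φ x.1.1 + φ x.1.2 - (φ x.2.1 + φ x.2.2) - v = 0) = ∅ := by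
    rw [Finset.filter_eq_empty_iff]
    intro x _ hx
    refine hno x.1.1 x.1.2 x.2.1 x.2.2 ?_
    rw [sub_eq_zero] at hx
    rw [← hx]; abel
  rw [hz] at hv0
  have h00 := four 0 (Finset.mem_insert_self _ _)
  simp only [neg_zero, ev_zero, mul_one, sub_zero, sub_eq_zero] at h00
  have h00' : ∑ i, ‖F i‖^4 = (Fintype.card ι : ℝ) * ((Finset.univ.filter fun x : (Ω × Ω) × (Ω × Ω) => φ x.1.1 + φ x.1.2 = (φ x.2.1 + φ x.2.2)).card : ℝ) := by
    exact_mod_cast h00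
  have cs := fiber_cs (fun x : Ω × Ω => φ x.1 + φ x.2) S (fun x => hS _ _)
  rw [Fintype.card_prod] at cs
  push_cast at cs
  rw [← hn] at cs
  have hre : ∑ i, ‖F i‖^4 * (ev (χ i) (-v)).re = 0 := by
    have := congrArg Complex.re hv0
    simpa [Complex.re_sum, ← Complex.ofReal_pow, Complex.re_ofReal_mul] using this
  have term : ∀ i, ‖F i‖^4 / 2 - (3/2) * (c^2*n^2) * ‖F i‖^2 ≤ ‖F i‖^4 * (ev (χ i) (-v)).re := by
    intro i
    by_cases hi : c * n ≤ ‖F i‖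
    · have h1 : 1/2 ≤ (ev (χ i) (-v)).re := by
        apply re_ev_ge
        rw [map_neg, norm_neg]
        exact hsmall _ (Finset.mem_image_of_mem _ (Finset.mem_filter.2 ⟨Finset.mem_univ _, hi⟩))
      have h3 : 0 ≤ (3/2) * (c^2*n^2) * ‖F i‖^2 := by positivity
      have h4 : 0 ≤ ‖F i‖^4 := by positivity
      nlinarith
    · push Not at hi
      have h1 : -1 ≤ (ev (χ i) (-v)).re := by
        have := Complex.abs_re_le_norm (ev (χ i) (-v))
        rw [ev_norm] at this
        exact (abs_le.1 this).1
      have h4 : 0 ≤ ‖F i‖^4 := by positivity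
      have h5 : ‖F i‖^2 ≤ c^2*n^2 := by
        rw [← mul_pow]; exact pow_le_pow_left₀ (norm_nonneg _) hi.le 2
      have h6 : 0 ≤ ‖F i‖^2 := by positivity
      have h7 : ‖F i‖^4 = ‖F i‖^2 * ‖F i‖^2 := by ring
      nlinarith
  have tot := Finset.sum_le_sum (fun i (_ : i ∈ Finset.univ) => term i)
  rw [hre, Finset.sum_sub_distrib, ← Finset.sum_div, ← Finset.mul_sum, sec, h00'] at tot
  set N4 : ℝ := ((Finset.univ.filter fun x : (Ω × Ω) × (Ω × Ω) => φ x.1.1 + φ x.1.2 = (φ x.2.1 + φ x.2.2)).card : ℝ)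
  set N2 : ℝ := ((Finset.univ.filter fun ab : Ω × Ω => φ ab.1 = φ ab.2).card : ℝ)
  have t1 : N4 ≤ 3 * (c^2*n^2) * N2 := by
    have : (Fintype.card ι : ℝ) * N4 ≤ Fintype.card ι * (3 * (c^2*n^2) * N2) := by nlinarith
    exact le_of_mul_le_mul_left this hιpos
  have hN4 : 0 ≤ N4 := by positivity
  have hN2 : 0 ≤ N2 := by positivity
  have t2 : (n*n)^2 ≤ C * M' * N4 := cs.trans (mul_le_mul_of_nonneg_right hSC hN4)
  have hC : 0 < C := by
    have : 0 < (n*n)^2 := by positivity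
    by_contra hC
    push Not at hC
    have : C * M' ≤ 0 := mul_nonpos_of_nonpos_of_nonneg hC hM.le
    nlinarith
  have t3 : (n*n)^2 ≤ C * (3 * (c^2*n^2) * (n^2)) := by
    calc (n*n)^2 ≤ C * M' * N4 := t2
      _ ≤ C * M' * (3 * (c^2*n^2) * N2) := by gcongr
      _ = C * (3 * (c^2*n^2)) * (N2 * M') := by ring
      _ ≤ C * (3 * (c^2*n^2)) * n^2 := by gcongr
      _ = _ := by ring
  have t4 : (n^4) * (4*c^2*C) ≤ n^4 * 1 := by gcongr
  have : 0 < n^4 := by positivity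
  nlinarith

end Fourier


section Cover

/-- `S` is covered by at most `N` translates of `X`. -/
def Cov {R : Type u} [AddCommGroup R] (N : ℕ) (S X : Set R) : Prop :=
  ∃ F : Finset R, F.card ≤ N ∧ S ⊆ (F : Set R) + X

variable {R : Type u} [AddCommGroup R]

lemma Cov.mono {N N' : ℕ} {S S' X : Set R} (h : Cov N S X) (hN : N ≤ N') (hS : S' ⊆ S) : Cov N' S' X := by
  obtain ⟨F, h1, h2⟩ := h
  exact ⟨F, h1.trans hN, hS.trans h2⟩

lemma Cov.right {N : ℕ} {S X X' : Set R} (h : Cov N S X) (hS : X ⊆ X') : Cov N S X' := by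
  obtain ⟨F, h1, h2⟩ := h
  exact ⟨F, h1, h2.trans (Set.add_subset_add_left hS)⟩

lemma Cov.self (X : Set R) : Cov 1 X X := ⟨{0}, by simp, by simp⟩

lemma Cov.trans {N N' : ℕ} {S T X : Set R} (h : Cov N S T) (h' : Cov N' T X) : Cov (N*N') S X := by
  classical
  obtain ⟨F, h1, h2⟩ := h
  obtain ⟨F', h1', h2'⟩ := h'
  refine ⟨F + F', (Finset.card_add_le).trans (Nat.mul_le_mul h1 h1'), ?_⟩
  refine h2.trans ((Set.add_subset_add_left h2').trans ?_)
  rw [← add_assoc]; push_cast; rfl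

lemma Cov.add {N N' : ℕ} {S S' X X' : Set R} (h : Cov N S X) (h' : Cov N' S' X') :
    Cov (N*N') (S+S') (X+X') := by
  classical
  obtain ⟨F, h1, h2⟩ := h
  obtain ⟨F', h1', h2'⟩ := h'
  refine ⟨F + F', (Finset.card_add_le).trans (Nat.mul_le_mul h1 h1'), ?_⟩
  refine (Set.add_subset_add h2 h2').trans ?_
  rw [Finset.coe_add, add_add_add_comm]

lemma Cov.add_same {N N' K : ℕ} {S S' X : Set R} (h : Cov N S X) (h' : Cov N' S' X)
    (hK : Cov K (X+X) X) : Cov (N*N'*K) (S+S') X := (h.add h').trans hK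

lemma Cov.biUnion {ι : Type*} {N M : ℕ} {S X : Set R} (F : Finset ι) (hF : F.card ≤ M) (T : ι → Set R)
    (h : ∀ i ∈ F, Cov N (T i) X) (hS : ∀ x ∈ S, ∃ i ∈ F, x ∈ T i) : Cov (M*N) S X := by
  classical
  choose! E h1 h2 using h
  refine ⟨F.biUnion E, ?_, ?_⟩
  · exact (Finset.card_biUnion_le_card_mul _ _ _ h1).trans (Nat.mul_le_mul_right _ hF)
  · intro x hx
    obtain ⟨i, hi, hxi⟩ := hS x hx
    obtain ⟨e, he, y, hy, rfl⟩ := h2 i hi hxi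
    exact ⟨e, by simpa using ⟨i, hi, he⟩, y, hy, rfl⟩

/-- shrink the covering set so that each translate meets `S`. -/
lemma Cov.shrink {N : ℕ} {S X : Set R} (h : Cov N S X) : ∃ F : Finset R, F.card ≤ N ∧ S ⊆ (F : Set R) + X ∧
    ∀ f ∈ F, ∃ x ∈ X, f + x ∈ S := by
  classical
  obtain ⟨F, h1, h2⟩ := h
  refine ⟨F.filter (fun f => ∃ x ∈ X, f + x ∈ S), (Finset.card_filter_le _ _).trans h1, ?_, ?_⟩
  · intro s hs
    obtain ⟨e, he, y, hy, rfl⟩ := h2 hs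
    exact ⟨e, by simpa using ⟨he, y, hy, hs⟩, y, hy, rfl⟩
  · intro f hf
    exact (Finset.mem_filter.1 hf).2

lemma Cov.card {N : ℕ} {S X : Finset R} (h : Cov N (S : Set R) X) : S.card ≤ N * X.card := by
  classical
  obtain ⟨F, h1, h2⟩ := h
  have : S ⊆ F + X := by
    intro x hx
    have := h2 (Finset.mem_coe.2 hx)
    rw [← Finset.coe_add] at this
    exact_mod_cast this
  exact (Finset.card_le_card this).trans ((Finset.card_add_le).trans (Nat.mul_le_mul_right _ h1))

lemma Cov.finite {N : ℕ} {S X : Set R} (h : Cov N S X) (hX : X.Finite) : S.Finite := by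
  obtain ⟨F, _, h2⟩ := h
  exact (F.finite_toSet.add hX).subset h2
end Cover

section Iter
variable {R : Type u} [NonUnitalRing R]

lemma AddSymm.neg_mem {X : Set R} (h : AddSymm X) {x : R} (hx : x ∈ X) : -x ∈ X := by
  rw [h.2]; simpa using hx

lemma AddSymm.mk' {X : Set R} (h0 : (0:R) ∈ X) (h : ∀ x ∈ X, -x ∈ X) : AddSymm X := by
  refine ⟨h0, ?_⟩
  ext x
  constructor
  · intro hx; exact h x hx
  · intro hx
    have := h _ hx
    simpa using this

lemma iterX_symm {X : Set R} (h : AddSymm X) (n : ℕ) : AddSymm (iterX X n) := by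
  induction n with
  | zero => exact h
  | succ n ih =>
    apply AddSymm.mk'
    · exact ⟨0, ⟨0, ih.1, 0, ih.1, by simp⟩, 0, ⟨0, ih.1, 0, ih.1, by simp⟩, by simp⟩
    · rintro _ ⟨_, ⟨a, ha, b, hb, rfl⟩, _, ⟨c, hc, d, hd, rfl⟩, rfl⟩
      exact ⟨_, ⟨_, ih.neg_mem ha, _, ih.neg_mem hb, rfl⟩, _, ⟨_, ih.neg_mem hc, _, hd, rfl⟩, by
        simp; abel⟩

lemma iterX_add {X : Set R} (h : AddSymm X) {n : ℕ} {a b : R} (ha : a ∈ iterX X n) (hb : b ∈ iterX X n) :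
    a + b ∈ iterX X (n+1) :=
  ⟨_, ⟨a, ha, b, hb, rfl⟩, 0, ⟨0, (iterX_symm h n).1, 0, (iterX_symm h n).1, by simp⟩, by simp⟩

lemma iterX_mul {X : Set R} (h : AddSymm X) {n : ℕ} {a b : R} (ha : a ∈ iterX X n) (hb : b ∈ iterX X n) :
    a * b ∈ iterX X (n+1) :=
  ⟨0, ⟨0, (iterX_symm h n).1, 0, (iterX_symm h n).1, by simp⟩, _, ⟨a, ha, b, hb, rfl⟩, by simp⟩

lemma iterX_mono {X : Set R} (h : AddSymm X) {m n : ℕ} (hmn : m ≤ n) : iterX X m ⊆ iterX X n := by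
  induction hmn with
  | refl => exact subset_rfl
  | step _ ih =>
    intro x hx
    have := iterX_add h (ih hx) (iterX_symm h _).1
    simpa using this

/-- multiplication by `g` preserves covering numbers. -/
def GoodMul (X : Set R) (D : ℕ → ℕ) (g : R) : Prop :=
  ∀ N S, Cov N S X → Cov (D N) ({g} * S) X ∧ Cov (D N) (S * {g}) X

lemma goodMul_base {K : ℕ} {X : Set R} (hm : Cov K (X*X) X) {g : R} (hg : g ∈ X) :
    GoodMul X (fun N => N * K) g := by
  classical
  rintro N S ⟨F, h1, h2⟩
  constructor
  · have : Cov N ({g} * S) (X*X) := by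
      refine ⟨F.image (fun f => g * f), Finset.card_image_le.trans h1, ?_⟩
      rintro _ ⟨g', hg', s, hs, rfl⟩
      obtain rfl : g' = g := hg'
      obtain ⟨f, hf, x, hx, rfl⟩ := h2 hs
      exact ⟨g' * f, by simpa using ⟨f, hf, rfl⟩, g' * x, ⟨g', hg, x, hx, rfl⟩, by simp [mul_add]⟩
    exact this.trans hm
  · have : Cov N (S * {g}) (X*X) := by
      refine ⟨F.image (fun f => f * g), Finset.card_image_le.trans h1, ?_⟩
      rintro _ ⟨s, hs, g', hg', rfl⟩
      obtain rfl : g' = g := hg'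
      obtain ⟨f, hf, x, hx, rfl⟩ := h2 hs
      exact ⟨f * g', by simpa using ⟨f, hf, rfl⟩, x * g', ⟨x, hx, g', hg, rfl⟩, by simp [add_mul]⟩
    exact this.trans hm

lemma GoodMul.add {K : ℕ} {X : Set R} (h2 : Cov K (X+X) X) {D D' : ℕ → ℕ} {a b : R} (ha : GoodMul X D a)
    (hb : GoodMul X D' b) : GoodMul X (fun N => D N * D' N * K) (a+b) := by
  intro N S hS
  constructor
  · refine ((ha N S hS).1.add_same (hb N S hS).1 h2).mono le_rfl ?_
    rintro _ ⟨_, rfl, s, hs, rfl⟩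
    exact ⟨a * s, ⟨a, rfl, s, hs, rfl⟩, b * s, ⟨b, rfl, s, hs, rfl⟩, by simp [add_mul]⟩
  · refine ((ha N S hS).2.add_same (hb N S hS).2 h2).mono le_rfl ?_
    rintro _ ⟨s, hs, _, rfl, rfl⟩
    exact ⟨s * a, ⟨s, hs, a, rfl, rfl⟩, s * b, ⟨s, hs, b, rfl, rfl⟩, by simp [mul_add]⟩

lemma GoodMul.mul {X : Set R} {D : ℕ → ℕ} {a b : R} (ha : GoodMul X D a)
    (hb : GoodMul X D b) : GoodMul X (fun N => D (D N)) (a*b) := by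
  intro N S hS
  constructor
  · have := (ha _ _ (hb _ _ hS).1).1
    rwa [← mul_assoc, Set.singleton_mul_singleton] at this
  · have := (hb _ _ (ha _ _ hS).2).2
    rwa [mul_assoc, Set.singleton_mul_singleton] at this

lemma approx_cov {K : ℕ} {X : Set R} (h : IsApproxSubringWith K X) : Cov K (X*X) X ∧ Cov K (X+X) X := by
  obtain ⟨F, h1, h2⟩ := h.2
  exact ⟨⟨F, h1, Set.subset_union_left.trans h2⟩, ⟨F, h1, Set.subset_union_right.trans h2⟩⟩

lemma goodMul_iter (K j : ℕ) : ∃ D : ℕ → ℕ, ∀ (R : Type u) [NonUnitalRing R] (X : Set R),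
    IsApproxSubringWith K X → ∀ g ∈ iterX X j, GoodMul X D g := by
  induction j with
  | zero => exact ⟨_, fun R _ X h g hg => goodMul_base (approx_cov h).1 hg⟩
  | succ j ih =>
    obtain ⟨D, hD⟩ := ih
    refine ⟨fun N => (D N * D N * K) * D (D N) * K, fun R _ X h g hg => ?_⟩
    obtain ⟨_, ⟨a, ha, b, hb, rfl⟩, _, ⟨c, hc, d, hd, rfl⟩, rfl⟩ := hg
    have h2 := (approx_cov h).2
    exact ((hD R X h a ha).add h2 (hD R X h b hb)).add h2 ((hD R X h c hc).mul (hD R X h d hd))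

lemma cov_iter (K j : ℕ) : ∃ N : ℕ, ∀ (R : Type u) [NonUnitalRing R] (X : Set R),
    IsApproxSubringWith K X → Cov N (iterX X j) X := by
  induction j with
  | zero => exact ⟨1, fun R _ X _ => Cov.self X⟩
  | succ j ih =>
    obtain ⟨N, hN⟩ := ih
    obtain ⟨D, hD⟩ := goodMul_iter.{u} K j
    -- bound for products with a fixed f
    let D2 : ℕ → ℕ := fun n => D n * D n * K
    refine ⟨N * N * K * ((N * D2 N) * ((N * D2 1) * K * K) * K) * K, fun R _ X h => ?_⟩
    obtain ⟨hm, h2⟩ := approx_cov h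
    have hc := hN R X h
    obtain ⟨F, hF1, hF2, hF3⟩ := hc.shrink
    have hg : ∀ f ∈ F, GoodMul X D2 f := by
      intro f hf
      obtain ⟨x, hx, hfx⟩ := hF3 f hf
      have := (hD R X h _ hfx).add h2 (hD R X h (-x) (iterX_mono h.1 (Nat.zero_le j) (h.1.neg_mem hx)))
      simpa using this
    have c1 : Cov ((N * D2 1) * K * K) (X * iterX X j) X := by
      have a1 : Cov (N * D2 1) (X * (F : Set R)) X := by
        refine Cov.biUnion F hF1 (fun f => X * {f}) (fun f hf => (hg f hf 1 X (Cov.self X)).2) ?_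
        rintro _ ⟨x, hx, f, hf, rfl⟩
        exact ⟨f, hf, x, hx, f, rfl, rfl⟩
      refine (a1.add_same hm h2).mono le_rfl ?_
      rintro _ ⟨x, hx, y, hy, rfl⟩
      obtain ⟨f, hf, z, hz, rfl⟩ := hF2 hy
      exact ⟨x * f, ⟨x, hx, f, hf, rfl⟩, x * z, ⟨x, hx, z, hz, rfl⟩, by simp [mul_add]⟩
    have c2 : Cov (N * D2 N) ((F : Set R) * iterX X j) X := by
      refine Cov.biUnion F hF1 (fun f => {f} * iterX X j) (fun f hf => (hg f hf N _ hc).1) ?_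
      rintro _ ⟨f, hf, x, hx, rfl⟩
      exact ⟨f, hf, f, rfl, x, hx, rfl⟩
    have c3 : Cov ((N * D2 N) * ((N * D2 1) * K * K) * K) (iterX X j * iterX X j) X := by
      refine (c2.add_same c1 h2).mono le_rfl ?_
      rintro _ ⟨x, hx, y, hy, rfl⟩
      obtain ⟨f, hf, z, hz, rfl⟩ := hF2 hx
      exact ⟨f * y, ⟨f, hf, y, hy, rfl⟩, z * y, ⟨z, hz, y, hy, rfl⟩, by simp [add_mul]⟩
    exact (hc.add_same hc h2).add_same c3 h2

end Iter

section MWsec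

lemma card_filter_sub_neg {G : Type u} [AddCommGroup G] [DecidableEq G] (B : Finset G) (g : G) :
    (B.filter (fun z => z - -g ∈ B)).card = (B.filter (fun z => z - g ∈ B)).card := by
  refine Finset.card_bij (fun z _ => z + g) ?_ ?_ ?_
  · intro z hz
    simp only [Finset.mem_filter, sub_neg_eq_add, add_sub_cancel_right] at hz ⊢
    exact hz.symm
  · intro a _ b _ h
    simpa using h
  · intro b hb
    simp only [Finset.mem_filter] at hb
    refine ⟨b - g, ?_, by simp⟩
    simp only [Finset.mem_filter, sub_neg_eq_add, sub_add_cancel]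
    exact hb.symm

lemma MW_aux (K η : ℝ) (hK : 1 ≤ K) (hη : 0 < η) (hη1 : η < 1) (n : ℕ) : ∀ t : ℝ, 0 < t → ∃ τ : ℝ, 0 < τ ∧
    ∀ (G : Type u) [AddCommGroup G] [DecidableEq G] (X B : Finset G), (∀ x ∈ X, -x ∈ X) → X.Nonempty →
      ((X + X).card : ℝ) ≤ K * X.card → B ⊆ X → t * X.card ≤ B.card →
      ((X + B).card : ℝ) * (1-η)^n < X.card →
      ∃ Z S : Finset G, Z ⊆ X + X ∧ X.card ≤ Z.card ∧ (0:G) ∈ S ∧ (∀ s ∈ S, -s ∈ S) ∧ S ⊆ X + X ∧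
        τ * X.card ≤ S.card ∧ ∀ s ∈ S, (1-η) * Z.card ≤ (Z.filter (fun z => z - s ∈ Z)).card := by
  induction n with
  | zero =>
    intro t ht
    refine ⟨1, one_pos, ?_⟩
    intro G _ _ X B hneg hX hXX hB htB hlt
    exfalso
    have hXpos : (0:ℝ) < X.card := by exact_mod_cast hX.card_pos
    have hBpos : (0:ℝ) < B.card := lt_of_lt_of_le (by positivity) htB
    have hBne : B.Nonempty := Finset.card_pos.1 (by exact_mod_cast hBpos)
    have := Finset.card_le_card_add_right (s := X) hBne
    have : (X.card : ℝ) ≤ (X+B).card := by exact_mod_cast this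
    simp at hlt
    linarith [show ((X+B).card : ℝ) < X.card by exact_mod_cast hlt]
  | succ n ih =>
    intro t ht
    obtain ⟨τ', hτ', H⟩ := ih (t^2/(2*K)) (by positivity)
    refine ⟨min (t^2/2) τ', by positivity, ?_⟩
    intro G _ _ X B hneg hX hXX hB htB hlt
    have hXpos : (0:ℝ) < X.card := by exact_mod_cast hX.card_pos
    have hBpos : (0:ℝ) < B.card := lt_of_lt_of_le (by positivity) htB
    have hBne : B.Nonempty := Finset.card_pos.1 (by exact_mod_cast hBpos)
    have hBX : (B.card : ℝ) ≤ X.card := by exact_mod_cast Finset.card_le_card hB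
    have ht1 : t ≤ 1 := by
      by_contra h
      push Not at h
      nlinarith
    let S := (B - B).filter (fun g => t^2/(2*K) * X.card ≤ ((B.filter (fun z => z - g ∈ B)).card : ℝ))
    have hBB : B - B ⊆ X + X := by
      intro x hx
      obtain ⟨a, ha, b, hb, rfl⟩ := Finset.mem_sub.1 hx
      rw [sub_eq_add_neg]
      exact Finset.add_mem_add (hB ha) (hneg _ (hB hb))
    by_cases hgood : ∀ s ∈ S, (1-η) * (X+B).card ≤ ((X+B).filter (fun z => z - s ∈ X + B)).card
    · refine ⟨X + B, S, Finset.add_subset_add_left hB, Finset.card_le_card_add_right hBne, ?_, ?_, ?_, ?_, hgood⟩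
      · refine Finset.mem_filter.2 ⟨?_, ?_⟩
        · obtain ⟨b, hb⟩ := hBne
          exact Finset.mem_sub.2 ⟨b, hb, b, hb, sub_self b⟩
        · have : B.filter (fun z => z - 0 ∈ B) = B := by simp
          rw [this]
          refine le_trans ?_ htB
          gcongr
          rw [div_le_iff₀ (by positivity)]
          nlinarith
      · intro s hs
        obtain ⟨h1, h2⟩ := Finset.mem_filter.1 hs
        refine Finset.mem_filter.2 ⟨?_, ?_⟩
        · obtain ⟨a, ha, b, hb, rfl⟩ := Finset.mem_sub.1 h1
          exact Finset.mem_sub.2 ⟨b, hb, a, ha, by abel⟩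
        · rwa [card_filter_sub_neg]
      · exact (Finset.filter_subset _ _).trans hBB
      · have hsum : (B.card : ℝ)^2 = ∑ g ∈ B - B, ((B.filter (fun z => z - g ∈ B)).card : ℝ) := by
          rw [sq, ← Nat.cast_mul, ← Finset.card_product]
          rw [Finset.card_eq_sum_card_fiberwise (f := fun x : G × G => x.1 - x.2) (t := B - B)]
          · push_cast
            refine Finset.sum_congr rfl fun g _ => ?_
            congr 1
            refine Finset.card_bij (fun x _ => x.1) ?_ ?_ ?_
            · rintro ⟨a, b⟩ h
              simp only [Finset.mem_filter, Finset.mem_product] at h ⊢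
              obtain ⟨⟨ha, hb⟩, rfl⟩ := h
              exact ⟨ha, by simpa using hb⟩
            · rintro ⟨a, b⟩ h ⟨a', b'⟩ h' e
              simp only [Finset.mem_filter, Finset.mem_product] at h h' e
              subst e
              have := h.2.trans h'.2.symm
              simp at this
              rw [this]
            · intro a h
              simp only [Finset.mem_filter] at h
              exact ⟨(a, a - g), by simp [h.1, h.2], rfl⟩
          · intro x hx
            have hx' := Finset.mem_product.1 (Finset.mem_coe.1 hx)
            exact Finset.mem_coe.2 (Finset.sub_mem_sub hx'.1 hx'.2)
        have hsplit : ∑ g ∈ B - B, ((B.filter (fun z => z - g ∈ B)).card : ℝ)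
            ≤ S.card * X.card + (B - B).card * (t^2/(2*K) * X.card) := by
          rw [← Finset.sum_filter_add_sum_filter_not (B - B) (fun g => t^2/(2*K) * X.card ≤ ((B.filter (fun z => z - g ∈ B)).card : ℝ))]
          refine add_le_add ?_ ?_
          · refine (Finset.sum_le_card_nsmul _ _ (X.card : ℝ) ?_).trans ?_
            · intro g _
              exact_mod_cast (Finset.card_filter_le _ _).trans (Finset.card_le_card hB)
            · simp [S]
          · refine (Finset.sum_le_card_nsmul _ _ (t^2/(2*K) * X.card : ℝ) ?_).trans ?_
            · intro g hg
              exact (not_le.1 (Finset.mem_filter.1 hg).2).le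
            · rw [nsmul_eq_mul]
              gcongr
              exact Finset.filter_subset _ _
        have hBBc : ((B - B).card : ℝ) ≤ K * X.card :=
          le_trans (by exact_mod_cast Finset.card_le_card hBB) hXX
        have h3 : ((B - B).card : ℝ) * (t^2/(2*K) * X.card) ≤ t^2/2 * X.card * X.card := by
          calc ((B - B).card : ℝ) * (t^2/(2*K) * X.card) ≤ (K * X.card) * (t^2/(2*K) * X.card) := by gcongr
            _ = _ := by field_simp
        have h4 : (t * X.card)^2 ≤ (B.card : ℝ)^2 := by gcongr
        have h5 : (t^2/2 * X.card) * X.card ≤ S.card * (X.card : ℝ) := by nlinarith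
        have h6 := le_of_mul_le_mul_right h5 hXpos
        refine le_trans ?_ h6
        gcongr
        exact min_le_left _ _
    · push Not at hgood
      obtain ⟨g, hg, hbad⟩ := hgood
      obtain ⟨_, hg2⟩ := Finset.mem_filter.1 hg
      obtain ⟨Z, S', a1, a2, a3, a4, a5, a6, a7⟩ := H G X (B.filter (fun z => z - g ∈ B)) hneg hX hXX
        ((Finset.filter_subset _ _).trans hB) hg2 (by
          have hsub : X + B.filter (fun z => z - g ∈ B) ⊆ (X+B).filter (fun z => z - g ∈ X + B) := by
            intro x hx
            obtain ⟨a, ha, b, hb, rfl⟩ := Finset.mem_add.1 hx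
            obtain ⟨hb1, hb2⟩ := Finset.mem_filter.1 hb
            refine Finset.mem_filter.2 ⟨Finset.add_mem_add ha hb1, ?_⟩
            rw [add_sub_assoc]
            exact Finset.add_mem_add ha hb2
          have h1 : ((X + B.filter (fun z => z - g ∈ B)).card : ℝ) ≤ ((X+B).filter (fun z => z - g ∈ X + B)).card := by
            exact_mod_cast Finset.card_le_card hsub
          have h2 : (0:ℝ) < (1-η)^n := pow_pos (by linarith) n
          calc ((X + B.filter (fun z => z - g ∈ B)).card : ℝ) * (1-η)^n
              ≤ ((1-η) * (X+B).card) * (1-η)^n := by gcongr; exact h1.trans hbad.le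
            _ = (X+B).card * (1-η)^(n+1) := by ring
            _ < _ := hlt)
      refine ⟨Z, S', a1, a2, a3, a4, a5, le_trans ?_ a6, a7⟩
      gcongr
      exact min_le_right _ _

lemma MW (K η : ℝ) (hK : 1 ≤ K) (hη : 0 < η) (hη1 : η < 1) : ∃ τ : ℝ, 0 < τ ∧
    ∀ (G : Type u) [AddCommGroup G] [DecidableEq G] (X : Finset G), (∀ x ∈ X, -x ∈ X) → X.Nonempty →
      ((X + X).card : ℝ) ≤ K * X.card →
      ∃ Z S : Finset G, Z ⊆ X + X ∧ X.card ≤ Z.card ∧ (0:G) ∈ S ∧ (∀ s ∈ S, -s ∈ S) ∧ S ⊆ X + X ∧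
        τ * X.card ≤ S.card ∧ ∀ s ∈ S, (1-η) * Z.card ≤ (Z.filter (fun z => z - s ∈ Z)).card := by
  obtain ⟨n, hn⟩ := exists_pow_lt_of_lt_one (show (0:ℝ) < 1/K by positivity) (show 1 - η < 1 by linarith)
  obtain ⟨τ, hτ, H⟩ := MW_aux.{u} K η hK hη hη1 n 1 one_pos
  refine ⟨τ, hτ, fun G _ _ X hneg hX hXX => H G X X hneg hX hXX subset_rfl (by simp) ?_⟩
  have hXpos : (0:ℝ) < X.card := by exact_mod_cast hX.card_pos
  have h0 : (0:ℝ) < (1-η)^n := pow_pos (by linarith) n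
  calc ((X+X).card : ℝ) * (1-η)^n ≤ (K * X.card) * (1-η)^n := by gcongr
    _ < (K * X.card) * (1/K) := by gcongr
    _ = X.card := by field_simp

lemma almost_inv {G : Type u} [AddCommGroup G] [DecidableEq G] (Z : Finset G) (s : G) (η : ℝ)
    (h : (1-η) * Z.card ≤ ((Z.filter (fun z => z - s ∈ Z)).card : ℝ)) (γ : G →+ AddCircle (1:ℝ)) :
    ‖1 - ev γ s‖ * ‖∑ z ∈ Z, ev γ z‖ ≤ 2 * η * Z.card := by
  have e1 : (1 - ev γ s) * ∑ z ∈ Z, ev γ z = ∑ z ∈ Z.filter (fun z => ¬ (z - s ∈ Z)), ev γ z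
      - ∑ z ∈ Z.filter (fun z => ¬ (z + s ∈ Z)), ev γ (z + s) := by
    have a1 := Finset.sum_filter_add_sum_filter_not Z (fun z => z - s ∈ Z) (fun z => ev γ z)
    have a2 := Finset.sum_filter_add_sum_filter_not Z (fun z => z + s ∈ Z) (fun z => ev γ (z + s))
    have a3 : ∑ z ∈ Z.filter (fun z => z + s ∈ Z), ev γ (z+s) = ∑ z ∈ Z.filter (fun z => z - s ∈ Z), ev γ z := by
      refine Finset.sum_bij (fun z _ => z + s) ?_ ?_ ?_ ?_
      · intro z hz
        simp only [Finset.mem_filter, add_sub_cancel_right] at hz ⊢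
        exact hz.symm
      · intro a _ b _ h
        simpa using h
      · intro b hb
        simp only [Finset.mem_filter] at hb
        exact ⟨b - s, by simp [hb.1, hb.2], by simp⟩
      · intro a _; rfl
    have a4 : ∑ z ∈ Z, ev γ (z+s) = ev γ s * ∑ z ∈ Z, ev γ z := by
      rw [Finset.mul_sum]
      refine Finset.sum_congr rfl fun z _ => ?_
      rw [ev_add, mul_comm]
    rw [sub_mul, one_mul, ← a4, ← a1, ← a2, a3]
    ring
  have c1 : ((Z.filter (fun z => ¬ (z - s ∈ Z))).card : ℝ) ≤ η * Z.card := by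
    have := Finset.card_filter_add_card_filter_not (s := Z) (fun z => z - s ∈ Z)
    have : ((Z.filter (fun z => z - s ∈ Z)).card : ℝ) + ((Z.filter (fun z => ¬ (z - s ∈ Z))).card : ℝ) = Z.card := by
      exact_mod_cast this
    linarith
  have c2 : ((Z.filter (fun z => ¬ (z + s ∈ Z))).card : ℝ) ≤ η * Z.card := by
    have := Finset.card_filter_add_card_filter_not (s := Z) (fun z => z + s ∈ Z)
    have e : (Z.filter (fun z => z + s ∈ Z)).card = (Z.filter (fun z => z - s ∈ Z)).card := by
      rw [← card_filter_sub_neg]; simp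
    have : ((Z.filter (fun z => z + s ∈ Z)).card : ℝ) + ((Z.filter (fun z => ¬ (z + s ∈ Z))).card : ℝ) = Z.card := by
      exact_mod_cast this
    rw [e] at this
    linarith
  rw [← norm_mul, e1]
  refine (norm_sub_le _ _).trans ?_
  have d1 : ‖∑ z ∈ Z.filter (fun z => ¬ (z - s ∈ Z)), ev γ z‖ ≤ (Z.filter (fun z => ¬ (z - s ∈ Z))).card := by
    refine (norm_sum_le _ _).trans ?_
    simp [ev_norm]
  have d2 : ‖∑ z ∈ Z.filter (fun z => ¬ (z + s ∈ Z)), ev γ (z+s)‖ ≤ (Z.filter (fun z => ¬ (z + s ∈ Z))).card := by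
    refine (norm_sum_le _ _).trans ?_
    simp [ev_norm]
  linarith

end MWsec


section Patterns

lemma net_lemma {α P : Type*} [Fintype P] [DecidableEq α] [DecidableEq P] (Γ : Finset α) (pat : α → P) :
    ∃ Γ₀ ⊆ Γ, Γ₀.card ≤ Fintype.card P ∧ ∀ γ ∈ Γ, ∃ γ₀ ∈ Γ₀, pat γ = pat γ₀ := by
  rcases Γ.eq_empty_or_nonempty with rfl | ⟨g0, _⟩
  · exact ⟨∅, subset_rfl, by simp, by simp⟩
  have : Nonempty α := ⟨g0⟩
  have h : ∀ q ∈ Γ.image pat, ∃ γ ∈ Γ, pat γ = q := fun q hq => Finset.mem_image.1 hq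
  choose! f hf1 hf2 using h
  refine ⟨(Γ.image pat).image f, ?_, ?_, ?_⟩
  · intro x hx
    obtain ⟨q, hq, rfl⟩ := Finset.mem_image.1 hx
    exact hf1 q hq
  · exact Finset.card_image_le.trans (Finset.card_le_univ _)
  · intro γ hγ
    have := Finset.mem_image_of_mem pat hγ
    exact ⟨f (pat γ), Finset.mem_image_of_mem f this, (hf2 _ this).symm⟩

variable {G : Type u} [AddCommGroup G]

lemma hom_net (n : ℕ) (hn : 0 < n) (Γ : Finset (G →+ AddCircle (1:ℝ))) (E : Finset G) :
    ∃ Γ₀ ⊆ Γ, Γ₀.card ≤ n ^ E.card ∧ ∀ γ ∈ Γ, ∃ γ₀ ∈ Γ₀, ∀ e ∈ E, ‖γ e - γ₀ e‖ ≤ 1/n := by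
  classical
  obtain ⟨cell, hcell⟩ := exists_cell n hn
  obtain ⟨Γ₀, h1, h2, h3⟩ := net_lemma Γ (fun γ => fun e : E => cell (γ e))
  refine ⟨Γ₀, h1, by simpa using h2, fun γ hγ => ?_⟩
  obtain ⟨γ₀, h4, h5⟩ := h3 γ hγ
  exact ⟨γ₀, h4, fun e he => hcell _ _ (congrFun h5 ⟨e, he⟩)⟩

lemma hom_pigeon (n : ℕ) (hn : 0 < n) (Q : Finset (G →+ AddCircle (1:ℝ))) (S : Finset G) :
    ∃ S₀ ⊆ S, (S.card : ℝ) ≤ n ^ Q.card * S₀.card ∧ ∀ x ∈ S₀, ∀ y ∈ S₀, ∀ q ∈ Q, ‖q (x - y)‖ ≤ 1/n := by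
  classical
  obtain ⟨cell, hcell⟩ := exists_cell n hn
  have : Nonempty (Fin n) := ⟨⟨0, hn⟩⟩
  obtain ⟨y, _, hy⟩ := Finset.exists_le_card_fiber_of_nsmul_le_card_of_maps_to (s := S)
    (t := (Finset.univ : Finset (Q → Fin n))) (f := fun x => fun q : Q => cell (q.1 x))
    (b := (S.card : ℝ) / n ^ Q.card) (fun _ _ => Finset.mem_univ _) Finset.univ_nonempty (by
      have : (0:ℝ) < n ^ Q.card := by positivity
      simp
      rw [mul_div_cancel₀ _ this.ne'])
  refine ⟨S.filter (fun x => (fun q : Q => cell (q.1 x)) = y), Finset.filter_subset _ S, ?_, ?_⟩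
  · rw [div_le_iff₀ (by positivity)] at hy
    rw [mul_comm]
    exact hy
  · intro x hx z hz q hq
    have h1 := (Finset.mem_filter.1 hx).2
    have h2 := (Finset.mem_filter.1 hz).2
    rw [map_sub]
    exact hcell _ _ (congrFun (h1.trans h2.symm) ⟨q, hq⟩)

lemma hom_cover (n : ℕ) (hn : 0 < n) (Q : Finset (G →+ AddCircle (1:ℝ))) (S : Finset G) :
    Cov (n ^ Q.card) (S : Set G) {d | ∃ x ∈ S, ∃ y ∈ S, d = x - y ∧ ∀ q ∈ Q, ‖q d‖ ≤ 1/n} := by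
  classical
  obtain ⟨cell, hcell⟩ := exists_cell n hn
  obtain ⟨S₀, h1, h2, h3⟩ := net_lemma S (fun x => fun q : Q => cell (q.1 x))
  refine ⟨S₀, by simpa using h2, fun x hx => ?_⟩
  obtain ⟨x₀, h4, h5⟩ := h3 x hx
  refine ⟨x₀, h4, x - x₀, ⟨x, hx, x₀, h1 h4, rfl, fun q hq => ?_⟩, by simp⟩
  rw [map_sub]
  exact hcell _ _ (congrFun h5 ⟨q, hq⟩)

/-- the local norm attached to a finite set of characters -/
noncomputable def pn (Q : Finset (G →+ AddCircle (1:ℝ))) : LN G :=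
  LN.sup (fun o : Option Q => match o with
    | none => LN.zero G
    | some q => LN.circ.comp q.1)

lemma le_pn (Q : Finset (G →+ AddCircle (1:ℝ))) {q : G →+ AddCircle (1:ℝ)} (hq : q ∈ Q) (x : G) :
    ‖q x‖ ≤ (pn Q).f x :=
  LN.le_sup (fun o : Option Q => match o with
    | none => LN.zero G
    | some q => LN.circ.comp q.1) (some ⟨q, hq⟩) x

lemma pn_le (Q : Finset (G →+ AddCircle (1:ℝ))) (x : G) (c : ℝ) (hc : 0 ≤ c) (h : ∀ q ∈ Q, ‖q x‖ ≤ c) :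
    (pn Q).f x ≤ c := by
  apply LN.sup_le
  intro o
  match o with
  | none => exact hc
  | some q => exact h q.1 q.2

lemma big_rows {α : Type*} (Z : Finset α) (f : α → α → ℂ) (hf : ∀ x y, ‖f x y‖ ≤ 1) (c : ℝ)
    (h : c * (Z.card : ℝ)^2 ≤ ‖∑ x ∈ Z, ∑ y ∈ Z, f x y‖) (hc : 0 ≤ c) :
    c/2 * Z.card ≤ ((Z.filter (fun x => c/2 * Z.card ≤ ‖∑ y ∈ Z, f x y‖)).card : ℝ) := by
  rcases Z.eq_empty_or_nonempty with rfl | hZ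
  · simp
  have hZ : (0:ℝ) < Z.card := by exact_mod_cast hZ.card_pos
  have h1 := norm_sum_le Z (fun x => ∑ y ∈ Z, f x y)
  rw [← Finset.sum_filter_add_sum_filter_not Z (fun x => c/2 * Z.card ≤ ‖∑ y ∈ Z, f x y‖)
    (fun x => ‖∑ y ∈ Z, f x y‖)] at h1
  have a1 : ∑ x ∈ Z.filter (fun x => c/2 * Z.card ≤ ‖∑ y ∈ Z, f x y‖), ‖∑ y ∈ Z, f x y‖
      ≤ (Z.filter (fun x => c/2 * Z.card ≤ ‖∑ y ∈ Z, f x y‖)).card * (Z.card : ℝ) := by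
    rw [← nsmul_eq_mul]
    apply Finset.sum_le_card_nsmul
    intro x _
    refine (norm_sum_le _ _).trans ?_
    refine (Finset.sum_le_card_nsmul _ _ 1 (fun y _ => hf x y)).trans ?_
    simp
  have a2 : ∑ x ∈ Z.filter (fun x => ¬ (c/2 * Z.card ≤ ‖∑ y ∈ Z, f x y‖)), ‖∑ y ∈ Z, f x y‖
      ≤ Z.card * (c/2 * (Z.card : ℝ)) := by
    refine (Finset.sum_le_card_nsmul _ _ (c/2 * (Z.card : ℝ)) ?_).trans ?_
    · intro x hx
      exact (not_le.1 (Finset.mem_filter.1 hx).2).le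
    · rw [nsmul_eq_mul]
      gcongr
      exact Finset.filter_subset _ _
  have h2 : (c/2 * Z.card) * Z.card ≤ (Z.filter (fun x => c/2 * Z.card ≤ ‖∑ y ∈ Z, f x y‖)).card * (Z.card : ℝ) := by
    nlinarith
  exact le_of_mul_le_mul_right h2 hZ

/-- Ruzsa covering in the form used below -/
lemma ruzsa' [DecidableEq G] (V P D : Finset G) (hP : P.Nonempty) (hD : V + P ⊆ D) (m : ℕ)
    (hm : (D.card : ℝ) ≤ m * P.card) : ∃ E ⊆ V, E.card ≤ m ∧ ∀ v ∈ V, ∃ e ∈ E, ∃ a ∈ P, ∃ b ∈ P, v = e + (a - b) := by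
  have h1 : ((V + P).card : ℝ) ≤ m * P.card := le_trans (by exact_mod_cast Finset.card_le_card hD) hm
  obtain ⟨E, h2, h3, h4⟩ := Finset.ruzsa_covering_add hP h1
  refine ⟨E, h2, by exact_mod_cast h3, fun v hv => ?_⟩
  obtain ⟨e, he, d, hd, rfl⟩ := Finset.mem_add.1 (h4 hv)
  obtain ⟨a, ha, b, hb, rfl⟩ := Finset.mem_sub.1 hd
  exact ⟨e, he, a, ha, b, hb, rfl⟩

end Patterns


section StageOne
variable {R : Type u} [NonUnitalRing R]

lemma ring_nbhd [DecidableEq R] (Dom V E' : Finset R) (Γ₀ : Finset (R →+ AddCircle (1:ℝ)))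
    (hV0 : (0:R) ∈ V) (hVn : ∀ v ∈ V, -v ∈ V) (hVD : V ⊆ Dom)
    (hadd : ∀ v ∈ V, ∀ w ∈ V, v + w ∈ Dom ∧ v * w ∈ Dom)
    (hV : ∀ v ∈ Dom, (pn Γ₀).f v ≤ 1/32 → v ∈ V) (hE'V : E' ⊆ V)
    (hE : ∀ v ∈ V, ∃ e ∈ E', ∃ t, v = e + t ∧ ∀ w ∈ V, (pn Γ₀).f (w * t) ≤ 1/64 ∧ (pn Γ₀).f (t * w) ≤ 1/64) :
    ∃ (Q : Finset (R →+ AddCircle (1:ℝ))) (A : Finset R), Q.card ≤ Γ₀.card * (1 + 2 * E'.card) ∧ A ⊆ Dom ∧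
      (0:R) ∈ A ∧ (∀ v ∈ A, -v ∈ A) ∧ (∀ v ∈ A, ∀ w ∈ A, v * w ∈ A) ∧
      ∀ v ∈ Dom, (∀ q ∈ Q, ‖q v‖ ≤ 1/128) → v ∈ A := by
  classical
  let Q : Finset (R →+ AddCircle (1:ℝ)) := Γ₀.biUnion (fun γ => {γ} ∪
    (E'.image (fun e => γ.comp (AddMonoidHom.mulLeft e)) ∪ E'.image (fun e => γ.comp (AddMonoidHom.mulRight e))))
  have hQ1 : ∀ γ ∈ Γ₀, γ ∈ Q := fun γ hγ => Finset.mem_biUnion.2 ⟨γ, hγ, by simp⟩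
  have hQ2 : ∀ γ ∈ Γ₀, ∀ e ∈ E', γ.comp (AddMonoidHom.mulLeft e) ∈ Q := fun γ hγ e he =>
    Finset.mem_biUnion.2 ⟨γ, hγ, Finset.mem_union_right _ (Finset.mem_union_left _ (Finset.mem_image_of_mem _ he))⟩
  have hQ3 : ∀ γ ∈ Γ₀, ∀ e ∈ E', γ.comp (AddMonoidHom.mulRight e) ∈ Q := fun γ hγ e he =>
    Finset.mem_biUnion.2 ⟨γ, hγ, Finset.mem_union_right _ (Finset.mem_union_right _ (Finset.mem_image_of_mem _ he))⟩
  have hQcard : Q.card ≤ Γ₀.card * (1 + 2 * E'.card) := by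
    refine Finset.card_biUnion_le_card_mul _ _ _ fun γ _ => ?_
    refine (Finset.card_union_le _ _).trans ?_
    refine add_le_add (by simp) ((Finset.card_union_le _ _).trans ?_)
    rw [two_mul]
    exact add_le_add Finset.card_image_le Finset.card_image_le
  set p0 := pn Γ₀ with hp0
  set p1 := pn Q with hp1
  have p0p1 : ∀ x, p0.f x ≤ p1.f x := fun x => pn_le _ _ _ (p1.nonneg x) fun q hq => le_pn Q (hQ1 q hq) x
  have p0l : ∀ x, ∀ e ∈ E', p0.f (e * x) ≤ p1.f x := fun x e he => pn_le _ _ _ (p1.nonneg x) fun q hq =>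
    le_pn Q (hQ2 q hq e he) x
  have p0r : ∀ x, ∀ e ∈ E', p0.f (x * e) ≤ p1.f x := fun x e he => pn_le _ _ _ (p1.nonneg x) fun q hq =>
    le_pn Q (hQ3 q hq e he) x
  have p1le : ∀ x c, p0.f x ≤ c → (∀ e ∈ E', p0.f (e * x) ≤ c) → (∀ e ∈ E', p0.f (x * e) ≤ c) → p1.f x ≤ c := by
    intro x c h1 h2 h3
    refine pn_le _ _ _ ((p0.nonneg x).trans h1) fun q hq => ?_
    obtain ⟨γ, hγ, hq⟩ := Finset.mem_biUnion.1 hq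
    simp only [Finset.mem_union, Finset.mem_singleton, Finset.mem_image] at hq
    rcases hq with rfl | ⟨e, he, rfl⟩ | ⟨e, he, rfl⟩
    · exact (le_pn Γ₀ hγ x).trans h1
    · exact (le_pn Γ₀ hγ (e * x)).trans (h2 e he)
    · exact (le_pn Γ₀ hγ (x * e)).trans (h3 e he)
  -- claim 1
  have c1 : ∀ v ∈ V, p1.f v ≤ 1/64 → ∀ w ∈ V, p0.f (v * w) ≤ 1/32 ∧ p0.f (w * v) ≤ 1/32 := by
    intro v hv hpv w hw
    obtain ⟨e, he, t, rfl, ht⟩ := hE w hw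
    obtain ⟨t1, t2⟩ := ht v hv
    constructor
    · rw [mul_add]
      have := p0.add_le (v * e) (v * t)
      linarith [p0r v e he]
    · rw [add_mul]
      have := p0.add_le (e * v) (t * v)
      linarith [p0l v e he]
  have c1' : ∀ v ∈ V, p1.f v ≤ 1/64 → ∀ w ∈ V, v * w ∈ V ∧ w * v ∈ V := fun v hv hpv w hw =>
    ⟨hV _ (hadd v hv w hw).2 (c1 v hv hpv w hw).1, hV _ (hadd w hw v hv).2 (c1 v hv hpv w hw).2⟩
  have c2 : ∀ v ∈ V, p1.f v ≤ 1/64 → ∀ w ∈ V, p1.f w ≤ 1/64 → p1.f (v * w) ≤ 1/32 := by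
    intro v hv hpv w hw hpw
    apply p1le
    · exact (c1 v hv hpv w hw).1
    · intro e he
      rw [← mul_assoc]
      exact (c1 w hw hpw (e * v) (c1' v hv hpv e (hE'V he)).2).2
    · intro e he
      rw [mul_assoc]
      exact (c1 v hv hpv (w * e) (c1' w hw hpw e (hE'V he)).1).1
  have c3 : ∀ v ∈ V, p1.f v ≤ 1/128 → v + v ∈ V ∧ p1.f (v + v) ≤ 1/64 := by
    intro v hv hpv
    have h1 := p1.add_le v v
    have h2 := p0p1 (v + v)
    exact ⟨hV _ (hadd v hv v hv).1 (by linarith), by linarith⟩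
  refine ⟨Q, V.filter (fun v => p1.f v ≤ 1/128), hQcard, (Finset.filter_subset _ _).trans hVD, ?_, ?_, ?_, ?_⟩
  · exact Finset.mem_filter.2 ⟨hV0, by rw [p1.zero']; norm_num⟩
  · intro v hv
    obtain ⟨h1, h2⟩ := Finset.mem_filter.1 hv
    exact Finset.mem_filter.2 ⟨hVn v h1, by rw [p1.neg]; exact h2⟩
  · intro v hv w hw
    obtain ⟨hv1, hv2⟩ := Finset.mem_filter.1 hv
    obtain ⟨hw1, hw2⟩ := Finset.mem_filter.1 hw
    have hv3 : p1.f v ≤ 1/64 := by linarith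
    have hw3 : p1.f w ≤ 1/64 := by linarith
    refine Finset.mem_filter.2 ⟨(c1' v hv1 hv3 w hw1).1, ?_⟩
    obtain ⟨a1, a2⟩ := c3 v hv1 hv2
    obtain ⟨b1, b2⟩ := c3 w hw1 hw2
    have h1 := c2 _ a1 a2 _ b1 b2
    have h2 := c2 v hv1 hv3 w hw1 hw3
    have h3 : (v + v) * (w + w) = 4 • (v * w) := by
      rw [add_mul, mul_add]; abel
    rw [h3, p1.hom 4 (v * w) (by push_cast; linarith)] at h1
    push_cast at h1
    linarith
  · intro v hv hq
    have h1 : p1.f v ≤ 1/128 := pn_le _ _ _ (by norm_num) hq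
    exact Finset.mem_filter.2 ⟨hV v hv (by linarith [p0p1 v]), h1⟩

set_option maxHeartbeats 1000000 in
lemma exists_coarse (N5 : ℕ) (N3 : ℕ) (hN3 : 1 ≤ N3) (τ : ℝ) (hτ : 0 < τ) : ∃ NA : ℕ,
    ∀ (R : Type u) [NonUnitalRing R] [DecidableEq R] (X Z S X3 X4 Dom : Finset R),
      X.Nonempty → X.card ≤ Z.card → (0:R) ∈ S → τ * X.card ≤ S.card →
      (∀ s ∈ S, (1 - 1/(8000*N3:ℝ)) * Z.card ≤ (Z.filter (fun z => z - s ∈ Z)).card) →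
      (∀ z ∈ Z, ∀ z' ∈ Z, ∀ z'' ∈ Z, ∀ w ∈ Z, ∀ w' ∈ Z, ∀ w'' ∈ Z, z + z' * z'' + (w + w' * w'') ∈ X3) →
      (X3.card ≤ N3 * X.card) → 
      (∀ a ∈ X3, ∀ b ∈ X3, a - b ∈ X4) → (∀ v ∈ X4, ∀ w ∈ X4, v + w ∈ Dom ∧ v * w ∈ Dom) →
      (0:R) ∈ X4 → Z ⊆ X4 → S ⊆ X4 → X ⊆ X4 → (∀ x ∈ X, -x ∈ X) → (Dom + S).card ≤ N5 * X.card → 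
      ∃ A : Finset R, A ⊆ Dom ∧ (0:R) ∈ A ∧ (∀ v ∈ A, -v ∈ A) ∧ (∀ v ∈ A, ∀ w ∈ A, v * w ∈ A) ∧
        Cov NA (X : Set R) A := by
  obtain ⟨n, hn⟩ : ∃ n : ℕ, n = 1000 := ⟨_, rfl⟩
  have hn0 : 0 < n := by norm_num [hn]
  obtain ⟨m0, hm0⟩ : ∃ m0 : ℕ, m0 = ⌈N5/τ⌉₊ := ⟨_, rfl⟩
  obtain ⟨D, hD⟩ : ∃ D : ℕ, D = n ^ m0 := ⟨_, rfl⟩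
  obtain ⟨m1, hm1⟩ : ∃ m1 : ℕ, m1 = 4 * N3 * N5 := ⟨_, rfl⟩
  obtain ⟨q1, hq1⟩ : ∃ q1 : ℕ, q1 = n ^ (D * (2 * m1)) := ⟨_, rfl⟩
  obtain ⟨m2, hm2⟩ : ∃ m2 : ℕ, m2 = m0 * q1 := ⟨_, rfl⟩
  refine ⟨n ^ (D * (1 + 2 * m2)), ?_⟩
  intro R _ _ X Z S X3 X4 Dom hX hXZ hS0 hSX hSinv hZ3 hX3 hX34 hX4D hX40 hZX4 hSX4 hXX4 hXn hDS
  classical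
  have hXpos : (0:ℝ) < X.card := by exact_mod_cast hX.card_pos
  have hXZ' : (X.card : ℝ) ≤ Z.card := by exact_mod_cast hXZ
  have hZpos : (0:ℝ) < Z.card := by linarith
  have hZne : Z.Nonempty := Finset.card_pos.1 (by exact_mod_cast hZpos)
  have hSne : S.Nonempty := ⟨0, hS0⟩
  have hN3' : (1:ℝ) ≤ N3 := by exact_mod_cast hN3
  set c : ℝ := 1/(2*N3) with hc
  have hcpos : 0 < c := by positivity
  have hX4D' : X4 ⊆ Dom := fun x hx => by simpa using (hX4D x hx 0 hX40).1
  have hDS' : ((Dom + S).card : ℝ) ≤ N5 * X.card := by exact_mod_cast hDS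
  have hDomcard : (Dom.card : ℝ) ≤ N5 * X.card := by
    refine le_trans ?_ hDS'
    exact_mod_cast Finset.card_le_card_add_right hSne
  have : Nonempty Z := hZne.to_subtype
  let φ : Z × Z × Z → R := fun ω => ω.1.1 + ω.2.1.1 * ω.2.2.1
  obtain ⟨Γ, hΓ1, hΓ2⟩ := fourier_L φ (Z.card : ℝ) (N3 : ℝ) c hZpos (by
      have : (Finset.univ.filter fun ab : (Z × Z × Z) × (Z × Z × Z) => φ ab.1 = φ ab.2).card
          ≤ Fintype.card ((Z × Z) × (Z × Z × Z)) := by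
        rw [← Finset.card_univ]
        refine Finset.card_le_card_of_injOn (fun ab => (ab.1.2, ab.2)) (fun _ _ => Finset.mem_coe.2 (Finset.mem_univ _)) ?_
        rintro ⟨⟨a, b, c⟩, w⟩ h ⟨⟨a', b', c'⟩, w'⟩ h' e
        simp only [Finset.coe_filter, Finset.mem_univ, true_and, Set.mem_ofPred_eq, φ] at h h'
        simp only [Prod.mk.injEq] at e
        obtain ⟨⟨rfl, rfl⟩, rfl⟩ := e
        have : a = a' := Subtype.ext (by
          have := h.trans h'.symm
          simpa using this)
        rw [this]
      have h2 : ((Finset.univ.filter fun ab : (Z × Z × Z) × (Z × Z × Z) => φ ab.1 = φ ab.2).card : ℝ)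
          ≤ (Z.card : ℝ)^5 := by
        refine le_trans (Nat.cast_le.2 this) (le_of_eq ?_)
        simp [Fintype.card_prod]; ring
      calc _ ≤ (Z.card : ℝ)^5 * Z.card := by gcongr
        _ = _ := by simp [Fintype.card_prod]; ring)
    X3 (fun a b => hZ3 _ a.1.2 _ a.2.1.2 _ a.2.2.2 _ b.1.2 _ b.2.1.2 _ b.2.2.2)
    (le_trans (show (X3.card : ℝ) ≤ N3 * X.card by exact_mod_cast hX3) (by gcongr)) (by
      rw [hc]
      field_simp
      nlinarith) Dom
  -- consequences for characters in Γ
  have hfac : ∀ γ : R →+ AddCircle (1:ℝ), ∑ ω, ev γ (φ ω) = (∑ z ∈ Z, ev γ z) * ∑ z ∈ Z, ∑ z' ∈ Z, ev γ (z * z') := by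
    intro γ
    simp only [φ, Fintype.sum_prod_type, ev_add]
    rw [← Finset.sum_coe_sort Z (fun z => ev γ z), ← Finset.sum_coe_sort Z (fun z => ∑ z' ∈ Z, ev γ (z * z')), Finset.sum_mul_sum]
    refine Finset.sum_congr rfl fun a _ => Finset.sum_congr rfl fun b _ => ?_
    rw [← Finset.sum_coe_sort Z (fun z' => ev γ (b.1 * z')), Finset.mul_sum]
  have hcardΩ : ((Fintype.card (Z × Z × Z) : ℕ) : ℝ) = (Z.card : ℝ)^3 := by
    simp [Fintype.card_prod]; ring
  have hsumle : ∀ (f : R → ℂ), (∀ x, ‖f x‖ ≤ 1) → ‖∑ z ∈ Z, f z‖ ≤ Z.card := by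
    intro f hf
    refine (norm_sum_le _ _).trans ((Finset.sum_le_card_nsmul _ _ 1 (fun y _ => hf y)).trans ?_)
    simp
  have hbig : ∀ γ ∈ Γ, c * Z.card ≤ ‖∑ z ∈ Z, ev γ z‖ ∧ c * (Z.card : ℝ)^2 ≤ ‖∑ z ∈ Z, ∑ z' ∈ Z, ev γ (z * z')‖ := by
    intro γ hγ
    have h := hΓ1 γ hγ
    rw [hfac, norm_mul, hcardΩ] at h
    have a1 : ‖∑ z ∈ Z, ev γ z‖ ≤ Z.card := hsumle _ (fun x => (ev_norm γ x).le)
    have a2 : ‖∑ z ∈ Z, ∑ z' ∈ Z, ev γ (z * z')‖ ≤ (Z.card : ℝ)^2 := by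
      refine (norm_sum_le _ _).trans ((Finset.sum_le_card_nsmul _ _ (Z.card : ℝ) (fun y _ =>
        hsumle _ (fun x => (ev_norm γ _).le))).trans ?_)
      simp [sq]
    have b1 := norm_nonneg (∑ z ∈ Z, ev γ z)
    have b2 := norm_nonneg (∑ z ∈ Z, ∑ z' ∈ Z, ev γ (z * z'))
    constructor
    · have : c * Z.card * (Z.card : ℝ)^2 ≤ ‖∑ z ∈ Z, ev γ z‖ * (Z.card : ℝ)^2 := by
        calc c * Z.card * (Z.card : ℝ)^2 = c * (Z.card : ℝ)^3 := by ring
          _ ≤ _ := h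
          _ ≤ _ := by gcongr
      exact le_of_mul_le_mul_right this (by positivity)
    · have : (c * (Z.card : ℝ)^2) * Z.card ≤ ‖∑ z ∈ Z, ∑ z' ∈ Z, ev γ (z * z')‖ * Z.card := by
        calc (c * (Z.card : ℝ)^2) * Z.card = c * (Z.card : ℝ)^3 := by ring
          _ ≤ _ := h
          _ ≤ Z.card * ‖∑ z ∈ Z, ∑ z' ∈ Z, ev γ (z * z')‖ := by gcongr
          _ = _ := by ring
      exact le_of_mul_le_mul_right this hZpos
  have hinv : ∀ γ : R →+ AddCircle (1:ℝ), ∀ s ∈ S, c/2 * Z.card ≤ ‖∑ z ∈ Z, ev γ z‖ → ‖γ s‖ ≤ 1/1000 := by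
    intro γ s hs h
    have h1 := almost_inv Z s (1/(8000*N3:ℝ)) (hSinv s hs) γ
    have h2 := norm_le_ev γ s
    have h3 : ‖γ s‖ * (c/2 * Z.card) ≤ 2 * (1/(8000*N3:ℝ)) * Z.card := by
      refine le_trans ?_ h1
      gcongr
    have h4 : 2 * (1/(8000*N3:ℝ)) * Z.card = 1/1000 * (c/2 * Z.card) := by
      rw [hc]; field_simp; norm_num
    rw [h4] at h3
    exact le_of_mul_le_mul_right h3 (by positivity)
  have hΓS : ∀ γ ∈ Γ, ∀ s ∈ S, ‖γ s‖ ≤ 1/1000 := fun γ hγ s hs => hinv γ s hs (by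
    have := (hbig γ hγ).1
    have : 0 < c * Z.card := by positivity
    linarith)
  -- the net
  obtain ⟨E, hE1, hE2, hE3⟩ := ruzsa' Dom S (Dom + S) hSne subset_rfl m0 (by
    calc ((Dom + S).card : ℝ) ≤ N5 * X.card := hDS'
      _ = (N5/τ) * (τ * X.card) := by field_simp
      _ ≤ m0 * S.card := by rw [hm0]; gcongr; exact Nat.le_ceil _)
  obtain ⟨Γ₀, hΓ₀1, hΓ₀2, hΓ₀3⟩ := hom_net n hn0 Γ E
  have hΓ₀card : Γ₀.card ≤ D := hΓ₀2.trans (hD ▸ Nat.pow_le_pow_right hn0 hE2)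
  let V : Finset R := Dom.filter (fun v => ∃ a b c d, v = φ a + φ b - φ c - φ d)
  have hVX4 : V ⊆ X4 := by
    intro v hv
    obtain ⟨_, a, b, c, d, rfl⟩ := Finset.mem_filter.1 hv
    have h1 := hZ3 _ a.1.2 _ a.2.1.2 _ a.2.2.2 _ b.1.2 _ b.2.1.2 _ b.2.2.2
    have h2 := hZ3 _ c.1.2 _ c.2.1.2 _ c.2.2.2 _ d.1.2 _ d.2.1.2 _ d.2.2.2
    have := hX34 _ h1 _ h2
    rw [sub_sub]
    exact this
  have hmemV : ∀ a b c d, φ a + φ b - φ c - φ d ∈ V := by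
    intro a b c d
    refine Finset.mem_filter.2 ⟨hX4D' ?_, a, b, c, d, rfl⟩
    have h1 := hZ3 _ a.1.2 _ a.2.1.2 _ a.2.2.2 _ b.1.2 _ b.2.1.2 _ b.2.2.2
    have h2 := hZ3 _ c.1.2 _ c.2.1.2 _ c.2.2.2 _ d.1.2 _ d.2.1.2 _ d.2.2.2
    have := hX34 _ h1 _ h2
    rw [sub_sub]
    exact this
  have hV0 : (0:R) ∈ V := by
    obtain ⟨z⟩ := this
    have := hmemV (z, z, z) (z, z, z) (z, z, z) (z, z, z)
    simpa using this
  have hVn : ∀ v ∈ V, -v ∈ V := by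
    intro v hv
    obtain ⟨_, a, b, c, d, rfl⟩ := Finset.mem_filter.1 hv
    have := hmemV c d a b
    convert this using 1
    abel
  have h5 : (1/(n:ℝ)) = 1/1000 := by rw [hn]; norm_num
  have hVp : ∀ v ∈ Dom, (pn Γ₀).f v ≤ 1/32 → v ∈ V := by
    intro v hv hpv
    refine Finset.mem_filter.2 ⟨hv, hΓ2 v hv fun γ hγ => ?_⟩
    obtain ⟨γ₀, hγ₀, hclose⟩ := hΓ₀3 γ hγ
    obtain ⟨e, he, s, hs, s', hs', rfl⟩ := hE3 v hv
    have a0 := (le_pn Γ₀ hγ₀ (e + (s - s'))).trans hpv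
    have a1 := hclose e he
    have a2 := hΓS γ hγ s hs
    have a3 := hΓS γ hγ s' hs'
    have a4 := hΓS γ₀ (hΓ₀1 hγ₀) s hs
    have a5 := hΓS γ₀ (hΓ₀1 hγ₀) s' hs'
    have e1 : γ (e + (s - s')) = γ₀ (e + (s - s')) + ((γ e - γ₀ e) + ((γ s - γ s') - (γ₀ s - γ₀ s'))) := by
      simp only [map_add, map_sub]; abel
    rw [e1]
    have b1 := norm_add_le (γ₀ (e + (s - s'))) ((γ e - γ₀ e) + ((γ s - γ s') - (γ₀ s - γ₀ s')))
    have b2 := norm_add_le (γ e - γ₀ e) ((γ s - γ s') - (γ₀ s - γ₀ s'))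
    have b3 := norm_sub_le (γ s - γ s') (γ₀ s - γ₀ s')
    have b4 := norm_sub_le (γ s) (γ s')
    have b5 := norm_sub_le (γ₀ s) (γ₀ s')
    rw [h5] at a1
    linarith
  -- rows and columns
  have hrow : ∀ γ ∈ Γ, ∃ F ⊆ V, F.card ≤ m1 ∧ ∀ v ∈ V, ∃ e ∈ F, ∃ z, ∃ z', v = e + (z - z') ∧
      ∀ s ∈ S, ‖γ (z * s)‖ ≤ 1/1000 ∧ ‖γ (z' * s)‖ ≤ 1/1000 := by
    intro γ hγ
    have h1 := big_rows Z (fun z z' => ev γ (z * z')) (fun x y => (ev_norm γ _).le) c (hbig γ hγ).2 hcpos.le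
    set P := Z.filter (fun x => c/2 * Z.card ≤ ‖∑ y ∈ Z, ev γ (x * y)‖) with hP
    have hPpos : (0:ℝ) < P.card := lt_of_lt_of_le (by positivity) h1
    have hPne : P.Nonempty := Finset.card_pos.1 (by exact_mod_cast hPpos)
    obtain ⟨F, f1, f2, f3⟩ := ruzsa' V P Dom hPne (by
      intro x hx
      obtain ⟨a, ha, b, hb, rfl⟩ := Finset.mem_add.1 hx
      exact (hX4D _ (hVX4 ha) _ (hZX4 (Finset.filter_subset _ _ hb))).1) m1 (by
        calc (Dom.card : ℝ) ≤ N5 * X.card := hDomcard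
          _ ≤ N5 * Z.card := by gcongr
          _ = (4 * N3 * N5 : ℝ) * (c/2 * Z.card) := by rw [hc]; field_simp; norm_num
          _ ≤ (4 * N3 * N5 : ℝ) * P.card := by gcongr
          _ = m1 * P.card := by rw [hm1]; push_cast; ring)
    refine ⟨F, f1, f2, fun v hv => ?_⟩
    obtain ⟨e, he, a, ha, b, hb, rfl⟩ := f3 v hv
    refine ⟨e, he, a, b, rfl, fun s hs => ⟨?_, ?_⟩⟩
    · exact hinv (γ.comp (AddMonoidHom.mulLeft a)) s hs (Finset.mem_filter.1 ha).2
    · exact hinv (γ.comp (AddMonoidHom.mulLeft b)) s hs (Finset.mem_filter.1 hb).2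
  have hcol : ∀ γ ∈ Γ, ∃ F ⊆ V, F.card ≤ m1 ∧ ∀ v ∈ V, ∃ e ∈ F, ∃ z, ∃ z', v = e + (z - z') ∧
      ∀ s ∈ S, ‖γ (s * z)‖ ≤ 1/1000 ∧ ‖γ (s * z')‖ ≤ 1/1000 := by
    intro γ hγ
    have h0 := (hbig γ hγ).2
    rw [Finset.sum_comm] at h0
    have h1 := big_rows Z (fun z z' => ev γ (z' * z)) (fun x y => (ev_norm γ _).le) c h0 hcpos.le
    set P := Z.filter (fun x => c/2 * Z.card ≤ ‖∑ y ∈ Z, ev γ (y * x)‖) with hP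
    have hPpos : (0:ℝ) < P.card := lt_of_lt_of_le (by positivity) h1
    have hPne : P.Nonempty := Finset.card_pos.1 (by exact_mod_cast hPpos)
    obtain ⟨F, f1, f2, f3⟩ := ruzsa' V P Dom hPne (by
      intro x hx
      obtain ⟨a, ha, b, hb, rfl⟩ := Finset.mem_add.1 hx
      exact (hX4D _ (hVX4 ha) _ (hZX4 (Finset.filter_subset _ _ hb))).1) m1 (by
        calc (Dom.card : ℝ) ≤ N5 * X.card := hDomcard
          _ ≤ N5 * Z.card := by gcongr
          _ = (4 * N3 * N5 : ℝ) * (c/2 * Z.card) := by rw [hc]; field_simp; norm_num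
          _ ≤ (4 * N3 * N5 : ℝ) * P.card := by gcongr
          _ = m1 * P.card := by rw [hm1]; push_cast; ring)
    refine ⟨F, f1, f2, fun v hv => ?_⟩
    obtain ⟨e, he, a, ha, b, hb, rfl⟩ := f3 v hv
    refine ⟨e, he, a, b, rfl, fun s hs => ⟨?_, ?_⟩⟩
    · exact hinv (γ.comp (AddMonoidHom.mulRight a)) s hs (Finset.mem_filter.1 ha).2
    · exact hinv (γ.comp (AddMonoidHom.mulRight b)) s hs (Finset.mem_filter.1 hb).2
  choose! FL hFL1 hFL2 hFL3 using hrow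
  choose! FR hFR1 hFR2 hFR3 using hcol
  let QS : Finset (R →+ AddCircle (1:ℝ)) := Γ₀.biUnion (fun γ =>
    ((FL γ).image (fun e => γ.comp (AddMonoidHom.mulLeft e)) ∪ (FR γ).image (fun e => γ.comp (AddMonoidHom.mulRight e))))
  have hQScard : QS.card ≤ D * (2 * m1) := by
    refine (Finset.card_biUnion_le_card_mul _ _ (2 * m1) fun γ hγ => ?_).trans (Nat.mul_le_mul_right _ hΓ₀card)
    refine (Finset.card_union_le _ _).trans ?_
    rw [two_mul]
    exact add_le_add (Finset.card_image_le.trans (hFL2 γ (hΓ₀1 hγ))) (Finset.card_image_le.trans (hFR2 γ (hΓ₀1 hγ)))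
  have hQL : ∀ γ ∈ Γ₀, ∀ e ∈ FL γ, γ.comp (AddMonoidHom.mulLeft e) ∈ QS := fun γ hγ e he =>
    Finset.mem_biUnion.2 ⟨γ, hγ, (Finset.mem_union_left _ (Finset.mem_image_of_mem _ he))⟩
  have hQR : ∀ γ ∈ Γ₀, ∀ e ∈ FR γ, γ.comp (AddMonoidHom.mulRight e) ∈ QS := fun γ hγ e he =>
    Finset.mem_biUnion.2 ⟨γ, hγ, (Finset.mem_union_right _ (Finset.mem_image_of_mem _ he))⟩
  obtain ⟨S₀, hS₀1, hS₀2, hS₀3⟩ := hom_pigeon n hn0 QS S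
  have hq1' : ((n:ℝ) ^ QS.card) ≤ q1 := by
    rw [hq1]; push_cast
    exact pow_le_pow_right₀ (by exact_mod_cast hn0) hQScard
  have hSpos : (0:ℝ) < S.card := by exact_mod_cast hSne.card_pos
  have hS₀2' : (S.card : ℝ) ≤ q1 * S₀.card := hS₀2.trans (by gcongr)
  have hS₀ne : S₀.Nonempty := by
    rw [Finset.nonempty_iff_ne_empty]
    rintro rfl
    simp at hS₀2'
    exact absurd hS₀2' (Finset.nonempty_iff_ne_empty.1 hSne)
  obtain ⟨E', hE'1, hE'2, hE'3⟩ := ruzsa' V S₀ (Dom + S) hS₀ne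
    (Finset.add_subset_add (hVX4.trans hX4D') hS₀1) m2 (by
      calc ((Dom + S).card : ℝ) ≤ N5 * X.card := hDS'
        _ = (N5/τ) * (τ * X.card) := by field_simp
        _ ≤ m0 * (q1 * S₀.card) := by
          refine mul_le_mul ?_ (hSX.trans hS₀2') (by positivity) (by positivity)
          rw [hm0]; exact Nat.le_ceil _
        _ = m2 * S₀.card := by rw [hm2]; push_cast; ring)
  have four_le : ∀ a b c d e : AddCircle (1:ℝ), ‖e‖ ≤ 1/1000 → ‖a‖ ≤ 1/1000 → ‖b‖ ≤ 1/1000 → ‖c‖ ≤ 1/1000 → ‖d‖ ≤ 1/1000 →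
      ‖e + ((a - b) - (c - d))‖ ≤ 1/64 := by
    intro a b c d e h1 h2 h3 h4 h5
    have b2 := norm_add_le e ((a - b) - (c - d))
    have b3 := norm_sub_le (a - b) (c - d)
    have b4 := norm_sub_le a b
    have b5 := norm_sub_le c d
    linarith
  obtain ⟨Q, A, hQ, hA1, hA2, hA3, hA4, hA5⟩ := ring_nbhd Dom V E' Γ₀ hV0 hVn (hVX4.trans hX4D')
    (fun v hv w hw => hX4D v (hVX4 hv) w (hVX4 hw)) hVp hE'1 (by
      intro v hv
      obtain ⟨e, he, s, hs, s', hs', rfl⟩ := hE'3 v hv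
      refine ⟨e, he, s - s', rfl, fun w hw => ⟨?_, ?_⟩⟩
      · refine pn_le _ _ _ (by norm_num) fun γ hγ => ?_
        obtain ⟨f, hf, z, z', rfl, hz⟩ := hFL3 γ (hΓ₀1 hγ) w hw
        have a1 := hS₀3 s hs s' hs' _ (hQL γ hγ f hf)
        rw [AddMonoidHom.comp_apply, AddMonoidHom.coe_mulLeft] at a1
        rw [h5] at a1
        have := four_le (γ (z * s)) (γ (z * s')) (γ (z' * s)) (γ (z' * s')) (γ (f * (s - s'))) a1
          (hz s (hS₀1 hs)).1 (hz s' (hS₀1 hs')).1 (hz s (hS₀1 hs)).2 (hz s' (hS₀1 hs')).2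
        have e1 : γ ((f + (z - z')) * (s - s')) = γ (f * (s - s')) + ((γ (z * s) - γ (z * s')) - (γ (z' * s) - γ (z' * s'))) := by
          rw [← map_sub, ← map_sub, ← map_sub, ← map_add]
          congr 1
          simp only [add_mul, sub_mul, mul_sub]
          abel
        rw [e1]
        exact this
      · refine pn_le _ _ _ (by norm_num) fun γ hγ => ?_
        obtain ⟨f, hf, z, z', rfl, hz⟩ := hFR3 γ (hΓ₀1 hγ) w hw
        have a1 := hS₀3 s hs s' hs' _ (hQR γ hγ f hf)
        rw [AddMonoidHom.comp_apply, AddMonoidHom.mulRight_apply] at a1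
        rw [h5] at a1
        have := four_le (γ (s * z)) (γ (s' * z)) (γ (s * z')) (γ (s' * z')) (γ ((s - s') * f)) a1
          (hz s (hS₀1 hs)).1 (hz s' (hS₀1 hs')).1 (hz s (hS₀1 hs)).2 (hz s' (hS₀1 hs')).2
        have e1 : γ ((s - s') * (f + (z - z'))) = γ ((s - s') * f) + ((γ (s * z) - γ (s' * z)) - (γ (s * z') - γ (s' * z'))) := by
          rw [← map_sub, ← map_sub, ← map_sub, ← map_add]
          congr 1
          simp only [mul_add, sub_mul, mul_sub]
        rw [e1]
        exact this)
  refine ⟨A, hA1, hA2, hA3, hA4, ?_⟩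
  have hcov := hom_cover n hn0 Q X
  refine (hcov.mono (Nat.pow_le_pow_right hn0 (hQ.trans (Nat.mul_le_mul hΓ₀card
    (by gcongr)))) subset_rfl).right ?_
  rintro d ⟨x, hx, y, hy, rfl, hd⟩
  refine hA5 _ ?_ fun q hq => ?_
  · rw [sub_eq_add_neg]
    exact (hX4D _ (hXX4 hx) _ (hXX4 (hXn y hy))).1
  · refine (hd q hq).trans ?_
    rw [h5]
    norm_num

end StageOne


lemma stage1 (K : ℕ) (hK : 1 ≤ K) : ∃ NA : ℕ, ∀ (R : Type u) [NonUnitalRing R] (X : Finset R),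
    IsApproxSubringWith K (X : Set R) → ∃ A : Finset R, (0:R) ∈ A ∧ (∀ v ∈ A, -v ∈ A) ∧
      (∀ v ∈ A, ∀ w ∈ A, v * w ∈ A) ∧ Cov NA (A : Set R) X ∧ Cov NA (X : Set R) A := by
  obtain ⟨N3', hN3⟩ := cov_iter.{u} K 3
  obtain ⟨N5, hN5⟩ := cov_iter.{u} K 5
  obtain ⟨N6, hN6⟩ := cov_iter.{u} K 6
  set N3 := max N3' 1 with hN3def
  have h31 : 1 ≤ N3 := le_max_right _ _
  have h31' : (1:ℝ) ≤ N3 := by exact_mod_cast h31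
  obtain ⟨τ, hτ, hMW⟩ := MW.{u} (K:ℝ) (1/(8000*N3:ℝ)) (by exact_mod_cast hK) (by positivity) (by
    rw [div_lt_one (by positivity)]; linarith)
  obtain ⟨NA, H⟩ := exists_coarse.{u} N6 N3 h31 τ hτ
  refine ⟨max NA N5, fun R _ X hX => ?_⟩
  classical
  have hs := hX.1
  have hfin : ∀ j, (iterX (X : Set R) j).Finite := by
    intro j
    obtain ⟨N, hN⟩ := cov_iter.{u} K j
    exact (hN R X hX).finite X.finite_toSet
  let XX : ℕ → Finset R := fun j => (hfin j).toFinset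
  have hmem : ∀ j x, x ∈ XX j ↔ x ∈ iterX (X : Set R) j := fun j x => (hfin j).mem_toFinset
  have hcoe : ∀ j, ((XX j : Finset R) : Set R) = iterX (X : Set R) j := fun j => (hfin j).coe_toFinset
  have h0 : (0:R) ∈ X := by exact_mod_cast hs.1
  have hneg : ∀ x ∈ X, -x ∈ X := fun x hx => by exact_mod_cast hs.neg_mem (Finset.mem_coe.2 hx)
  have hXX : ((X + X).card : ℝ) ≤ K * X.card := by
    have := (approx_cov hX).2
    rw [← Finset.coe_add] at this
    exact_mod_cast this.card
  obtain ⟨Z, S, z1, z2, s1, s2, s3, s4, s5⟩ := hMW R X hneg ⟨0, h0⟩ hXX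
  have hX0 : ∀ x ∈ X, x ∈ iterX (X : Set R) 0 := fun x hx => Finset.mem_coe.2 hx
  have h2X : ∀ x ∈ X + X, x ∈ iterX (X : Set R) 1 := by
    intro x hx
    obtain ⟨a, ha, b, hb, rfl⟩ := Finset.mem_add.1 hx
    exact iterX_add hs (hX0 a ha) (hX0 b hb)
  have hφ : ∀ z ∈ Z, ∀ z' ∈ Z, ∀ z'' ∈ Z, z + z' * z'' ∈ iterX (X : Set R) 2 := by
    intro z hz z' hz' z'' hz''
    exact ⟨z, ⟨z, h2X z (z1 hz), 0, (iterX_symm hs 1).1, by simp⟩, _, ⟨z', h2X _ (z1 hz'), z'', h2X _ (z1 hz''), rfl⟩, rfl⟩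
  have mono := fun (m n : ℕ) (h : m ≤ n) => iterX_mono hs h
  obtain ⟨A, a1, a2, a3, a4, a5⟩ := H R X Z S (XX 3) (XX 4) (XX 5) ⟨0, h0⟩ z2 s1 s4 s5
    (fun z hz z' hz' z'' hz'' w hw w' hw' w'' hw'' => (hmem _ _).2 (iterX_add hs (hφ z hz z' hz' z'' hz'')
      (hφ w hw w' hw' w'' hw'')))
    (by
      have := hN3 R X hX
      rw [← hcoe] at this
      exact this.card.trans (Nat.mul_le_mul_right _ (le_max_left _ _)))
    (fun a ha b hb => by
      rw [hmem] at *
      rw [sub_eq_add_neg]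
      exact iterX_add hs ha ((iterX_symm hs _).neg_mem hb))
    (fun a ha b hb => by
      simp only [hmem] at *
      exact ⟨iterX_add hs ha hb, iterX_mul hs ha hb⟩)
    ((hmem _ _).2 (iterX_symm hs _).1)
    (fun z hz => (hmem _ _).2 (mono 1 4 (by norm_num) (h2X z (z1 hz))))
    (fun z hz => (hmem _ _).2 (mono 1 4 (by norm_num) (h2X z (s3 hz))))
    (fun z hz => (hmem _ _).2 (mono 0 4 (by norm_num) (hX0 z hz)))
    hneg (by
      have h1 := hN6 R X hX
      rw [← hcoe] at h1
      refine le_trans (Finset.card_le_card ?_) h1.card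
      intro x hx
      obtain ⟨a, ha, b, hb, rfl⟩ := Finset.mem_add.1 hx
      exact (hmem _ _).2 (iterX_add hs ((hmem _ _).1 ha) (mono 1 5 (by norm_num) (h2X b (s3 hb)))))
  refine ⟨A, a2, a3, a4, (hN5 R X hX).mono (le_max_right _ _) ?_, a5.mono (le_max_left _ _) subset_rfl⟩
  intro x hx
  exact (hmem _ _).1 (a1 hx)


section Msum
variable {G : Type u} [AddCommGroup G]

open Classical in
/-- iterated sumset -/
noncomputable def msum (A : Finset G) : ℕ → Finset G
  | 0 => {0}
  | n + 1 => msum A n + A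

lemma mem_msum_zero {A : Finset G} {x : G} : x ∈ msum A 0 ↔ x = 0 := by
  simp [msum]

lemma mem_msum_succ {A : Finset G} {n : ℕ} {x : G} :
    x ∈ msum A (n+1) ↔ ∃ y ∈ msum A n, ∃ a ∈ A, y + a = x := by
  simp [msum, Finset.mem_add]

lemma mem_msum_one {A : Finset G} {x : G} : x ∈ msum A 1 ↔ x ∈ A := by
  rw [mem_msum_succ]
  constructor
  · rintro ⟨y, hy, a, ha, rfl⟩
    rw [mem_msum_zero.1 hy, zero_add]; exact ha
  · intro h
    exact ⟨0, mem_msum_zero.2 rfl, x, h, zero_add _⟩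

lemma mem_msum_two {A : Finset G} {x : G} : x ∈ msum A 2 ↔ ∃ y ∈ A, ∃ a ∈ A, y + a = x := by
  rw [mem_msum_succ]
  simp only [mem_msum_one]

lemma msum_add {A : Finset G} {m n : ℕ} {x y : G} (hx : x ∈ msum A m) (hy : y ∈ msum A n) :
    x + y ∈ msum A (m+n) := by
  induction n generalizing y with
  | zero => rw [mem_msum_zero.1 hy]; simpa using hx
  | succ n ih =>
    obtain ⟨z, hz, a, ha, rfl⟩ := mem_msum_succ.1 hy
    rw [← add_assoc m n 1, ← add_assoc x]
    exact mem_msum_succ.2 ⟨_, ih hz, a, ha, rfl⟩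

lemma msum_zero_mem {A : Finset G} (h0 : (0:G) ∈ A) (n : ℕ) : (0:G) ∈ msum A n := by
  induction n with
  | zero => exact mem_msum_zero.2 rfl
  | succ n ih => exact mem_msum_succ.2 ⟨0, ih, 0, h0, zero_add _⟩

lemma msum_mono {A : Finset G} (h0 : (0:G) ∈ A) {m n : ℕ} (h : m ≤ n) : msum A m ⊆ msum A n := by
  intro x hx
  obtain ⟨k, rfl⟩ := Nat.exists_eq_add_of_le h
  simpa using msum_add hx (msum_zero_mem h0 k)

lemma msum_neg {A : Finset G} (hs : ∀ v ∈ A, -v ∈ A) {n : ℕ} {x : G} (hx : x ∈ msum A n) :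
    -x ∈ msum A n := by
  induction n generalizing x with
  | zero => rw [mem_msum_zero.1 hx]; simp [mem_msum_zero]
  | succ n ih =>
    obtain ⟨z, hz, a, ha, rfl⟩ := mem_msum_succ.1 hx
    exact mem_msum_succ.2 ⟨_, ih hz, _, hs a ha, by abel⟩

lemma msum_sub {A : Finset G} (hs : ∀ v ∈ A, -v ∈ A) {m n : ℕ} {x y : G} (hx : x ∈ msum A m)
    (hy : y ∈ msum A n) : x - y ∈ msum A (m+n) := by
  rw [sub_eq_add_neg]; exact msum_add hx (msum_neg hs hy)

lemma msum_nsmul {A : Finset G} {n : ℕ} {x : G} (hx : x ∈ msum A n) (l : ℕ) :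
    l • x ∈ msum A (l * n) := by
  induction l with
  | zero => simp [mem_msum_zero]
  | succ l ih => rw [succ_nsmul, Nat.succ_mul]; exact msum_add ih hx

lemma msum_card_pos {A : Finset G} (h0 : (0:G) ∈ A) (n : ℕ) : 0 < (msum A n).card :=
  Finset.card_pos.2 ⟨0, msum_zero_mem h0 n⟩

lemma msum_cov {A : Finset G} {K : ℕ} (hK : Cov K ((A:Set G) + (A:Set G)) A) (n : ℕ) :
    Cov (K^n) (msum A (n+1) : Set G) A := by
  induction n with
  | zero =>
    refine (Cov.self (A : Set G)).mono (by simp) ?_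
    intro x hx
    exact mem_msum_one.1 hx
  | succ n ih =>
    refine (ih.add (Cov.self (A:Set G))).trans hK |>.mono (by rw [pow_succ]; simp) ?_
    intro x hx
    obtain ⟨z, hz, a, ha, rfl⟩ := mem_msum_succ.1 hx
    exact ⟨z, hz, a, ha, rfl⟩

lemma msum_repr (E : Finset G) (n : ℕ) (x : G) (hx : x ∈ msum E n) :
    ∃ c : E → Fin (n+1), x = ∑ e, (c e : ℕ) • (e : G) := by
  classical
  suffices h : ∃ c : E → ℕ, (∀ e, c e ≤ n) ∧ x = ∑ e, (c e : ℕ) • (e : G) by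
    obtain ⟨c, h1, h2⟩ := h
    exact ⟨fun e => ⟨c e, Nat.lt_succ_of_le (h1 e)⟩, h2⟩
  induction n generalizing x with
  | zero => exact ⟨fun _ => 0, by simp, by simpa using mem_msum_zero.1 hx⟩
  | succ n ih =>
    obtain ⟨z, hz, a, ha, rfl⟩ := mem_msum_succ.1 hx
    obtain ⟨c, h1, h2⟩ := ih z hz
    refine ⟨fun e => c e + if e = ⟨a, ha⟩ then 1 else 0, fun e => ?_, ?_⟩
    · dsimp only; split_ifs
      · exact Nat.succ_le_succ (h1 e)
      · exact (h1 e).trans (Nat.le_succ n)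
    · simp only [add_smul, Finset.sum_add_distrib, ← h2, ite_smul, one_smul, zero_smul,
        Finset.sum_ite_eq', Finset.mem_univ, if_true]

lemma msum_poly {A : Finset G} {K : ℕ} (hK : Cov K ((A:Set G) + (A:Set G)) A) (n : ℕ) :
    (msum A (n+1)).card ≤ (n+1)^K * A.card := by
  classical
  obtain ⟨E, hE, hc⟩ := hK
  have key : msum A (n+1) ⊆ msum E n + A := by
    induction n with
    | zero =>
      intro x hx
      exact Finset.mem_add.2 ⟨0, mem_msum_zero.2 rfl, x, mem_msum_one.1 hx, zero_add _⟩
    | succ n ih =>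
      intro x hx
      obtain ⟨z, hz, a, ha, rfl⟩ := mem_msum_succ.1 hx
      obtain ⟨f, hf, b, hb, rfl⟩ := Finset.mem_add.1 (ih hz)
      obtain ⟨e, he, d, hd, hed⟩ := hc ⟨b, hb, a, ha, rfl⟩
      refine Finset.mem_add.2 ⟨f + e, mem_msum_succ.2 ⟨f, hf, e, he, rfl⟩, d, hd, ?_⟩
      simp only at hed
      rw [add_assoc, hed, add_assoc]
  have h2 : (msum E n).card ≤ (n+1)^K := by
    have : msum E n ⊆ Finset.univ.image (fun c : E → Fin (n+1) => ∑ e, (c e : ℕ) • (e : G)) := by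
      intro x hx
      obtain ⟨c, hc⟩ := msum_repr E n x hx
      exact Finset.mem_image.2 ⟨c, Finset.mem_univ _, hc.symm⟩
    refine (Finset.card_le_card this).trans (Finset.card_image_le.trans ?_)
    simp only [Finset.card_univ, Fintype.card_pi, Fintype.card_fin, Finset.prod_const, Fintype.card_coe]
    exact Nat.pow_le_pow_right (by omega) hE
  exact (Finset.card_le_card key).trans (Finset.card_add_le.trans (Nat.mul_le_mul_right _ h2))

end Msum

lemma msum_mul {R : Type u} [NonUnitalRing R] {A : Finset R} (hm : ∀ v ∈ A, ∀ w ∈ A, v * w ∈ A)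
    {m n : ℕ} {x y : R} (hx : x ∈ msum A m) (hy : y ∈ msum A n) : x * y ∈ msum A (m*n) := by
  have h1 : ∀ a ∈ A, ∀ n, ∀ y ∈ msum A n, a * y ∈ msum A n := by
    intro a ha n
    induction n with
    | zero => intro y hy; rw [mem_msum_zero.1 hy]; simp [mem_msum_zero]
    | succ n ih =>
      intro y hy
      obtain ⟨z, hz, b, hb, rfl⟩ := mem_msum_succ.1 hy
      rw [mul_add]
      exact mem_msum_succ.2 ⟨_, ih z hz, _, hm a ha b hb, rfl⟩
  induction m generalizing x with
  | zero => rw [mem_msum_zero.1 hx]; simp [mem_msum_zero]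
  | succ m ih =>
    obtain ⟨z, hz, b, hb, rfl⟩ := mem_msum_succ.1 hx
    rw [add_mul z b y, Nat.succ_mul]
    exact msum_add (ih hz) (h1 b hb n y hy)

/-- growth pigeonhole on one sequence -/
lemma seq_pigeon (a : ℕ → ℝ) (C : ℝ) (hC : 0 ≤ C) (m k : ℕ)
    (h : ∀ i, m ≤ i → i < m + k → C * a i < a (i+1)) : C^k * a m ≤ a (m+k) := by
  induction k with
  | zero => simp
  | succ k ih =>
    have h1 := ih (fun i hi hi' => h i hi (by omega))
    have h2 := h (m+k) (by omega) (by omega)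
    have h3 := mul_le_mul_of_nonneg_left h1 hC
    rw [pow_succ', mul_assoc, ← add_assoc]
    linarith

lemma growth_scale (K : ℕ) (hK1 : 1 ≤ K) (η : ℝ) (hη : 0 < η) (wmin : ℕ) : ∃ wmax : ℕ,
    ∀ (G : Type u) [AddCommGroup G] (A : Finset G), (0:G) ∈ A → Cov K ((A:Set G) + (A:Set G)) A →
      ∃ n : ℕ, 1 ≤ n ∧ wmin ≤ n ∧ n ≤ wmax ∧ ((msum A (n+1)).card : ℝ) ≤ (1+η) * (msum A n).card ∧
        ((msum A (n+n)).card : ℝ) ≤ (4:ℝ)^(2*K) * (msum A n).card := by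
  obtain ⟨l0, hl0⟩ : ∃ l : ℕ, wmin + 1 ≤ l ∧ (4:ℝ)^(2*K) / η ≤ l :=
    ⟨max (wmin+1) ⌈(4:ℝ)^(2*K) / η⌉₊, le_max_left _ _, (Nat.le_ceil _).trans (by exact_mod_cast le_max_right _ _)⟩
  have lpow : ∀ l : ℕ, l ≤ 4^l := fun l => (Nat.lt_pow_self (by norm_num)).le
  refine ⟨2 * 4^(2*l0), fun G _ A h0 hc => ?_⟩
  set c : ℕ → ℝ := fun n => ((msum A n).card : ℝ) with hcdef
  have cpos : ∀ n, 0 < c n := fun n => Nat.cast_pos.2 (msum_card_pos h0 n)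
  have cmono : ∀ {m n}, m ≤ n → c m ≤ c n := fun {m n} h =>
    Nat.cast_le.2 (Finset.card_le_card (msum_mono h0 h))
  have e1 : ∃ l, l0 ≤ l ∧ l < 2*l0 ∧ c (4^(l+1)) ≤ (4:ℝ)^(2*K) * c (4^l) := by
    by_contra hcon
    push Not at hcon
    have h1 := seq_pigeon (fun l => c (4^l)) ((4:ℝ)^(2*K)) (by positivity) (l0+0) l0 (fun i hi hi' => hcon i hi (by omega))
    have h1' : c (4^(l0+l0)) > ((4:ℝ)^(2*K))^l0 * c (4^l0) := by
      have h2 := seq_pigeon (fun l => c (4^l)) ((4:ℝ)^(2*K)) (by positivity) l0 (l0-1) (fun i hi hi' => hcon i hi (by omega))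
      have h3 := hcon (l0 + (l0-1)) (by omega) (by omega)
      have h4 : l0 + (l0 - 1) + 1 = l0 + l0 := by omega
      rw [h4] at h3
      have h5 : ((4:ℝ)^(2*K))^l0 = (4:ℝ)^(2*K) * ((4:ℝ)^(2*K))^(l0-1) := by
        rw [← pow_succ']; congr 1; omega
      rw [h5, mul_assoc]
      have := mul_le_mul_of_nonneg_left h2 (show (0:ℝ) ≤ (4:ℝ)^(2*K) by positivity)
      linarith
    obtain ⟨q, hq⟩ : ∃ q, 4^(l0+l0) = q + 1 := ⟨4^(l0+l0)-1, (Nat.sub_add_cancel (Nat.one_le_pow _ _ (by norm_num))).symm⟩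
    have h6 := msum_poly hc q
    rw [← hq] at h6
    have h7 : c (4^(l0+l0)) ≤ ((4:ℝ)^(l0+l0))^K * c 1 := by
      have : (msum A 1).card = A.card := by congr 1; ext x; exact mem_msum_one
      simp only [hcdef, this]
      exact_mod_cast h6
    have h8 : c 1 ≤ c (4^l0) := cmono (Nat.one_le_pow _ _ (by norm_num))
    have h9 : ((4:ℝ)^(l0+l0))^K = ((4:ℝ)^(2*K))^l0 := by rw [← pow_mul, ← pow_mul]; congr 1; ring
    rw [h9] at h7
    have := mul_le_mul_of_nonneg_left h8 (show (0:ℝ) ≤ ((4:ℝ)^(2*K))^l0 by positivity)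
    linarith
  obtain ⟨l, hl1, hl2, hl3⟩ := e1
  have e2 : ∃ n, 4^l ≤ n ∧ n < 4^l + 4^l ∧ c (n+1) ≤ (1+η) * c n := by
    by_contra hcon
    push Not at hcon
    have h1 := seq_pigeon c (1+η) (by positivity) (4^l) (4^l) hcon
    have h2 : c (4^l+4^l) ≤ c (4^(l+1)) := cmono (by rw [pow_succ]; omega)
    have h3 := one_add_mul_le_pow (show (-2:ℝ) ≤ η by linarith) (4^l)
    have h4 : (4:ℝ)^(2*K) ≤ ((4^l : ℕ):ℝ) * η := by
      have a1 : (l0:ℝ) ≤ ((4^l:ℕ):ℝ) := by exact_mod_cast hl1.trans (lpow l)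
      have := (div_le_iff₀ hη).1 hl0.2
      nlinarith
    have h5 : (4:ℝ)^(2*K) < (1+η)^(4^l) := by linarith
    have := mul_lt_mul_of_pos_right h5 (cpos (4^l))
    linarith
  obtain ⟨n, hn1, hn2, hn3⟩ := e2
  have hln := lpow l
  refine ⟨n, by omega, by omega, ?_, hn3, ?_⟩
  · have : 4^l ≤ 4^(2*l0) := Nat.pow_le_pow_right (by norm_num) (by omega)
    omega
  · calc c (n+n) ≤ c (4^(l+1)) := cmono (by rw [pow_succ]; omega)
      _ ≤ _ := hl3
      _ ≤ _ := mul_le_mul_of_nonneg_left (cmono hn1) (by positivity)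

set_option maxHeartbeats 1000000 in
lemma stage2 (K : ℕ) (hK1 : 1 ≤ K) (ε : ℝ) (hε : 0 < ε) (wmin : ℕ) : ∃ wmax : ℕ,
    ∀ (G : Type u) [AddCommGroup G] (A : Finset G), (0:G) ∈ A → (∀ v ∈ A, -v ∈ A) →
      Cov K ((A:Set G) + (A:Set G)) A →
      ∃ (w : ℕ) (p : LN G), wmin ≤ w ∧ w ≤ wmax ∧ (∀ a ∈ A, p.f a ≤ ε) ∧
        ∀ v ∈ msum A (w^2), p.f v ≤ 1/16 → v ∈ msum A w := by
  obtain ⟨c, hc⟩ : ∃ c : ℝ, c = 1/(2*4^K) := ⟨_, rfl⟩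
  have hcpos : 0 < c := by rw [hc]; positivity
  obtain ⟨wmax, hw⟩ := growth_scale.{u} K hK1 (ε*c/2) (by positivity) wmin
  refine ⟨4*wmax, fun G _ A h0 hs hcov => ?_⟩
  classical
  obtain ⟨n, hn1, hn2, hn3, hn4, hn5⟩ := hw G A h0 hcov
  have hne : Nonempty (msum A n) := ⟨⟨0, msum_zero_mem h0 n⟩⟩
  have hpos : (0:ℝ) < (msum A n).card := by exact_mod_cast msum_card_pos h0 n
  obtain ⟨Γ, hΓ1, hΓ2⟩ := fourier_L (Ω := msum A n) (fun x => (x : G)) ((msum A n).card : ℝ) ((4:ℝ)^(2*K)) c hpos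
    (by
      have : (Finset.univ.filter (fun ab : (msum A n) × (msum A n) => (ab.1 : G) = ab.2)).card ≤ (msum A n).card := by
        rw [← Fintype.card_coe (msum A n), ← Finset.card_univ]
        refine Finset.card_le_card_of_injOn Prod.fst (fun _ _ => Finset.mem_coe.2 (Finset.mem_univ _)) ?_
        rintro ⟨a, b⟩ hab ⟨a', b'⟩ hab' h
        simp only [Finset.coe_filter, Finset.mem_univ, true_and, Set.mem_ofPred_eq] at hab hab'
        simp only at h
        subst h
        have : b = b' := Subtype.ext (hab.symm.trans hab')
        rw [this]
      have h2 : ((Finset.univ.filter (fun ab : (msum A n) × (msum A n) => (ab.1 : G) = ab.2)).card : ℝ) ≤ (msum A n).card := by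
        exact_mod_cast this
      simp only [Fintype.card_coe]
      rw [sq]
      exact mul_le_mul_of_nonneg_right h2 hpos.le)
    (msum A (n+n)) (fun a b => msum_add a.2 b.2) hn5
    (by
      have e : (4:ℝ)^(2*K) = (4^K)^2 := by rw [← pow_mul, mul_comm]
      rw [hc, e]
      have : (0:ℝ) < 4^K := by positivity
      apply le_of_eq
      field_simp
      norm_num)
    (msum A ((4*n)^2))
  refine ⟨4*n, pn Γ, by omega, by omega, ?_, ?_⟩
  · intro a ha
    refine pn_le Γ a ε hε.le (fun γ hγ => ?_)
    have h1 := hΓ1 γ hγ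
    rw [Finset.sum_coe_sort (msum A n) (fun z => ev γ z), Fintype.card_coe] at h1
    have h2 : (1-ε*c/2) * (msum A n).card ≤ (((msum A n).filter (fun z => z - a ∈ msum A n)).card : ℝ) := by
      have b1 : (msum A n).filter (fun z => z - a ∈ msum A n) = msum A n ∩ (msum A n).image (fun z => z + a) := by
        ext z
        simp only [Finset.mem_filter, Finset.mem_inter, Finset.mem_image, and_congr_right_iff]
        intro _
        constructor
        · intro h; exact ⟨_, h, by abel⟩
        · rintro ⟨y, hy, rfl⟩; simpa using hy
      have b2 : msum A n ∪ (msum A n).image (fun z => z + a) ⊆ msum A (n+1) := by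
        apply Finset.union_subset (msum_mono h0 (by omega))
        intro z hz
        obtain ⟨y, hy, rfl⟩ := Finset.mem_image.1 hz
        exact mem_msum_succ.2 ⟨y, hy, a, ha, rfl⟩
      have b3 := Finset.card_union_add_card_inter (msum A n) ((msum A n).image (fun z => z + a))
      have b4 : ((msum A n).image (fun z => z + a)).card = (msum A n).card :=
        Finset.card_image_of_injective _ (add_left_injective a)
      have b5 := Finset.card_le_card b2
      rw [b1]
      have b6 : ((msum A n).card : ℝ) + (msum A n).card ≤ (msum A (n+1)).card + (msum A n ∩ (msum A n).image (fun z => z + a)).card := by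
        exact_mod_cast (by omega : (msum A n).card + (msum A n).card ≤ (msum A (n+1)).card + (msum A n ∩ (msum A n).image (fun z => z + a)).card)
      linarith
    have h3 := almost_inv _ a _ h2 γ
    have h4 := norm_le_ev γ a
    have h5 := mul_le_mul_of_nonneg_left h1 (norm_nonneg (1 - ev γ a))
    have h6 : ‖1 - ev γ a‖ * (c * (msum A n).card) ≤ ε * (c * (msum A n).card) := by
      calc _ ≤ _ := h5
        _ ≤ _ := h3
        _ = _ := by ring
    exact h4.trans (le_of_mul_le_mul_right h6 (by positivity))
  · intro v hv hp
    obtain ⟨a, b, c', d, h⟩ := hΓ2 v hv (fun γ hγ => (le_pn Γ hγ v).trans hp)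
    rw [h]
    have := msum_sub hs (msum_sub hs (msum_add a.2 b.2) c'.2) d.2
    convert this using 2
    omega


section Growth
variable {G : Type u} [AddCommGroup G]

/-- a set whose differences lying in `2A` fall in `D` has size at most `N * |D|` -/
lemma cov_diff_count {A : Finset G} (hs : ∀ v ∈ A, -v ∈ A) {N : ℕ} (S : Finset G)
    (hS : Cov N (S : Set G) A) (T D : Finset G) (hT : T ⊆ S)
    (hD : ∀ x ∈ T, ∀ y ∈ T, x - y ∈ msum A 2 → x - y ∈ D) : T.card ≤ N * D.card := by
  classical
  obtain ⟨F, hF, hc⟩ := hS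
  have : T ⊆ F.biUnion (fun f => T.filter (fun t => t - f ∈ A)) := by
    intro t ht
    obtain ⟨f, hf, a, ha, hfa⟩ := hc (hT ht)
    refine Finset.mem_biUnion.2 ⟨f, hf, Finset.mem_filter.2 ⟨ht, ?_⟩⟩
    simp only at hfa
    rw [← hfa]; simpa using ha
  refine (Finset.card_le_card this).trans
    ((Finset.card_biUnion_le_card_mul _ _ D.card ?_).trans (Nat.mul_le_mul_right _ hF))
  intro f _
  rcases Finset.eq_empty_or_nonempty (T.filter (fun t => t - f ∈ A)) with h | ⟨t0, h0⟩
  · simp [h]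
  · refine Finset.card_le_card_of_injOn (fun t => t - t0) ?_ (fun a _ b _ h => by simpa using h)
    intro t ht
    have h1 := Finset.mem_filter.1 ht
    have h2 := Finset.mem_filter.1 h0
    refine hD t h1.1 t0 h2.1 ?_
    have e : t - t0 = (t - f) + -(t0 - f) := by abel
    rw [e]
    exact mem_msum_two.2 ⟨_, h1.2, _, hs _ h2.2, rfl⟩

lemma pow_two_cov {X : Finset G} {K : ℕ} (hX : Cov K ((X:Set G) + (X:Set G)) X) (r : ℕ) :
    ∃ F : Finset G, F.card ≤ K^r ∧ ∀ x ∈ X, ∃ f ∈ F, ∃ x' ∈ X, (2^r) • x = f + x' := by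
  classical
  induction r with
  | zero => exact ⟨{0}, by simp, fun x hx => ⟨0, by simp, x, hx, by simp⟩⟩
  | succ r ih =>
    obtain ⟨F', h1, h2⟩ := ih
    obtain ⟨F, h3, h4⟩ := hX
    refine ⟨F'.image (fun f => f + f) + F, ?_, ?_⟩
    · rw [pow_succ]
      exact Finset.card_add_le.trans (Nat.mul_le_mul (Finset.card_image_le.trans h1) h3)
    · intro x hx
      obtain ⟨f, hf, x', hx', e⟩ := h2 x hx
      obtain ⟨g, hg, y, hy, e'⟩ := h4 ⟨x', hx', x', hx', rfl⟩
      simp only at e'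
      refine ⟨f + f + g, Finset.add_mem_add (Finset.mem_image_of_mem _ hf) hg, y, hy, ?_⟩
      rw [pow_succ, mul_comm, mul_smul, e, two_nsmul, add_assoc (f+f), e']
      abel

lemma ruzsaR [DecidableEq G] (V P : Finset G) (hP : P.Nonempty) :
    ∃ E ⊆ V, E.card * P.card ≤ (V + P).card ∧ ∀ v ∈ V, ∃ e ∈ E, ∃ a ∈ P, ∃ b ∈ P, v = e + (a - b) := by
  have hpos : (0:ℝ) < P.card := by exact_mod_cast Finset.card_pos.2 hP
  obtain ⟨E, h2, h3, h4⟩ := Finset.ruzsa_covering_add (A := V) (K := ((V+P).card : ℝ)/P.card) hP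
    (by rw [div_mul_cancel₀ _ hpos.ne'])
  refine ⟨E, h2, ?_, fun v hv => ?_⟩
  · rw [le_div_iff₀ hpos] at h3
    exact_mod_cast h3
  obtain ⟨e, he, d, hd, rfl⟩ := Finset.mem_add.1 (h4 hv)
  obtain ⟨a, ha, b, hb, rfl⟩ := Finset.mem_sub.1 hd
  exact ⟨e, he, a, ha, b, hb, rfl⟩

open Classical in
/-- ball count -/
noncomputable def bb (A : Finset G) (p q : LN G) (s s' : ℝ) : Finset G :=
  (msum A 2).filter (fun v => p.f v ≤ s ∧ q.f v ≤ s')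

lemma mem_bb {A : Finset G} {p q : LN G} {s s' : ℝ} {v : G} :
    v ∈ bb A p q s s' ↔ v ∈ msum A 2 ∧ p.f v ≤ s ∧ q.f v ≤ s' := by
  simp [bb]

lemma bb_mono {A : Finset G} {p q : LN G} {s s' t t' : ℝ} (h : s ≤ t) (h' : s' ≤ t') :
    bb A p q s s' ⊆ bb A p q t t' := by
  intro v hv
  rw [mem_bb] at hv ⊢
  exact ⟨hv.1, hv.2.1.trans h, hv.2.2.trans h'⟩

lemma growth (X A : Finset G) (K NA CA r : ℕ) (hX : Cov K ((X:Set G) + (X:Set G)) X) (hX0 : (0:G) ∈ X)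
    (h0 : (0:G) ∈ A) (hs : ∀ v ∈ A, -v ∈ A) (hXA : Cov NA (X : Set G) A)
    (hCA : ∀ D : Finset G, (∀ d ∈ D, ∃ x ∈ X, ∃ a ∈ msum A 2, d = x + a) → D.card ≤ CA * X.card)
    (p q : LN G) (hp : ∀ a ∈ A, p.f a ≤ (1/2)^(r+4)) (hq : ∀ a ∈ A, q.f a ≤ (1/2)^(r+4))
    (s s' : ℝ) (hs0 : 0 ≤ s) (hs0' : 0 ≤ s') :
    (bb A p q s s').card ≤ NA * CA * K^r * (bb A p q (4 * s/2^r) (4*s'/2^r)).card := by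
  classical
  set D := bb A p q s s' with hD
  have hDne : D.Nonempty := ⟨0, mem_bb.2 ⟨msum_zero_mem h0 2, by rw [p.zero']; exact hs0, by rw [q.zero']; exact hs0'⟩⟩
  have hDpos : 0 < D.card := Finset.card_pos.2 hDne
  have hXpos : 0 < X.card := Finset.card_pos.2 ⟨0, hX0⟩
  obtain ⟨Xs, -, hXs1, hXs2⟩ := ruzsaR X D hDne
  have hXs1 : Xs.card * D.card ≤ CA * X.card := by
    refine hXs1.trans (hCA _ ?_)
    intro d hd
    obtain ⟨x, hx, a, ha, rfl⟩ := Finset.mem_add.1 hd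
    exact ⟨x, hx, a, (mem_bb.1 ha).1, rfl⟩
  obtain ⟨F, hF, hF2⟩ := hXA
  obtain ⟨F', hF', hF2'⟩ := pow_two_cov hX r
  have key : ∀ x : G, ∃ c : G × G × G, x ∈ X → c ∈ F ×ˢ F' ×ˢ Xs ∧ x - c.1 ∈ A ∧
      ∃ d ∈ D, ∃ d' ∈ D, (2^r) • x = c.2.1 + c.2.2 + (d - d') := by
    intro x
    by_cases hx : x ∈ X
    · obtain ⟨f, hf, a, ha, e⟩ := hF2 hx
      obtain ⟨f', hf', x', hx', e'⟩ := hF2' x hx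
      obtain ⟨y, hy, d, hd, d', hd', e''⟩ := hXs2 x' hx'
      refine ⟨⟨f, f', y⟩, fun _ => ⟨by simp only [Finset.mem_product]; exact ⟨hf, hf', hy⟩, ?_, d, hd, d', hd', ?_⟩⟩
      · simp only at e ⊢
        rw [← e]; simpa using ha
      · simp only
        rw [e', e'']; abel
    · exact ⟨0, fun h => absurd h hx⟩
  choose φ hφ using key
  have hcard : X.card ≤ (bb A p q (4 * s/2^r) (4*s'/2^r)).card * (F ×ˢ F' ×ˢ Xs).card := by
    refine Finset.card_le_mul_card_image_of_maps_to (f := φ) (fun x hx => (hφ x hx).1) _ ?_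
    intro b _
    rcases Finset.eq_empty_or_nonempty (X.filter (fun x => φ x = b)) with h | ⟨t0, ht0⟩
    · simp [h]
    · refine Finset.card_le_card_of_injOn (fun t => t - t0) ?_ (fun a _ b _ h => by simpa using h)
      intro t ht
      have h1 := Finset.mem_filter.1 ht
      have h2 := Finset.mem_filter.1 ht0
      obtain ⟨-, a1, d1, hd1, d1', hd1', e1⟩ := hφ t h1.1
      obtain ⟨-, a2, d2, hd2, d2', hd2', e2⟩ := hφ t0 h2.1
      rw [h1.2] at a1 e1
      rw [h2.2] at a2 e2
      have e : t - t0 = (t - b.1) + -(t0 - b.1) := by abel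
      have hmem : t - t0 ∈ msum A 2 := by
        rw [e]
        exact mem_msum_two.2 ⟨_, a1, _, hs _ a2, rfl⟩
      have e3 : (2^r) • (t - t0) = d1 - d1' - (d2 - d2') := by
        rw [nsmul_sub, e1, e2]; abel
      have main : ∀ p : LN G, (∀ a ∈ A, p.f a ≤ (1/2)^(r+4)) → ∀ s, p.f d1 ≤ s → p.f d1' ≤ s → p.f d2 ≤ s →
          p.f d2' ≤ s → p.f (t - t0) ≤ 4*s/2^r := by
        intro p hp s i1 i2 i3 i4
        have j1 : p.f (t - t0) ≤ 2 * (1/2)^(r+4) := by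
          rw [e]
          have := p.add_le (t - b.1) (-(t0 - b.1))
          rw [p.neg] at this
          have := hp _ a1
          have := hp _ a2
          linarith
        have j2 : ((2^r : ℕ):ℝ) * p.f (t - t0) ≤ 1/2 := by
          have : ((2^r : ℕ):ℝ) * (2 * (1/2)^(r+4)) = 1/8 := by
            push_cast
            rw [pow_add, one_div_pow]
            field_simp
            norm_num
          have k := mul_le_mul_of_nonneg_left j1 (show (0:ℝ) ≤ ((2^r : ℕ):ℝ) by positivity)
          linarith
        have j3 := p.hom _ _ j2
        rw [e3] at j3
        have j4 := p.sub_le (d1 - d1') (d2 - d2')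
        have j5 := p.sub_le d1 d1'
        have j6 := p.sub_le d2 d2'
        rw [le_div_iff₀ (by positivity)]
        push_cast at j3
        linarith
      rw [hD, mem_bb] at hd1 hd1' hd2 hd2'
      refine Finset.mem_coe.2 (mem_bb.2 ⟨hmem, ?_, ?_⟩)
      · exact main p hp s hd1.2.1 hd1'.2.1 hd2.2.1 hd2'.2.1
      · exact main q hq s' hd1.2.2 hd1'.2.2 hd2.2.2 hd2'.2.2
  set b2 := (bb A p q (4 * s/2^r) (4*s'/2^r)).card
  rw [Finset.card_product, Finset.card_product] at hcard
  have h5 : X.card ≤ b2 * (NA * (K^r * Xs.card)) := hcard.trans (by gcongr)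
  have h6 : X.card * D.card ≤ X.card * (NA * CA * K^r * b2) := by
    calc X.card * D.card ≤ b2 * (NA * (K^r * Xs.card)) * D.card := Nat.mul_le_mul_right _ h5
      _ = b2 * NA * K^r * (Xs.card * D.card) := by ring
      _ ≤ b2 * NA * K^r * (CA * X.card) := Nat.mul_le_mul_left _ hXs1
      _ = _ := by ring
  exact Nat.le_of_mul_le_mul_left h6 hXpos

lemma growth_iter (X A : Finset G) (K NA CA ρ : ℕ) (hX : Cov K ((X:Set G) + (X:Set G)) X) (hX0 : (0:G) ∈ X)
    (h0 : (0:G) ∈ A) (hs : ∀ v ∈ A, -v ∈ A) (hXA : Cov NA (X : Set G) A)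
    (hCA : ∀ D : Finset G, (∀ d ∈ D, ∃ x ∈ X, ∃ a ∈ msum A 2, d = x + a) → D.card ≤ CA * X.card)
    (hρ2 : 2 ≤ ρ) (hρ : NA * CA ≤ K^(ρ-2))
    (p q : LN G) (hp : ∀ a ∈ A, p.f a ≤ (1/2)^(ρ+6)) (hq : ∀ a ∈ A, q.f a ≤ (1/2)^(ρ+6))
    (k : ℕ) : ∀ s s' : ℝ, 0 ≤ s → 0 ≤ s' →
    (bb A p q s s').card ≤ K^(2*ρ*k) * (bb A p q (s/2^(ρ*k)) (s'/2^(ρ*k))).card := by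
  induction k with
  | zero => intro s s' _ _; simp
  | succ k ih =>
    intro s s' hs0 hs0'
    have h1 := growth X A K NA CA (ρ+2) hX hX0 h0 hs hXA hCA p q hp hq s s' hs0 hs0'
    have e : ∀ s : ℝ, 4 * s / 2^(ρ+2) = s / 2^ρ := by
      intro s; rw [pow_add]; field_simp; ring
    rw [e, e] at h1
    have h2 := ih (s/2^ρ) (s'/2^ρ) (by positivity) (by positivity)
    have e2 : ∀ s : ℝ, s / 2^ρ / 2^(ρ*k) = s / 2^(ρ*(k+1)) := by
      intro s; rw [div_div, ← pow_add]; congr 2; ring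
    rw [e2, e2] at h2
    set b := (bb A p q (s/2^(ρ*(k+1))) (s'/2^(ρ*(k+1)))).card
    calc _ ≤ _ := h1
      _ ≤ K^(ρ-2) * K^(ρ+2) * (K^(2*ρ*k) * b) := by gcongr
      _ = _ := by
        rw [← mul_assoc, ← pow_add, ← pow_add]; congr 2
        have : ρ - 2 + (ρ + 2) = 2*ρ := by omega
        rw [this]; ring
end Growth


section Trap
variable {G : Type u} [AddCommGroup G]

lemma trap_le (q : LN G) (v : G) (t θ : ℝ) (ht0 : 0 ≤ t) (ht : t ≤ 1/16) (hθ0 : 0 ≤ θ) (hθ : θ ≤ 1/4)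
    (h : ∀ l : ℕ, l * t ≤ 1/16 → q.f (l • v) ≤ θ) : q.f v ≤ 32 * θ * t := by
  rcases ht0.eq_or_lt with h0 | hpos
  · subst h0
    have h1 : ∀ L : ℕ, 1 ≤ L → q.f v * L ≤ θ := fun L hL =>
      q.small_of_multiples v θ hθ L hL (fun l _ _ => h l (by norm_num))
    have : q.f v ≤ 0 := by
      by_contra hc
      push Not at hc
      obtain ⟨n, hn⟩ := exists_nat_gt (θ / q.f v)
      have h2 := h1 (n+1) (by omega)
      rw [div_lt_iff₀ hc] at hn
      push_cast at h2
      nlinarith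
    linarith
  · set L := ⌊1/(16*t)⌋₊ with hL
    have hL1 : 1 ≤ L := by
      rw [hL, Nat.le_floor_iff (by positivity)]
      rw [le_div_iff₀ (by positivity)]; push_cast; linarith
    have hL2 : (L:ℝ) ≤ 1/(16*t) := Nat.floor_le (by positivity)
    have hL3 : 1/(16*t) < L + 1 := Nat.lt_floor_add_one _
    rw [le_div_iff₀ (by positivity)] at hL2
    rw [div_lt_iff₀ (by positivity)] at hL3
    have h1 := q.small_of_multiples v θ hθ L hL1 (fun l _ hl => h l (by
      have : (l:ℝ) ≤ L := by exact_mod_cast hl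
      nlinarith))
    have hL1' : (1:ℝ) ≤ L := by exact_mod_cast hL1
    have h5 : 1 ≤ 32 * t * L := by nlinarith
    have := q.nonneg v
    calc q.f v ≤ q.f v * (32 * t * L) := le_mul_of_one_le_right this h5
      _ = (q.f v * L) * (32 * t) := by ring
      _ ≤ θ * (32 * t) := mul_le_mul_of_nonneg_right h1 (by positivity)
      _ = _ := by ring

/-- `wA` is trapped by the norm `p` -/
def GoodW (A : Finset G) (w : ℕ) (p : LN G) : Prop :=
  2 ≤ w ∧ ∀ v ∈ msum A (w^2), p.f v ≤ 1/16 → v ∈ msum A w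

lemma GoodW.mem {A : Finset G} (h0 : (0:G) ∈ A) {w : ℕ} {p : LN G} (h : GoodW A w p) {m : ℕ} {v : G}
    (hv : v ∈ msum A m) (hm : m ≤ w^2) (hp : p.f v ≤ 1/16) : v ∈ msum A w :=
  h.2 v (msum_mono h0 hm hv) hp

lemma GoodW.add {A : Finset G} (h0 : (0:G) ∈ A) {w : ℕ} {p : LN G} (h : GoodW A w p) {x y : G}
    (hx : x ∈ msum A w) (hy : y ∈ msum A w) (hp : p.f (x + y) ≤ 1/16) : x + y ∈ msum A w :=
  h.mem h0 (msum_add hx hy) (by have := h.1; nlinarith) hp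

lemma GoodW.sub {A : Finset G} (h0 : (0:G) ∈ A) (hs : ∀ v ∈ A, -v ∈ A) {w : ℕ} {p : LN G} (h : GoodW A w p) {x y : G}
    (hx : x ∈ msum A w) (hy : y ∈ msum A w) (hp : p.f (x - y) ≤ 1/16) : x - y ∈ msum A w :=
  h.mem h0 (msum_sub hs hx hy) (by have := h.1; nlinarith) hp

lemma GoodW.nsmul {A : Finset G} (h0 : (0:G) ∈ A) {w : ℕ} {p : LN G} (h : GoodW A w p) {x : G}
    (hx : x ∈ msum A w) (l : ℕ) (hp : l * p.f x ≤ 1/16) : l • x ∈ msum A w := by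
  induction l with
  | zero => simpa using msum_zero_mem h0 w
  | succ l ih =>
    rw [succ_nsmul]
    push_cast at hp
    have hn := p.nonneg x
    refine h.add h0 (ih (by linarith)) hx ?_
    rw [← succ_nsmul]
    have := p.nsmul_le (l+1) x
    push_cast at this
    linarith

lemma GoodW.zsmul {A : Finset G} (h0 : (0:G) ∈ A) (hs : ∀ v ∈ A, -v ∈ A) {w : ℕ} {p : LN G} (h : GoodW A w p) {x : G}
    (hx : x ∈ msum A w) (l : ℤ) (hp : |(l:ℝ)| * p.f x ≤ 1/16) : l • x ∈ msum A w := by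
  rcases Int.eq_nat_or_neg l with ⟨n, rfl | rfl⟩
  · rw [natCast_zsmul]; exact h.nsmul h0 hx n (by simpa using hp)
  · rw [neg_smul, natCast_zsmul]; exact msum_neg hs (h.nsmul h0 hx n (by simpa using hp))

lemma GoodW.sum {A : Finset G} (h0 : (0:G) ∈ A) (hs : ∀ v ∈ A, -v ∈ A) {w : ℕ} {p : LN G} (h : GoodW A w p)
    {ι : Type*} (S : Finset ι) (c : ι → ℤ) (u : ι → G) (hu : ∀ i ∈ S, u i ∈ msum A w)
    (hp : ∑ i ∈ S, |(c i:ℝ)| * p.f (u i) ≤ 1/16) : ∑ i ∈ S, c i • u i ∈ msum A w := by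
  classical
  induction S using Finset.induction_on with
  | empty => simpa using msum_zero_mem h0 w
  | insert a S ha ih =>
    rw [Finset.sum_insert ha] at hp ⊢
    have n1 : 0 ≤ |(c a:ℝ)| * p.f (u a) := mul_nonneg (abs_nonneg _) (p.nonneg _)
    have n2 : 0 ≤ ∑ i ∈ S, |(c i:ℝ)| * p.f (u i) := Finset.sum_nonneg fun i _ => mul_nonneg (abs_nonneg _) (p.nonneg _)
    refine h.add h0 (h.zsmul h0 hs (hu a (Finset.mem_insert_self _ _)) _ (by linarith))
      (ih (fun i hi => hu i (Finset.mem_insert_of_mem hi)) (by linarith)) ?_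
    have a1 := p.add_le (c a • u a) (∑ i ∈ S, c i • u i)
    have a2 := p.zsmul_le (c a) (u a)
    have a3 := p.sum_le S (fun i => c i • u i)
    have a4 : ∑ i ∈ S, p.f (c i • u i) ≤ ∑ i ∈ S, |(c i:ℝ)| * p.f (u i) :=
      Finset.sum_le_sum fun i _ => p.zsmul_le _ _
    linarith

lemma msum_norm_le {A : Finset G} (p : LN G) (c : ℝ) (h : ∀ a ∈ A, p.f a ≤ c) (n : ℕ) :
    ∀ v ∈ msum A n, p.f v ≤ n * c := by
  induction n with
  | zero => intro v hv; rw [mem_msum_zero.1 hv, p.zero']; simp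
  | succ n ih =>
    intro v hv
    obtain ⟨z, hz, a, ha, rfl⟩ := mem_msum_succ.1 hv
    have := p.add_le z a
    have := ih z hz
    have := h a ha
    push_cast
    linarith

lemma GoodW.le {A : Finset G} (h0 : (0:G) ∈ A) {w : ℕ} {p' p : LN G} (h : GoodW A w p')
    (hp : ∀ v ∈ msum A w, p.f v ≤ 1/200) {v : G} (hv : v ∈ msum A w) : p.f v ≤ p'.f v := by
  rcases le_or_gt (p'.f v) (1/16) with h1 | h1
  · have := trap_le p v (p'.f v) (1/200) (p'.nonneg v) h1 (by norm_num) (by norm_num)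
      (fun l hl => hp _ (h.nsmul h0 hv l hl))
    have := p'.nonneg v
    linarith
  · have := hp v hv
    linarith

lemma chain (K : ℕ) (hK1 : 1 ≤ K) (ε : ℝ) (hε : 0 < ε) (n : ℕ) : ∃ Wm : ℕ,
    ∀ (G : Type u) [AddCommGroup G] (A : Finset G), (0:G) ∈ A → (∀ v ∈ A, -v ∈ A) →
      Cov K ((A:Set G)+(A:Set G)) A →
      ∃ (w : ℕ → ℕ) (p : ℕ → LN G), (∀ i ≤ n, GoodW A (w i) (p i) ∧ w i ≤ Wm ∧ ∀ a ∈ A, (p i).f a ≤ ε) ∧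
        ∀ i < n, w i ≤ w (i+1) ∧ ∀ v ∈ msum A (w i), (p (i+1)).f v ≤ 1/200 := by
  induction n with
  | zero =>
    obtain ⟨Wm, h⟩ := stage2.{u} K hK1 ε hε 2
    refine ⟨Wm, fun G _ A h0 hs hc => ?_⟩
    obtain ⟨w, p, h1, h2, h3, h4⟩ := h G A h0 hs hc
    exact ⟨fun _ => w, fun _ => p, fun i _ => ⟨⟨h1, h4⟩, h2, h3⟩, fun i hi => absurd hi (by omega)⟩
  | succ n ih =>
    obtain ⟨Wm, ih⟩ := ih
    obtain ⟨Wm', h⟩ := stage2.{u} K hK1 (min ε (1/(200*(Wm+1)))) (by positivity) (Wm+2)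
    refine ⟨max Wm Wm', fun G _ A h0 hs hc => ?_⟩
    obtain ⟨w, p, i1, i2⟩ := ih G A h0 hs hc
    obtain ⟨w', p', h1, h2, h3, h4⟩ := h G A h0 hs hc
    refine ⟨fun i => if i ≤ n then w i else w', fun i => if i ≤ n then p i else p', ?_, ?_⟩
    · intro i hi
      by_cases hin : i ≤ n
      · simp only [hin, if_true]
        exact ⟨(i1 i hin).1, (i1 i hin).2.1.trans (le_max_left _ _), (i1 i hin).2.2⟩
      · simp only [hin, if_false]
        exact ⟨⟨by omega, h4⟩, h2.trans (le_max_right _ _), fun a ha => (h3 a ha).trans (min_le_left _ _)⟩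
    · intro i hi
      have hin : i ≤ n := by omega
      by_cases hin' : i + 1 ≤ n
      · simp only [hin, hin', if_true]
        exact i2 i (by omega)
      · simp only [hin, hin', if_true, if_false]
        have hw := (i1 i hin).2.1
        refine ⟨by omega, fun v hv => ?_⟩
        have := msum_norm_le p' _ (fun a ha => (h3 a ha).trans (min_le_right _ _)) _ v hv
        refine this.trans ?_
        have hw' : (w i : ℝ) ≤ Wm := by exact_mod_cast hw
        rw [mul_one_div, div_le_div_iff₀ (by positivity) (by norm_num)]
        linarith
end Trap

section BigP
variable {R : Type u} [NonUnitalRing R]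

/-- the two-sided version of a norm -/
noncomputable def bigP (A : Finset R) (p : LN R) : LN R :=
  LN.sup (ι := Option (A ⊕ A)) (fun i => match i with
    | none => p
    | some (Sum.inl a) => p.comp (AddMonoidHom.mulRight (a : R))
    | some (Sum.inr a) => p.comp (AddMonoidHom.mulLeft (a : R)))

lemma bigP_self (A : Finset R) (p : LN R) (x : R) : p.f x ≤ (bigP A p).f x :=
  LN.le_sup (ι := Option (A ⊕ A)) (fun i => match i with
    | none => p
    | some (Sum.inl a) => p.comp (AddMonoidHom.mulRight (a : R))
    | some (Sum.inr a) => p.comp (AddMonoidHom.mulLeft (a : R))) none x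

lemma bigP_right (A : Finset R) (p : LN R) (x : R) {a : R} (ha : a ∈ A) : p.f (x * a) ≤ (bigP A p).f x :=
  LN.le_sup (ι := Option (A ⊕ A)) (fun i => match i with
    | none => p
    | some (Sum.inl a) => p.comp (AddMonoidHom.mulRight (a : R))
    | some (Sum.inr a) => p.comp (AddMonoidHom.mulLeft (a : R))) (some (Sum.inl ⟨a, ha⟩)) x

lemma bigP_left (A : Finset R) (p : LN R) (x : R) {a : R} (ha : a ∈ A) : p.f (a * x) ≤ (bigP A p).f x :=
  LN.le_sup (ι := Option (A ⊕ A)) (fun i => match i with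
    | none => p
    | some (Sum.inl a) => p.comp (AddMonoidHom.mulRight (a : R))
    | some (Sum.inr a) => p.comp (AddMonoidHom.mulLeft (a : R))) (some (Sum.inr ⟨a, ha⟩)) x

lemma bigP_le (A : Finset R) (p : LN R) (x : R) (c : ℝ) (h : p.f x ≤ c) (hr : ∀ a ∈ A, p.f (x * a) ≤ c)
    (hl : ∀ a ∈ A, p.f (a * x) ≤ c) : (bigP A p).f x ≤ c := by
  apply LN.sup_le
  rintro (_ | a | a)
  · exact h
  · exact hr a a.2
  · exact hl a a.2
end BigP


section Select
variable {R : Type u} [NonUnitalRing R]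

/-- growth hypothesis -/
def HG (A : Finset R) (K ρ : ℕ) : Prop :=
  ∀ p q : LN R, (∀ a ∈ A, p.f a ≤ (1/2)^(ρ+6)) → (∀ a ∈ A, q.f a ≤ (1/2)^(ρ+6)) → ∀ (k : ℕ) (s s' : ℝ),
    0 ≤ s → 0 ≤ s' → (bb A p q s s').card ≤ K^(2*ρ*k) * (bb A p q (s/2^(ρ*k)) (s'/2^(ρ*k))).card

/-- basic properties of the set `A` -/
structure BA (A : Finset R) : Prop where
  h0 : (0:R) ∈ A
  hs : ∀ v ∈ A, -v ∈ A
  hm : ∀ v ∈ A, ∀ w ∈ A, v * w ∈ A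

lemma BA.mulr {A : Finset R} (h : BA A) {n : ℕ} {v a : R} (hv : v ∈ msum A n) (ha : a ∈ A) : v * a ∈ msum A n := by
  have := msum_mul h.hm hv (mem_msum_one.2 ha)
  rwa [mul_one] at this

lemma BA.mull {A : Finset R} (h : BA A) {n : ℕ} {v a : R} (hv : v ∈ msum A n) (ha : a ∈ A) : a * v ∈ msum A n := by
  have := msum_mul h.hm (mem_msum_one.2 ha) hv
  rwa [one_mul] at this

lemma bigP_A {A : Finset R} (h : BA A) {p : LN R} {c : ℝ} (hp : ∀ a ∈ A, p.f a ≤ c) :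
    ∀ a ∈ A, (bigP A p).f a ≤ c := by
  intro a ha
  exact bigP_le A p a c (hp a ha) (fun b hb => hp _ (h.hm _ ha _ hb)) (fun b hb => hp _ (h.hm _ hb _ ha))

/-- the data of a selected scale -/
structure Sel (A : Finset R) (ρ j Wm w' w : ℕ) (p' p : LN R) : Prop where
  g' : GoodW A w' p'
  g : GoodW A w p
  ww : w' ≤ w
  wW : w ≤ Wm
  small : ∀ v ∈ msum A w', p.f v ≤ 1/200
  e' : ∀ a ∈ A, p'.f a ≤ (1/2)^(ρ+6)
  e : ∀ a ∈ A, p.f a ≤ (1/2)^(ρ+6)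
  cnt : (bb A (bigP A p) (bigP A p) (1/2^(2*ρ*j)) (1/2^(2*ρ*j))).card ≤
    2^(ρ*j) * (bb A (bigP A p') (bigP A p') (1/2^(2*ρ*j)) (1/2^(2*ρ*j))).card

lemma bigP_mono {A : Finset R} (h : BA A) {w' : ℕ} {p' p : LN R} (g' : GoodW A w' p')
    (small : ∀ v ∈ msum A w', p.f v ≤ 1/200) {v : R} (hv : v ∈ msum A w') :
    (bigP A p).f v ≤ (bigP A p').f v := by
  refine bigP_le A p v _ ?_ ?_ ?_
  · exact (g'.le h.h0 small hv).trans (bigP_self A p' v)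
  · intro a ha
    exact (g'.le h.h0 small (h.mulr hv ha)).trans (bigP_right A p' v ha)
  · intro a ha
    exact (g'.le h.h0 small (h.mull hv ha)).trans (bigP_left A p' v ha)

lemma select (K KA ρ : ℕ) (hK : 2 ≤ K) (hKA : 1 ≤ KA) (hρ : 1 ≤ ρ) : ∃ Wm : ℕ, ∀ j : ℕ, 1 ≤ j →
    ∀ (R : Type u) [NonUnitalRing R] (A : Finset R), BA A → Cov KA ((A:Set R)+(A:Set R)) A → HG A K ρ →
    ∃ w' w p' p, Sel A ρ j Wm w' w p' p := by
  obtain ⟨Wm, H⟩ := chain.{u} KA hKA ((1/2)^(ρ+6)) (by positivity) (4*K)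
  refine ⟨Wm, fun j hj R _ A hA hcov hG => ?_⟩
  obtain ⟨w, p, h1, h2⟩ := H R A hA.h0 hA.hs hcov
  set s : ℝ := 1/2^(2*ρ*j) with hsdef
  have hs0 : 0 ≤ s := by positivity
  set b : ℕ → ℕ := fun i => (bb A (bigP A (p i)) (bigP A (p i)) s s).card with hb
  by_cases hex : ∃ i < 4*K, b (i+1) ≤ 2^(ρ*j) * b i
  · obtain ⟨i, hi, hi2⟩ := hex
    exact ⟨w i, w (i+1), p i, p (i+1), (h1 i hi.le).1, (h1 (i+1) hi).1, (h2 i hi).1, (h1 (i+1) hi).2.1,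
      (h2 i hi).2, (h1 i hi.le).2.2, (h1 (i+1) hi).2.2, hi2⟩
  · exfalso
    push Not at hex
    have h3 : ∀ i, i ≤ 4*K → (2^(ρ*j))^i * b 0 ≤ b i := by
      intro i
      induction i with
      | zero => intro _; simp
      | succ i ih =>
        intro hi
        have a1 := ih (by omega)
        have a2 := hex i (by omega)
        calc (2^(ρ*j))^(i+1) * b 0 = 2^(ρ*j) * ((2^(ρ*j))^i * b 0) := by rw [pow_succ]; ring
          _ ≤ 2^(ρ*j) * b i := Nat.mul_le_mul_left _ a1
          _ ≤ _ := a2.le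
    have h4 := h3 (4*K) le_rfl
    have h5 : b (4*K) ≤ (msum A 2).card := Finset.card_le_card (Finset.filter_subset _ _)
    have hP0 := bigP_A hA (h1 0 (by omega)).2.2
    have h6 := hG _ _ hP0 hP0 (2*j) 1 1 (by norm_num) (by norm_num)
    have e1 : bb A (bigP A (p 0)) (bigP A (p 0)) 1 1 = msum A 2 := by
      ext v
      rw [mem_bb]
      refine ⟨fun h => h.1, fun h => ⟨h, ?_, ?_⟩⟩ <;> linarith [(bigP A (p 0)).le_half v]
    have e2 : (1:ℝ)/2^(ρ*(2*j)) = s := by rw [hsdef]; congr 2; ring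
    rw [e1, e2] at h6
    have h7 : 0 < b 0 := Finset.card_pos.2 ⟨0, mem_bb.2 ⟨msum_zero_mem hA.h0 2, by rw [LN.zero']; exact hs0, by rw [LN.zero']; exact hs0⟩⟩
    have h8 : (2^(ρ*j))^(4*K) * b 0 ≤ K^(2*ρ*(2*j)) * b 0 := h4.trans (h5.trans h6)
    have h9 := Nat.le_of_mul_le_mul_right h8 h7
    have h10 : K^(2*ρ*(2*j)) < (2^(ρ*j))^(4*K) := by
      have : K^(2*ρ*(2*j)) = (K^4)^(ρ*j) := by rw [← pow_mul]; congr 1; ring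
      have e : (2^(ρ*j))^(4*K) = ((2^K)^4)^(ρ*j) := by rw [← pow_mul, ← pow_mul, ← pow_mul]; congr 1; ring
      rw [this, e]
      have hlt : K < 2^K := Nat.lt_two_pow_self
      have hne : ρ * j ≠ 0 := by positivity
      exact Nat.pow_lt_pow_left (Nat.pow_lt_pow_left hlt (by norm_num)) hne
    omega
end Select


section Gap
variable {R : Type u} [NonUnitalRing R]

set_option maxHeartbeats 1000000 in
lemma gap {A : Finset R} {K ρ j Wm w' w N' J0 : ℕ} {p' p : LN R} (hA : BA A) (S : Sel A ρ j Wm w' w p' p)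
    (hG : HG A K ρ) (hρ : 2 ≤ ρ) (hN : Cov N' (msum A (w'+2) : Set R) A) (s : ℝ) (hs : s = 1/2^(2*ρ*j))
    (hJ : J0 = N' * K^(2*ρ) * 2^(ρ*j)) (hJ1 : 1 ≤ J0)
    {y : R} (hy : y ∈ msum A w') (h1 : (bigP A p).f y ≤ s / J0) (h2 : (bigP A p').f y ≤ 1/(16*J0)) :
    (bigP A p').f y < 3 * s := by
  classical
  by_contra hcon
  push Not at hcon
  have hspos : 0 < s := by rw [hs]; positivity
  have hJr : (0:ℝ) < J0 := by exact_mod_cast hJ1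
  set P := bigP A p with hP
  set P' := bigP A p' with hP'
  set D := bb A P' P' s s with hD
  have hy16 : (J0:ℝ) * P'.f y ≤ 1/16 := by
    rw [le_div_iff₀ (by positivity)] at h2; linarith
  have hyJ : (J0:ℝ) * P.f y ≤ s := by
    rw [le_div_iff₀ (by positivity)] at h1; linarith
  have hly : ∀ l : ℕ, l ≤ J0 → l • y ∈ msum A w' := by
    intro l hl
    apply S.g'.nsmul hA.h0 hy
    have a1 : (l:ℝ) ≤ J0 := by exact_mod_cast hl
    have a2 := bigP_self A p' y
    have a3 := p'.nonneg y
    calc (l:ℝ) * p'.f y ≤ J0 * P'.f y := by gcongr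
      _ ≤ _ := hy16
  have h2A : msum A 2 ⊆ msum A w' := msum_mono hA.h0 S.g'.1
  let T : Finset R := (msum A (w'+2)).filter (fun v => P.f v ≤ 2 * s)
  have hT1 : T.card ≤ N' * (bb A P P (4*s) (4*s)).card := by
    refine cov_diff_count hA.hs _ hN T _ (Finset.filter_subset _ _) ?_
    intro x hx z hz hxz
    have a1 := (Finset.mem_filter.1 hx).2
    have a2 := (Finset.mem_filter.1 hz).2
    have a3 := P.sub_le x z
    exact mem_bb.2 ⟨hxz, by linarith, by linarith⟩
  have hPA := bigP_A hA S.e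
  have hT2 := hG P P hPA hPA 1 (4*s) (4*s) (by positivity) (by positivity)
  have hT3 : (bb A P P (4*s/2^(ρ*1)) (4*s/2^(ρ*1))).card ≤ (bb A P P s s).card := by
    have : 4*s/2^(ρ*1) ≤ s := by
      rw [div_le_iff₀ (by positivity), mul_one]
      have : (2:ℝ)^2 ≤ 2^ρ := pow_le_pow_right₀ (by norm_num) hρ
      nlinarith
    exact Finset.card_le_card (bb_mono this this)
  have hT4 : (bb A P P s s).card ≤ 2^(ρ*j) * D.card := by
    rw [hD, hs]; exact S.cnt
  have hT5 : T.card ≤ J0 * D.card := by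
    calc T.card ≤ N' * (bb A P P (4*s) (4*s)).card := hT1
      _ ≤ N' * (K^(2*ρ*1) * (2^(ρ*j) * D.card)) := by
        gcongr
        exact hT2.trans (Nat.mul_le_mul_left _ (hT3.trans hT4))
      _ = _ := by rw [hJ, mul_one]; ring
  have hT6 : (J0+1) * D.card ≤ T.card := by
    rw [← Finset.card_range (J0+1), ← Finset.card_product]
    refine Finset.card_le_card_of_injOn (fun c : ℕ × R => c.1 • y + c.2) ?_ ?_
    · rintro ⟨l, d⟩ hc
      rw [Finset.mem_coe, Finset.mem_product, Finset.mem_range, mem_bb] at hc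
      obtain ⟨c1, c2, c3, c4⟩ := hc
      simp only at c1 c2 c3
      refine Finset.mem_coe.2 (Finset.mem_filter.2 ⟨msum_add (hly l (by omega)) c2, ?_⟩)
      have b1 := P.add_le (l • y) d
      have b2 := P.nsmul_le l y
      have b3 : P.f d ≤ P'.f d := bigP_mono hA S.g' S.small (h2A c2)
      have b4 : (l:ℝ) * P.f y ≤ s := by
        have a1 : (l:ℝ) ≤ J0 := by exact_mod_cast (by omega : l ≤ J0)
        have := P.nonneg y
        exact (mul_le_mul_of_nonneg_right a1 this).trans hyJ
      simp only
      linarith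
    · have key : ∀ l l' : ℕ, ∀ d ∈ D, ∀ d' ∈ D, l < l' → l' ≤ J0 → l • y + d = l' • y + d' → False := by
        intro l l' d hd d' hd' hl hl' e
        rw [mem_bb] at hd hd'
        obtain ⟨m, rfl⟩ := Nat.exists_eq_add_of_lt hl
        have e2 : (m+1) • y = d - d' := by
          rw [add_assoc, add_nsmul, add_assoc] at e
          have := add_left_cancel e
          rw [this]; abel
        have b1 : ((m+1 : ℕ):ℝ) * P'.f y ≤ 1/2 := by
          have a1 : ((m+1:ℕ):ℝ) ≤ J0 := by exact_mod_cast (by omega : m+1 ≤ J0)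
          have := mul_le_mul_of_nonneg_right a1 (P'.nonneg y)
          linarith
        have b2 := P'.hom (m+1) y b1
        rw [e2] at b2
        have b3 := P'.sub_le d d'
        have b4 : P'.f y ≤ ((m+1 : ℕ):ℝ) * P'.f y := by
          apply le_mul_of_one_le_left (P'.nonneg y)
          push_cast; linarith [Nat.cast_nonneg (α := ℝ) m]
        linarith [hd.2.1, hd'.2.1]
      rintro ⟨l, d⟩ hc ⟨l', d'⟩ hc' e
      rw [Finset.mem_coe, Finset.mem_product, Finset.mem_range] at hc hc'
      simp only at e hc hc'
      rcases lt_trichotomy l l' with h | h | h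
      · exact (key l l' d hc.2 d' hc'.2 h (by omega) e).elim
      · subst h
        rw [add_left_cancel e]
      · exact (key l' l d' hc'.2 d hc.2 h (by omega) e.symm).elim
  have hDpos : 0 < D.card := Finset.card_pos.2 ⟨0, mem_bb.2 ⟨msum_zero_mem hA.h0 2, by rw [LN.zero']; exact hspos.le, by rw [LN.zero']; exact hspos.le⟩⟩
  have := hT6.trans hT5
  rw [add_mul] at this
  omega

/-- data after the gap has been established; `s, g, em` are the relevant scales -/
structure GapD (A : Finset R) (Wm w' w : ℕ) (p' p : LN R) (s g em : ℝ) : Prop where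
  g' : GoodW A w' p'
  gd : GoodW A w p
  ww : w' ≤ w
  wW : w ≤ Wm
  small : ∀ v ∈ msum A w', p.f v ≤ 1/200
  gap : ∀ y ∈ msum A w', (bigP A p).f y ≤ em → (bigP A p').f y ≤ g → (bigP A p').f y < 3 * s
  spos : 0 < s
  gs : 6 * s ≤ g
  gw : 3 * s * Wm ≤ g
  g16 : g ≤ 1/16
  em16 : em ≤ 1/16
  sW : 64 * Wm * s ≤ 1/32

open Classical in
/-- the approximate subgroups at scale `e` -/
noncomputable def UU (A : Finset R) (w' : ℕ) (p' p : LN R) (s e : ℝ) : Finset R :=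
  (msum A w').filter (fun y => (bigP A p).f y ≤ e ∧ (bigP A p').f y ≤ 3 * s)

variable {A : Finset R} {Wm w' w : ℕ} {p' p : LN R} {s g em : ℝ}

lemma mem_UU {e : ℝ} {y : R} : y ∈ UU A w' p' p s e ↔
    y ∈ msum A w' ∧ (bigP A p).f y ≤ e ∧ (bigP A p').f y ≤ 3 * s := by
  simp [UU]

lemma UU_mono {e e' : ℝ} (h : e ≤ e') : UU A w' p' p s e ⊆ UU A w' p' p s e' := by
  intro y hy
  rw [mem_UU] at hy ⊢
  exact ⟨hy.1, hy.2.1.trans h, hy.2.2⟩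

lemma UU_zero (hA : BA A) (hG : GapD A Wm w' w p' p s g em) {e : ℝ} (he : 0 ≤ e) : (0:R) ∈ UU A w' p' p s e := by
  rw [mem_UU, LN.zero', LN.zero']
  have := hG.spos
  exact ⟨msum_zero_mem hA.h0 _, he, by positivity⟩

lemma UU_neg (hA : BA A) {e : ℝ} {y : R} (hy : y ∈ UU A w' p' p s e) : -y ∈ UU A w' p' p s e := by
  rw [mem_UU] at hy ⊢
  rw [LN.neg, LN.neg]
  exact ⟨msum_neg hA.hs hy.1, hy.2⟩

lemma UU_add (hA : BA A) (hG : GapD A Wm w' w p' p s g em) {e e' : ℝ} {y y' : R} (hy : y ∈ UU A w' p' p s e)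
    (hy' : y' ∈ UU A w' p' p s e') (he : e + e' ≤ em) : y + y' ∈ UU A w' p' p s (e+e') := by
  rw [mem_UU] at hy hy' ⊢
  have h1 := (bigP A p).add_le y y'
  have h2 := (bigP A p').add_le y y'
  have h3 := bigP_self A p' (y+y')
  have h4 := hG.gs
  have h5 := hG.g16
  have h6 : y + y' ∈ msum A w' := hG.g'.add hA.h0 hy.1 hy'.1 (by linarith)
  refine ⟨h6, by linarith, (hG.gap _ h6 (by linarith) (by linarith)).le⟩

lemma UU_sub (hA : BA A) (hG : GapD A Wm w' w p' p s g em) {e e' : ℝ} {y y' : R} (hy : y ∈ UU A w' p' p s e)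
    (hy' : y' ∈ UU A w' p' p s e') (he : e + e' ≤ em) : y - y' ∈ UU A w' p' p s (e+e') := by
  rw [sub_eq_add_neg]
  exact UU_add hA hG hy (UU_neg hA hy') he

lemma norm_mul_left_le (q : LN R) (y : R) (c : ℝ) (n : ℕ) (h : ∀ a ∈ A, q.f (y * a) ≤ c) :
    ∀ v ∈ msum A n, q.f (y * v) ≤ n * c := by
  have := msum_norm_le (A := A) (q.comp (AddMonoidHom.mulLeft y)) c (fun a ha => h a ha) n
  intro v hv
  exact this v hv

lemma norm_mul_right_le (q : LN R) (y : R) (c : ℝ) (n : ℕ) (h : ∀ a ∈ A, q.f (a * y) ≤ c) :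
    ∀ v ∈ msum A n, q.f (v * y) ≤ n * c := by
  have := msum_norm_le (A := A) (q.comp (AddMonoidHom.mulRight y)) c (fun a ha => h a ha) n
  intro v hv
  exact this v hv

lemma UU_contr1 (hA : BA A) (hG : GapD A Wm w' w p' p s g em) {e : ℝ} {y : R} (hy : y ∈ UU A w' p' p s e) :
    ∀ a ∈ A, p.f (y * a) ≤ s ∧ p.f (a * y) ≤ s := by
  intro a ha
  rw [mem_UU] at hy
  have h1 := hG.spos
  have h2 := hG.gs
  have h3 := hG.g16
  have h4 := bigP_self A p' y
  have hl : ∀ l : ℕ, l * (3*s) ≤ 1/16 → l • y ∈ msum A w' := by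
    intro l hl
    refine hG.g'.nsmul hA.h0 hy.1 l ?_
    have : p'.f y ≤ 3 * s := h4.trans hy.2.2
    exact (mul_le_mul_of_nonneg_left this (Nat.cast_nonneg l)).trans hl
  constructor
  · have := trap_le p (y*a) (3*s) (1/200) (by positivity) (by linarith) (by norm_num) (by norm_num) (fun l h => by
      rw [← smul_mul_assoc]
      exact hG.small _ (hA.mulr (hl l h) ha))
    linarith
  · have := trap_le p (a*y) (3*s) (1/200) (by positivity) (by linarith) (by norm_num) (by norm_num) (fun l h => by
      rw [← mul_smul_comm]
      exact hG.small _ (hA.mull (hl l h) ha))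
    linarith

lemma UU_contr (hA : BA A) (hG : GapD A Wm w' w p' p s g em) {e : ℝ} {y : R} (hy : y ∈ UU A w' p' p s e)
    {v : R} (hv : v ∈ msum A w) (hpv : p.f v ≤ 1/16) :
    (y * v ∈ msum A w ∧ p.f (y * v) ≤ 32 * (Wm * s) * p.f v) ∧
    (v * y ∈ msum A w ∧ p.f (v * y) ≤ 32 * (Wm * s) * p.f v) := by
  have h1 := hG.spos
  have hw : (w:ℝ) ≤ Wm := by exact_mod_cast hG.wW
  have hW0 : (0:ℝ) ≤ Wm := Nat.cast_nonneg _
  have hc := UU_contr1 hA hG hy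
  have hsW := hG.sW
  have hl1 : ∀ v ∈ msum A w, p.f (y * v) ≤ Wm * s := fun v hv =>
    (norm_mul_left_le p y s w (fun a ha => (hc a ha).1) v hv).trans (mul_le_mul_of_nonneg_right hw h1.le)
  have hl2 : ∀ v ∈ msum A w, p.f (v * y) ≤ Wm * s := fun v hv =>
    (norm_mul_right_le p y s w (fun a ha => (hc a ha).2) v hv).trans (mul_le_mul_of_nonneg_right hw h1.le)
  rw [mem_UU] at hy
  have hww : w' * w ≤ w^2 := by rw [sq]; exact Nat.mul_le_mul_right _ hG.ww
  refine ⟨⟨?_, ?_⟩, ?_, ?_⟩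
  · refine hG.gd.mem hA.h0 (msum_mul hA.hm hy.1 hv) hww ?_
    linarith [hl1 v hv]
  · refine trap_le p (y*v) (p.f v) (Wm*s) (p.nonneg v) hpv (by positivity) (by linarith) (fun l h => ?_)
    rw [← mul_smul_comm]
    exact hl1 _ (hG.gd.nsmul hA.h0 hv l h)
  · refine hG.gd.mem hA.h0 (msum_mul hA.hm hv hy.1) (by rw [mul_comm]; exact hww) ?_
    linarith [hl2 v hv]
  · refine trap_le p (v*y) (p.f v) (Wm*s) (p.nonneg v) hpv (by positivity) (by linarith) (fun l h => ?_)
    rw [← smul_mul_assoc]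
    exact hl2 _ (hG.gd.nsmul hA.h0 hv l h)

lemma UU_mul (hA : BA A) (hG : GapD A Wm w' w p' p s g em) {e : ℝ} (he : e ≤ em) {y y' : R} (hy : y ∈ UU A w' p' p s e)
    (hy' : y' ∈ UU A w' p' p s e) : y * y' ∈ UU A w' p' p s (e/2) := by
  have h1 := hG.spos
  have hW0 : (0:ℝ) ≤ Wm := Nat.cast_nonneg _
  have hsW := hG.sW
  have hw : (w':ℝ) ≤ Wm := by exact_mod_cast hG.ww.trans hG.wW
  have h16 := hG.em16
  have m := mem_UU.1 hy
  have m' := mem_UU.1 hy'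
  have sub : msum A w' ⊆ msum A w := msum_mono hA.h0 hG.ww
  have c1 : ∀ v ∈ msum A w', p.f v ≤ e → p.f (y * v) ≤ e / 2 := by
    intro v hv hp
    have := ((UU_contr hA hG hy (sub hv) (by linarith)).1).2
    have hn := p.nonneg v
    nlinarith
  have c2 : ∀ v ∈ msum A w', p.f v ≤ e → p.f (v * y') ≤ e / 2 := by
    intro v hv hp
    have := ((UU_contr hA hG hy' (sub hv) (by linarith)).2).2
    have hn := p.nonneg v
    nlinarith
  have hP : (bigP A p).f (y * y') ≤ e / 2 := by
    refine bigP_le A p _ _ ?_ ?_ ?_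
    · exact c1 y' m'.1 ((bigP_self A p y').trans m'.2.1)
    · intro a ha
      rw [mul_assoc]
      exact c1 _ (hA.mulr m'.1 ha) ((bigP_right A p y' ha).trans m'.2.1)
    · intro a ha
      rw [← mul_assoc]
      exact c2 _ (hA.mull m.1 ha) ((bigP_left A p y ha).trans m.2.1)
  have d1 : ∀ v ∈ msum A w', p'.f (y * v) ≤ g := by
    intro v hv
    have := norm_mul_left_le p' y (3*s) w' (fun a ha => (bigP_right A p' y ha).trans m.2.2) v hv
    have := hG.gw
    nlinarith
  have d2 : ∀ v ∈ msum A w', p'.f (v * y') ≤ g := by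
    intro v hv
    have := norm_mul_right_le p' y' (3*s) w' (fun a ha => (bigP_left A p' y' ha).trans m'.2.2) v hv
    have := hG.gw
    nlinarith
  have hP' : (bigP A p').f (y * y') ≤ g := by
    refine bigP_le A p' _ _ (d1 _ m'.1) ?_ ?_
    · intro a ha
      rw [mul_assoc]
      exact d1 _ (hA.mulr m'.1 ha)
    · intro a ha
      rw [← mul_assoc]
      exact d2 _ (hA.mull m.1 ha)
  have hmem : y * y' ∈ msum A w' :=
    hG.g'.mem hA.h0 (msum_mul hA.hm m.1 m'.1) (by rw [sq]) ((bigP_self A p' _).trans (hP'.trans hG.g16))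
  have e0 : 0 ≤ e := ((bigP A p).nonneg y).trans m.2.1
  exact mem_UU.2 ⟨hmem, hP, (hG.gap _ hmem (by linarith) hP').le⟩
end Gap


section Pigeon
variable {R : Type u} [NonUnitalRing R]
variable {A : Finset R} {K ρ N' Wm w' w : ℕ} {p' p : LN R} {s g em : ℝ}

lemma bb_growth (hA : BA A) (hG : GapD A Wm w' w p' p s g em) (hH : HG A K ρ)
    (he' : ∀ a ∈ A, p'.f a ≤ (1/2)^(ρ+6)) (he : ∀ a ∈ A, p.f a ≤ (1/2)^(ρ+6)) (k : ℕ) (e : ℝ) (h0 : 0 ≤ e) (hem : e ≤ em) :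
    (bb A (bigP A p) (bigP A p') e (3*s)).card ≤ K^(2*ρ*k) * (bb A (bigP A p) (bigP A p') (e/2^(ρ*k)) (3*s)).card := by
  have hs := hG.spos
  have hgs := hG.gs
  have h1 := hH _ _ (bigP_A hA he) (bigP_A hA he') k e g h0 (by linarith)
  refine (Finset.card_le_card (bb_mono le_rfl (by linarith))).trans (h1.trans (Nat.mul_le_mul_left _ ?_))
  apply Finset.card_le_card
  intro v hv
  rw [mem_bb] at hv ⊢
  have hp : (1:ℝ) ≤ 2^(ρ*k) := one_le_pow₀ (by norm_num)
  have a1 : e/2^(ρ*k) ≤ e := div_le_self h0 hp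
  have a2 : g/2^(ρ*k) ≤ g := div_le_self (by linarith) hp
  exact ⟨hv.1, hv.2.1, (hG.gap v (msum_mono hA.h0 hG.g'.1 hv.1) (by linarith) (by linarith)).le⟩

lemma bb_sub_UU (hA : BA A) (hG : GapD A Wm w' w p' p s g em) (e : ℝ) :
    bb A (bigP A p) (bigP A p') e (3*s) ⊆ UU A w' p' p s e := by
  intro v hv
  rw [mem_bb] at hv
  exact mem_UU.2 ⟨msum_mono hA.h0 hG.g'.1 hv.1, hv.2⟩

lemma UU_count (hA : BA A) (hG : GapD A Wm w' w p' p s g em) (hN : Cov N' (msum A w' : Set R) A)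
    (e : ℝ) (hem : 2 * e ≤ em) :
    (UU A w' p' p s e).card ≤ N' * (bb A (bigP A p) (bigP A p') (2*e) (3*s)).card := by
  refine cov_diff_count hA.hs _ hN _ _ (Finset.filter_subset _ _) ?_
  intro x hx y hy hxy
  have h := mem_UU.1 (UU_sub hA hG hx hy (by linarith))
  exact mem_bb.2 ⟨hxy, by linarith [h.2.1], h.2.2⟩

lemma pigeon_x (hA : BA A) (hG : GapD A Wm w' w p' p s g em) (hH : HG A K ρ) (hK : 2 ≤ K) (hρ : 1 ≤ ρ)
    (he' : ∀ a ∈ A, p'.f a ≤ (1/2)^(ρ+6)) (he : ∀ a ∈ A, p.f a ≤ (1/2)^(ρ+6))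
    (hN : Cov N' (msum A w' : Set R) A) (x0 : ℝ) (hx0 : 0 < x0) (hem : 2 * x0 ≤ em) :
    ∃ x : ℝ, x0 / 8^(ρ*(N'+1)) ≤ x ∧ x ≤ x0 / 8 ∧
      (UU A w' p' p s (6*x)).card ≤ K^10 * (UU A w' p' p s x).card := by
  by_contra hcon
  push Not at hcon
  obtain ⟨n, hn⟩ : ∃ n, n = ρ*(N'+1) := ⟨_, rfl⟩
  rw [← hn] at hcon
  have h1 : ∀ k, k ≤ n → K^(10*k) * (UU A w' p' p s (x0/8^k)).card ≤ (UU A w' p' p s x0).card := by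
    intro k
    induction k with
    | zero => intro _; simp
    | succ k ih =>
      intro hk
      have a1 := ih (by omega)
      have a2 := hcon (x0/8^(k+1)) (by gcongr; norm_num) (by
        rw [pow_succ]
        have : x0 / (8^k*8) = x0/8/8^k := by rw [div_div]; congr 1; ring
        rw [this]
        exact div_le_self (by positivity) (one_le_pow₀ (by norm_num)))
      have a3 : (UU A w' p' p s (6 * (x0/8^(k+1)))).card ≤ (UU A w' p' p s (x0/8^k)).card := by
        apply Finset.card_le_card
        apply UU_mono
        rw [pow_succ, ← mul_div_assoc, div_le_div_iff₀ (by positivity) (by positivity)]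
        have : (0:ℝ) < x0 * 8^k := by positivity
        nlinarith
      calc K^(10*(k+1)) * (UU A w' p' p s (x0/8^(k+1))).card = K^(10*k) * (K^10 * (UU A w' p' p s (x0/8^(k+1))).card) := by
            rw [← mul_assoc, ← pow_add]; rfl
        _ ≤ K^(10*k) * (UU A w' p' p s (x0/8^k)).card := Nat.mul_le_mul_left _ (a2.le.trans a3)
        _ ≤ _ := a1
  have h2 := h1 n le_rfl
  have h3 := UU_count hA hG hN x0 hem
  have h4 := bb_growth hA hG hH he' he (3*(N'+1)+1) (2*x0) (by positivity) hem
  have h5 : (bb A (bigP A p) (bigP A p') (2*x0/2^(ρ*(3*(N'+1)+1))) (3*s)).card ≤ (UU A w' p' p s (x0/8^n)).card := by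
    refine Finset.card_le_card ((bb_sub_UU hA hG _).trans (UU_mono ?_))
    have e8 : (8:ℝ)^n = 2^(3*n) := by rw [pow_mul]; norm_num
    rw [e8, div_le_div_iff₀ (by positivity) (by positivity)]
    have : (2:ℝ)^(3*n+1) ≤ 2^(ρ*(3*(N'+1)+1)) := by
      apply pow_le_pow_right₀ (by norm_num)
      rw [hn]
      nlinarith
    rw [pow_succ] at this
    nlinarith
  have hpos : 0 < (UU A w' p' p s (x0/8^n)).card := Finset.card_pos.2 ⟨0, UU_zero hA hG (by positivity)⟩
  have h6 : K^(10*n) * (UU A w' p' p s (x0/8^n)).card ≤ N' * K^(2*ρ*(3*(N'+1)+1)) * (UU A w' p' p s (x0/8^n)).card := by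
    refine h2.trans (h3.trans ?_)
    rw [mul_assoc]
    exact Nat.mul_le_mul_left _ (h4.trans (Nat.mul_le_mul_left _ h5))
  have h7 := Nat.le_of_mul_le_mul_right h6 hpos
  have h8 : 10*n = 2*ρ*(3*(N'+1)+1) + ρ*(4*N'+2) := by rw [hn]; ring
  rw [h8, pow_add, mul_comm N'] at h7
  have h9 := Nat.le_of_mul_le_mul_left h7 (by positivity)
  have h10 : N' < K^(ρ*(4*N'+2)) := by
    calc N' < 2^N' := Nat.lt_two_pow_self
      _ ≤ K^N' := Nat.pow_le_pow_left hK _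
      _ ≤ _ := Nat.pow_le_pow_right (by omega) (by nlinarith)
  omega

/-- covering a subset of `f + X` lying in a set with small difference set -/
lemma cov_piece {T Y U1 U2 : Finset R} {m : ℕ} (hU : U1.Nonempty) (hadd : ∀ t ∈ T, ∀ u ∈ U1, t + u ∈ U2)
    (hc : U2.card ≤ m * U1.card) (hY : ∀ t ∈ T, ∀ t' ∈ T, ∀ a ∈ U1, ∀ b ∈ U1, t - t' = a - b → t - t' ∈ Y) :
    Cov m (T : Set R) Y := by
  classical
  obtain ⟨E, hE1, hE2, hE3⟩ := ruzsaR T U1 hU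
  refine ⟨E, ?_, ?_⟩
  · have : (T + U1).card ≤ U2.card := by
      apply Finset.card_le_card
      intro z hz
      obtain ⟨t, ht, u, hu, rfl⟩ := Finset.mem_add.1 hz
      exact hadd t ht u hu
    exact Nat.le_of_mul_le_mul_right (hE2.trans (this.trans hc)) (Finset.card_pos.2 hU)
  · intro t ht
    obtain ⟨e, he, a, ha, b, hb, h⟩ := hE3 t ht
    exact ⟨e, he, t - e, hY t ht e (hE1 he) a ha b hb (by rw [h]; abel), by simp⟩

end Pigeon


section YY
variable {R : Type u} [NonUnitalRing R]
variable {A X : Finset R} {K ρ N' Wm w' w : ℕ} {p' p : LN R} {s g em x : ℝ}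

open Classical in
/-- the approximate subring we construct -/
noncomputable def YY (X : Finset R) (A : Finset R) (w' : ℕ) (p' p : LN R) (s e : ℝ) : Finset R :=
  (X + X).filter (fun y => y ∈ UU A w' p' p s e)

lemma mem_YY {e : ℝ} {y : R} : y ∈ YY X A w' p' p s e ↔ (∃ a ∈ X, ∃ b ∈ X, a + b = y) ∧ y ∈ UU A w' p' p s e := by
  simp [YY, Finset.mem_add]

lemma cov_one {T Y : Set R} (h : ∀ t ∈ T, ∀ t' ∈ T, t - t' ∈ Y) : Cov 1 T Y := by
  rcases T.eq_empty_or_nonempty with rfl | ⟨t0, h0⟩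
  · exact ⟨∅, by simp, by simp⟩
  · refine ⟨{t0}, by simp, fun t ht => ⟨t0, by simp, t - t0, h t ht t0 h0, by simp⟩⟩

lemma cov_pieces {S T X Y : Set R} {N M : ℕ} (hS : Cov N S X) (hT : T ⊆ S)
    (h : ∀ f, Cov M {t | t ∈ T ∧ t - f ∈ X} Y) : Cov (N*M) T Y := by
  obtain ⟨F, hF, hF2⟩ := hS
  refine Cov.biUnion F hF (fun f => {t | t ∈ T ∧ t - f ∈ X}) (fun f _ => h f) ?_
  intro t ht
  obtain ⟨f, hf, a, ha, e⟩ := hF2 (hT ht)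
  simp only at e
  refine ⟨f, hf, ht, ?_⟩
  rw [← e]; simpa using ha

lemma YY_symm (hX : AddSymm (X : Set R)) (hA : BA A) (hG : GapD A Wm w' w p' p s g em) {e : ℝ} (he : 0 ≤ e) :
    AddSymm (YY X A w' p' p s e : Set R) := by
  apply AddSymm.mk'
  · exact mem_YY.2 ⟨⟨0, hX.1, 0, hX.1, add_zero _⟩, UU_zero hA hG he⟩
  · intro y hy
    obtain ⟨⟨a, ha, b, hb, rfl⟩, h2⟩ := mem_YY.1 hy
    exact mem_YY.2 ⟨⟨-a, hX.neg_mem ha, -b, hX.neg_mem hb, by abel⟩, UU_neg hA h2⟩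

lemma diff_YY (hX : AddSymm (X : Set R)) {e : ℝ} {f t t' : R} (h : t - f ∈ X) (h' : t' - f ∈ X)
    (hU : t - t' ∈ UU A w' p' p s e) : t - t' ∈ YY X A w' p' p s e :=
  mem_YY.2 ⟨⟨t - f, h, -(t' - f), hX.neg_mem h', by abel⟩, hU⟩

lemma YY_approx (hX : IsApproxSubringWith K (X : Set R)) (hA : BA A) (hG : GapD A Wm w' w p' p s g em)
    (hx : 0 < x) (hem : 6 * x ≤ em) (hc : (UU A w' p' p s (6*x)).card ≤ K^10 * (UU A w' p' p s x).card) :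
    IsApproxSubringWith (K^13 + K^7) (YY X A w' p' p s (2*x) : Set R) := by
  classical
  obtain ⟨hm, ha⟩ := approx_cov hX
  have hXs := hX.1
  set Y := YY X A w' p' p s (2*x) with hY
  have c1 : Cov (K^3*K^10) ((Y:Set R)+(Y:Set R)) Y := by
    refine cov_pieces ((ha.add_same ha ha).mono (le_of_eq (by ring)) subset_rfl) ?_ ?_
    · rintro _ ⟨y, hy, y', hy', rfl⟩
      obtain ⟨⟨a, ha, b, hb, rfl⟩, -⟩ := mem_YY.1 hy
      obtain ⟨⟨a', ha', b', hb', rfl⟩, -⟩ := mem_YY.1 hy'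
      exact ⟨_, ⟨a, ha, b, hb, rfl⟩, _, ⟨a', ha', b', hb', rfl⟩, rfl⟩
    · intro f
      have : ({t | t ∈ (Y:Set R)+(Y:Set R) ∧ t - f ∈ (X:Set R)} : Set R) = ((Y+Y).filter (fun t => t - f ∈ X) : Finset R) := by
        ext t
        simp [Finset.mem_add, Set.mem_add]
      rw [this]
      refine cov_piece (U1 := UU A w' p' p s x) (U2 := UU A w' p' p s (6*x)) ⟨0, UU_zero hA hG hx.le⟩ ?_ hc ?_
      · intro t ht u hu
        obtain ⟨y, hy, y', hy', rfl⟩ := Finset.mem_add.1 (Finset.mem_filter.1 ht).1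
        have h1 := UU_add hA hG (mem_YY.1 hy).2 (mem_YY.1 hy').2 (by linarith)
        have h2 := UU_add hA hG h1 hu (by linarith)
        exact UU_mono (by linarith) h2
      · intro t ht t' ht' a ha b hb e
        refine diff_YY hXs (Finset.mem_filter.1 ht).2 (Finset.mem_filter.1 ht').2 ?_
        rw [e]
        have := UU_sub hA hG ha hb (by linarith)
        exact UU_mono (by linarith) this
  have c2 : Cov (K^7*1) ((Y:Set R)*(Y:Set R)) Y := by
    have h4 := (hm.add_same hm ha).add_same (hm.add_same hm ha) ha
    refine cov_pieces (h4.mono (le_of_eq (by ring)) subset_rfl) ?_ ?_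
    · rintro _ ⟨y, hy, y', hy', rfl⟩
      obtain ⟨⟨a, ha, b, hb, rfl⟩, -⟩ := mem_YY.1 hy
      obtain ⟨⟨a', ha', b', hb', rfl⟩, -⟩ := mem_YY.1 hy'
      refine ⟨a * a' + a * b', ⟨_, ⟨a, ha, a', ha', rfl⟩, _, ⟨a, ha, b', hb', rfl⟩, rfl⟩,
        b * a' + b * b', ⟨_, ⟨b, hb, a', ha', rfl⟩, _, ⟨b, hb, b', hb', rfl⟩, rfl⟩, ?_⟩
      simp only [add_mul, mul_add]; abel
    · intro f
      apply cov_one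
      rintro t ⟨⟨y, hy, z, hz, e⟩, ht⟩ t' ⟨⟨y', hy', z', hz', e'⟩, ht'⟩
      simp only at e e'
      refine diff_YY hXs ht ht' ?_
      have h1 := UU_mul hA hG (by linarith) (mem_YY.1 hy).2 (mem_YY.1 hz).2
      have h2 := UU_mul hA hG (by linarith) (mem_YY.1 hy').2 (mem_YY.1 hz').2
      rw [e] at h1
      rw [e'] at h2
      exact UU_mono (by linarith) (UU_sub hA hG h1 h2 (by linarith))
  refine ⟨YY_symm hXs hA hG (by positivity), ?_⟩
  obtain ⟨F1, f1, g1⟩ := c1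
  obtain ⟨F2, f2, g2⟩ := c2
  refine ⟨F1 ∪ F2, (Finset.card_union_le _ _).trans ?_, ?_⟩
  · have e13 : K^3*K^10 = K^13 := by ring
    rw [e13] at f1; rw [mul_one] at f2; exact Nat.add_le_add f1 f2
  · rw [Finset.coe_union, Set.union_add]
    exact Set.union_subset (g2.trans Set.subset_union_right) (g1.trans Set.subset_union_left)

lemma YY_comm {NA CA h : ℕ} (hX : IsApproxSubringWith K (X : Set R)) (hA : BA A) (hG : GapD A Wm w' w p' p s g em)
    (hH : HG A K ρ) (he' : ∀ a ∈ A, p'.f a ≤ (1/2)^(ρ+6)) (he : ∀ a ∈ A, p.f a ≤ (1/2)^(ρ+6))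
    (hXA : Cov NA (X : Set R) A)
    (hCA : ∀ D : Finset R, (∀ d ∈ D, ∃ x ∈ X, ∃ a ∈ msum A 2, d = x + a) → D.card ≤ CA * X.card)
    (hx : 0 < x) (hem : 6 * x ≤ em) (hh1 : 1/2^(ρ*h) ≤ x) (hh2 : 1/2^(ρ*h) ≤ 3*s) :
    Cov K (YY X A w' p' p s (2*x) : Set R) X ∧
    Cov (CA * NA * K^(2*ρ*h)) (X : Set R) (YY X A w' p' p s (2*x)) := by
  classical
  obtain ⟨-, ha⟩ := approx_cov hX
  constructor
  · refine ha.mono le_rfl ?_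
    intro y hy
    obtain ⟨⟨a, ha, b, hb, rfl⟩, -⟩ := mem_YY.1 hy
    exact ⟨a, ha, b, hb, rfl⟩
  · have hs := hG.spos
    refine cov_piece (U1 := bb A (bigP A p) (bigP A p') x (3*s)) (U2 := X + msum A 2)
      ⟨0, mem_bb.2 ⟨msum_zero_mem hA.h0 2, by rw [LN.zero']; exact hx.le, by rw [LN.zero']; positivity⟩⟩ ?_ ?_ ?_
    · intro t ht u hu
      exact Finset.add_mem_add ht (mem_bb.1 hu).1
    · have a1 := hCA (X + msum A 2) (by
        intro d hd
        obtain ⟨x, hx, a, ha, rfl⟩ := Finset.mem_add.1 hd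
        exact ⟨x, hx, a, ha, rfl⟩)
      have a2 := hXA.card
      have a3 : A.card ≤ (msum A 2).card := by
        apply Finset.card_le_card
        intro v hv
        exact msum_mono hA.h0 (by norm_num) (mem_msum_one.2 hv)
      have a4 := hH _ _ (bigP_A hA he) (bigP_A hA he') h 1 1 (by norm_num) (by norm_num)
      have e1 : bb A (bigP A p) (bigP A p') 1 1 = msum A 2 := by
        ext v
        rw [mem_bb]
        refine ⟨fun h => h.1, fun h => ⟨h, ?_, ?_⟩⟩
        · linarith [(bigP A p).le_half v]
        · linarith [(bigP A p').le_half v]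
      rw [e1] at a4
      have a5 := Finset.card_le_card (bb_mono (A := A) (p := bigP A p) (q := bigP A p') hh1 hh2)
      calc _ ≤ _ := a1
        _ ≤ CA * (NA * (K^(2*ρ*h) * (bb A (bigP A p) (bigP A p') x (3*s)).card)) := by
          gcongr
          refine a2.trans (Nat.mul_le_mul_left _ (a3.trans (a4.trans (Nat.mul_le_mul_left _ a5))))
        _ = _ := by ring
    · intro t ht t' ht' a ha b hb e
      refine diff_YY (f := 0) hX.1 (by simpa using ht) (by simpa using ht') ?_
      rw [e]
      have := UU_sub hA hG (bb_sub_UU hA hG _ ha) (bb_sub_UU hA hG _ hb) (by linarith)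
      exact UU_mono (by linarith) this
end YY


section Nil
variable {G : Type u} [AddCommGroup G]

lemma nil_core {A : Finset G} (h0 : (0:G) ∈ A) (hs : ∀ v ∈ A, -v ∈ A) {w : ℕ} {p : LN G} (h : GoodW A w p)
    {M : ℕ} (hM : 1 ≤ M) (u : Fin M → G) (hu : ∀ i, u i ∈ msum A w) {τ : ℝ}
    (ht0 : ∀ i, 0 < p.f (u i)) (htτ : ∀ i, p.f (u i) ≤ τ)
    (hB : ∀ i j, i < j → 32 * M * p.f (u i) ≤ p.f (u j))
    (W : Fin M → AddSubgroup G) (hW : ∀ j k, j < k → u j ∈ W k) (hW' : ∀ k, u k ∉ W k)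
    (hmin : ∀ k, ∀ v ∈ msum A w, p.f v ≤ τ → p.f v < p.f (u k) → v ∈ W k)
    (d : Fin M → ℤ) (hd : ∀ j, |(d j : ℝ)| * p.f (u j) ≤ 1 / (64 * M))
    (hd' : ∀ j, d j ≠ 0 → 64 * τ ≤ |(d j:ℝ)| * p.f (u j))
    (hsum : p.f (∑ j, d j • u j) ≤ 2 * τ) (k : Fin M) (hk : 0 < d k) (hkj : ∀ j, k < j → d j = 0) : False := by
  have hM' : (1:ℝ) ≤ M := by exact_mod_cast hM
  obtain ⟨a, ha⟩ : ∃ a : ℕ, (a:ℤ) = d k := ⟨(d k).toNat, Int.toNat_of_nonneg hk.le⟩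
  have ha0 : 0 < a := by omega
  have har : (1:ℝ) ≤ a := by exact_mod_cast ha0
  have hdk : |(d k:ℝ)| = a := by rw [← ha]; simp
  have hatk : (a:ℝ) * p.f (u k) ≤ 1/(64*M) := by rw [← hdk]; exact hd k
  have hatk2 : 64 * τ ≤ (a:ℝ) * p.f (u k) := by rw [← hdk]; exact hd' k hk.ne'
  let c : Fin M → ℤ := fun j => if j < k then d j / a else if j = k then 1 else 0
  let r : Fin M → ℤ := fun j => if j < k then d j % a else 0
  have hdcr : ∀ j, d j = a * c j + r j := by
    intro j
    rcases lt_trichotomy j k with hj | hj | hj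
    · simp only [c, r, hj, if_true]; exact (Int.mul_ediv_add_emod _ _).symm
    · subst hj; simp [c, r, ha]
    · simp only [c, r, not_lt.2 hj.le, hj.ne', if_false]; rw [hkj j hj]; simp
  have hr : ∀ j, 0 ≤ r j ∧ r j < a := by
    intro j
    by_cases hj : j < k
    · simp only [r, hj, if_true]
      exact ⟨Int.emod_nonneg _ (by omega), Int.emod_lt_of_pos _ (by omega)⟩
    · simp only [r, hj, if_false]; omega
  have tk0 := ht0 k
  have hrt : ∀ j, |(r j:ℝ)| * p.f (u j) ≤ a * p.f (u k) / (32 * M) := by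
    intro j
    by_cases hj : j < k
    · have h1 := hB j k hj
      have h2 : |(r j:ℝ)| ≤ a := by
        rw [abs_of_nonneg (by exact_mod_cast (hr j).1)]
        exact_mod_cast (hr j).2.le
      rw [le_div_iff₀ (by positivity)]
      have := ht0 j
      calc |(r j:ℝ)| * p.f (u j) * (32*M) ≤ a * p.f (u j) * (32 * M) := by gcongr
        _ = a * (32 * M * p.f (u j)) := by ring
        _ ≤ _ := by gcongr
    · have : r j = 0 := by simp [r, hj]
      rw [this]; simp; positivity
  have hct : ∀ j, (a:ℝ) * (|(c j:ℝ)| * p.f (u j)) ≤ 1 / (32 * M) := by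
    intro j
    have h32 : (1:ℝ)/(32*M) = 1/(64*M) + 1/(64*M) := by field_simp; norm_num
    rcases lt_trichotomy j k with hj | hj | hj
    · have e : (a:ℝ) * c j = d j - r j := by
        have := hdcr j
        have h2 : ((d j:ℤ):ℝ) = a * c j + r j := by exact_mod_cast this
        linarith
      have e2 : (a:ℝ) * |(c j:ℝ)| ≤ |(d j:ℝ)| + |(r j:ℝ)| := by
        have : (a:ℝ) * |(c j:ℝ)| = |(a:ℝ) * c j| := by rw [abs_mul]; simp
        rw [this, e]
        exact abs_sub _ _
      have h1 := hd j
      have h2 := hrt j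
      have h3 : a * p.f (u k) / (32 * M) ≤ 1/(64*M) := by
        have : a * p.f (u k) / (32 * M) ≤ a * p.f (u k) := div_le_self (by positivity) (by linarith)
        linarith
      have := ht0 j
      calc (a:ℝ) * (|(c j:ℝ)| * p.f (u j)) = (a:ℝ) * |(c j:ℝ)| * p.f (u j) := by ring
        _ ≤ (|(d j:ℝ)| + |(r j:ℝ)|) * p.f (u j) := by gcongr
        _ = |(d j:ℝ)| * p.f (u j) + |(r j:ℝ)| * p.f (u j) := by ring
        _ ≤ _ := by rw [h32]; linarith
    · have : c j = 1 := by simp [c, hj]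
      rw [this, hj]; simp only [Int.cast_one, abs_one, one_mul]
      rw [h32]
      have : (0:ℝ) ≤ 1/(64*M) := by positivity
      linarith
    · have : c j = 0 := by simp [c, not_lt.2 hj.le, hj.ne']
      rw [this]; simp
  have hcsum : (a:ℝ) * ∑ j, |(c j:ℝ)| * p.f (u j) ≤ 1/32 := by
    rw [Finset.mul_sum]
    calc _ ≤ ∑ j : Fin M, (1:ℝ)/(32*M) := Finset.sum_le_sum fun j _ => hct j
      _ = 1/32 := by simp; field_simp
  have hcs0 : 0 ≤ ∑ j, |(c j:ℝ)| * p.f (u j) := Finset.sum_nonneg fun i _ => mul_nonneg (abs_nonneg _) (p.nonneg _)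
  have hcsum1 : ∑ j, |(c j:ℝ)| * p.f (u j) ≤ 1/32 := by nlinarith
  obtain ⟨v, hv⟩ : ∃ v, v = ∑ j, c j • u j := ⟨_, rfl⟩
  have hvV : v ∈ msum A w := by
    rw [hv]; exact h.sum h0 hs _ _ _ (fun i _ => hu i) (by linarith)
  have hpv : p.f v ≤ ∑ j, |(c j:ℝ)| * p.f (u j) := by
    rw [hv]; exact (p.sum_le _ _).trans (Finset.sum_le_sum fun i _ => p.zsmul_le _ _)
  have hom := p.hom a v (by
    have : (a:ℝ) * p.f v ≤ a * ∑ j, |(c j:ℝ)| * p.f (u j) := by gcongr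
    linarith)
  have hav : a • v = (∑ j, d j • u j) - ∑ j, r j • u j := by
    rw [hv, Finset.smul_sum, ← Finset.sum_sub_distrib]
    refine Finset.sum_congr rfl fun j _ => ?_
    rw [← sub_smul, ← natCast_zsmul, ← mul_smul]
    congr 1
    have := hdcr j
    linarith
  have h3 : p.f (a • v) ≤ 2 * τ + a * p.f (u k) / 32 := by
    rw [hav]
    refine (p.sub_le _ _).trans (add_le_add hsum ?_)
    calc _ ≤ ∑ j, |(r j:ℝ)| * p.f (u j) := (p.sum_le _ _).trans (Finset.sum_le_sum fun i _ => p.zsmul_le _ _)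
      _ ≤ ∑ j : Fin M, a * p.f (u k) / (32 * M) := Finset.sum_le_sum fun j _ => hrt j
      _ = _ := by simp; field_simp
  have h4 : p.f v < p.f (u k) := by
    rw [hom] at h3
    have : 0 < (a:ℝ) * p.f (u k) := by positivity
    have : (a:ℝ) * p.f v < a * p.f (u k) := by linarith
    exact lt_of_mul_lt_mul_left this (by linarith)
  have h5 := hmin k v hvV (h4.le.trans (htτ k)) h4
  apply hW' k
  rw [hv, ← Finset.add_sum_erase _ _ (Finset.mem_univ k)] at h5
  have hck : c k = 1 := by simp [c]
  rw [hck, one_smul] at h5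
  refine (AddSubgroup.add_mem_cancel_right _ ?_).1 h5
  refine AddSubgroup.sum_mem _ fun j hj => ?_
  rcases lt_or_gt_of_ne (Finset.ne_of_mem_erase hj) with hj | hj
  · exact AddSubgroup.zsmul_mem _ (hW j k hj) _
  · have : c j = 0 := by simp [c, not_lt.2 hj.le, hj.ne']
    rw [this, zero_smul]; exact AddSubgroup.zero_mem _

lemma nil_inj {A : Finset G} (h0 : (0:G) ∈ A) (hs : ∀ v ∈ A, -v ∈ A) {w : ℕ} {p : LN G} (h : GoodW A w p)
    {M : ℕ} (hM : 1 ≤ M) (u : Fin M → G) (hu : ∀ i, u i ∈ msum A w) {τ : ℝ}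
    (ht0 : ∀ i, 0 < p.f (u i)) (htτ : ∀ i, p.f (u i) ≤ τ)
    (hB : ∀ i j, i < j → 32 * M * p.f (u i) ≤ p.f (u j))
    (W : Fin M → AddSubgroup G) (hW : ∀ j k, j < k → u j ∈ W k) (hW' : ∀ k, u k ∉ W k)
    (hmin : ∀ k, ∀ v ∈ msum A w, p.f v ≤ τ → p.f v < p.f (u k) → v ∈ W k)
    (d : Fin M → ℤ) (hd : ∀ j, |(d j : ℝ)| * p.f (u j) ≤ 1 / (64 * M))
    (hd' : ∀ j, d j ≠ 0 → 64 * τ ≤ |(d j:ℝ)| * p.f (u j))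
    (hsum : p.f (∑ j, d j • u j) ≤ 2 * τ) : ∀ j, d j = 0 := by
  by_contra hc
  push Not at hc
  obtain ⟨j0, hj0⟩ := hc
  obtain ⟨k, hk, hmax⟩ := (Finset.univ.filter (fun j => d j ≠ 0)).exists_max_image id ⟨j0, by simp [hj0]⟩
  have hk' : d k ≠ 0 := by simpa using hk
  have hkj : ∀ j, k < j → d j = 0 := by
    intro j hj
    by_contra hne
    exact absurd (hmax j (by simp [hne])) (not_le.2 hj)
  rcases lt_or_gt_of_ne hk' with h1 | h1
  · refine nil_core h0 hs h hM u hu ht0 htτ hB W hW hW' hmin (fun j => - d j) ?_ ?_ ?_ k (by simpa using h1) ?_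
    · intro j; simpa using hd j
    · intro j hj; simpa using hd' j (by simpa using hj)
    · simpa [p.neg] using hsum
    · intro j hj; simpa using hkj j hj
  · exact nil_core h0 hs h hM u hu ht0 htτ hB W hW hW' hmin d hd hd' hsum k h1 hkj
end Nil


section Nil2
variable {R : Type u} [NonUnitalRing R]

set_option maxHeartbeats 1000000 in
lemma nil_count {A : Finset R} (h0 : (0:R) ∈ A) (hs : ∀ v ∈ A, -v ∈ A) {w : ℕ} {p : LN R} (h : GoodW A w p)
    {M K ρ e hh N' : ℕ} (hM : 1 ≤ M) (hKM : K^4 ≤ 2^M) (hρ : 1 ≤ ρ) (he : 520 * M ≤ 2^e) (hhe : hh = 2*e*M+2*N')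
    (hH : HG A K ρ) (hpA : ∀ a ∈ A, p.f a ≤ (1/2)^(ρ+6)) (hN : Cov N' (msum A w : Set R) A)
    (u : Fin M → R) (hu : ∀ i, u i ∈ msum A w) {τ : ℝ} (hτ : τ = 1/(8*2^(ρ*hh)))
    (ht0 : ∀ i, 0 < p.f (u i)) (htτ : ∀ i, p.f (u i) ≤ τ)
    (hB : ∀ i j, i < j → 32 * M * p.f (u i) ≤ p.f (u j))
    (W : Fin M → AddSubgroup R) (hW : ∀ j k, j < k → u j ∈ W k) (hW' : ∀ k, u k ∉ W k)
    (hmin : ∀ k, ∀ v ∈ msum A w, p.f v ≤ τ → p.f v < p.f (u k) → v ∈ W k) : False := by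
  classical
  have hM' : (1:ℝ) ≤ M := by exact_mod_cast hM
  have hehh : e ≤ ρ*hh := by
    have : e ≤ hh := by rw [hhe]; nlinarith
    nlinarith
  obtain ⟨Θ, hΘ⟩ : ∃ Θ : ℕ, Θ = 2^(ρ*hh - e) := ⟨_, rfl⟩
  have hΘe : Θ * 2^e = 2^(ρ*hh) := by rw [hΘ, ← pow_add]; congr 1; omega
  have hΘτ : (Θ:ℝ) * (65 * τ) ≤ 1/(64*M) := by
    have e1 : (Θ:ℝ) * 2^e = 2^(ρ*hh) := by exact_mod_cast hΘe
    have e2 : (520:ℝ)*M ≤ 2^e := by exact_mod_cast he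
    have hΘ0 : (0:ℝ) < Θ := by rw [hΘ]; positivity
    rw [hτ, ← e1, le_div_iff₀ (by positivity)]
    have : (Θ:ℝ) * (65 * (1/(8*(Θ * 2^e)))) * (64*M) = 520*M/2^e := by field_simp; norm_num
    rw [this]
    exact div_le_one_of_le₀ e2 (by positivity)
  have hτ0 : 0 < τ := by rw [hτ]; positivity
  have hΘ1 : (1:ℝ) ≤ Θ := by
    have : 1 ≤ Θ := by rw [hΘ]; exact Nat.one_le_two_pow
    exact_mod_cast this
  have h64 : 1/(64*(M:ℝ)) ≤ 1/64 := by
    apply one_div_le_one_div_of_le (by norm_num); linarith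
  have hτs : 65*τ ≤ 1/64 := by nlinarith
  let q : Fin M → ℕ := fun i => ⌈64*τ/p.f (u i)⌉₊
  have q1 : ∀ i, 64*τ ≤ q i * p.f (u i) := by
    intro i
    have := Nat.le_ceil (64*τ/p.f (u i))
    rwa [div_le_iff₀ (ht0 i)] at this
  have q2 : ∀ i, q i * p.f (u i) ≤ 65*τ := by
    intro i
    have hp := ht0 i
    have := (Nat.ceil_lt_add_one (show 0 ≤ 64*τ/p.f (u i) by positivity)).le
    have h2 := mul_le_mul_of_nonneg_right this hp.le
    rw [add_mul, div_mul_cancel₀ _ hp.ne'] at h2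
    have := htτ i
    simp only [q]
    linarith
  let B : Finset R := (msum A w).filter (fun v => p.f v ≤ τ)
  let T : Finset R := (msum A w).filter (fun v => p.f v ≤ 1/16)
  let φ : (Fin M → Fin Θ) × R → R := fun x => (∑ i, ((((x.1 i : ℕ) * q i : ℕ)) : ℤ) • u i) + x.2
  have hcoef : ∀ (a : Fin M → Fin Θ) i, (((a i:ℕ) * q i : ℕ) : ℝ) * p.f (u i) ≤ 1/(64*M) := by
    intro a i
    have : ((a i:ℕ):ℝ) ≤ Θ := by exact_mod_cast (a i).2.le
    push_cast
    calc ((a i:ℕ):ℝ) * q i * p.f (u i) = ((a i:ℕ):ℝ) * (q i * p.f (u i)) := by ring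
      _ ≤ Θ * (65*τ) :=
        mul_le_mul this (q2 i) (mul_nonneg (Nat.cast_nonneg _) (ht0 i).le) (Nat.cast_nonneg _)
      _ ≤ _ := hΘτ
  have c1 : (Finset.univ ×ˢ B : Finset ((Fin M → Fin Θ) × R)).card ≤ T.card := by
    refine Finset.card_le_card_of_injOn φ ?_ ?_
    · rintro ⟨a, v⟩ hav
      have hv : v ∈ msum A w ∧ p.f v ≤ τ := by
        have := (Finset.mem_product.1 (Finset.mem_coe.1 hav)).2
        exact Finset.mem_filter.1 this
      have hs1 : ∑ i, |((((a i : ℕ) * q i : ℕ) : ℤ) : ℝ)| * p.f (u i) ≤ 1/64 := by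
        calc _ ≤ ∑ i : Fin M, 1/(64*(M:ℝ)) := by
              refine Finset.sum_le_sum fun i _ => ?_
              rw [Int.cast_natCast, Nat.abs_cast]
              exact hcoef a i
          _ = 1/64 := by simp; field_simp
      have m1 := h.sum h0 hs Finset.univ (fun i => (((a i : ℕ) * q i : ℕ) : ℤ)) u (fun i _ => hu i) (by linarith)
      have n1 : p.f (∑ i, (((a i : ℕ) * q i : ℕ) : ℤ) • u i) ≤ 1/64 :=
        ((p.sum_le _ _).trans (Finset.sum_le_sum fun i _ => p.zsmul_le _ _)).trans hs1
      have n2 : p.f (φ (a, v)) ≤ 1/16 := by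
        have := p.add_le (∑ i, (((a i : ℕ) * q i : ℕ) : ℤ) • u i) v
        simp only [φ]
        linarith
      exact Finset.mem_coe.2 (Finset.mem_filter.2 ⟨h.add h0 m1 hv.1 n2, n2⟩)
    · rintro ⟨a, v⟩ hav ⟨a', v'⟩ hav' heq
      have hv : v ∈ msum A w ∧ p.f v ≤ τ := Finset.mem_filter.1 (Finset.mem_product.1 (Finset.mem_coe.1 hav)).2
      have hv' : v' ∈ msum A w ∧ p.f v' ≤ τ := Finset.mem_filter.1 (Finset.mem_product.1 (Finset.mem_coe.1 hav')).2
      simp only [φ] at heq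
      have hd0 := nil_inj h0 hs h hM u hu ht0 htτ hB W hW hW' hmin
        (fun i => (((a i : ℕ) * q i : ℕ) : ℤ) - (((a' i : ℕ) * q i : ℕ) : ℤ)) ?_ ?_ ?_
      · have haa : a = a' := by
          funext i
          have h1 := hd0 i
          have hq : q i ≠ 0 := by
            intro h0
            have := q1 i
            rw [h0] at this
            simp at this
            linarith
          have h2 : (a i:ℕ) * q i = (a' i:ℕ) * q i := by omega
          exact Fin.ext (Nat.eq_of_mul_eq_mul_right (Nat.pos_of_ne_zero hq) h2)
        subst haa
        have := add_left_cancel heq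
        rw [this]
      · intro j
        push_cast
        have a1 := hcoef a j
        have a2 := hcoef a' j
        have hp := ht0 j
        push_cast at a1 a2
        have b1 : 0 ≤ ((a j:ℕ):ℝ) * q j * p.f (u j) := by positivity
        have b2 : 0 ≤ ((a' j:ℕ):ℝ) * q j * p.f (u j) := by positivity
        rw [← abs_of_pos hp, ← abs_mul, sub_mul, abs_le]
        constructor <;> linarith
      · intro j hj
        have hp := ht0 j
        have e1 : (((((a j : ℕ) * q j : ℕ) : ℤ) - (((a' j : ℕ) * q j : ℕ) : ℤ) : ℤ) : ℝ) =
          (((a j:ℕ):ℤ) - ((a' j:ℕ):ℤ) : ℤ) * (q j:ℝ) := by push_cast; ring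
        have e2 : (1:ℝ) ≤ |((((a j:ℕ):ℤ) - ((a' j:ℕ):ℤ) : ℤ):ℝ)| := by
          have : (((a j:ℕ):ℤ) - ((a' j:ℕ):ℤ)) ≠ 0 := by
            intro h0
            apply hj
            have : (a j:ℕ) = (a' j:ℕ) := by omega
            rw [this]; simp
          have := Int.one_le_abs this
          exact_mod_cast this
        rw [e1, abs_mul, Nat.abs_cast, mul_assoc]
        have := q1 j
        calc 64 * τ ≤ q j * p.f (u j) := q1 j
          _ ≤ _ := le_mul_of_one_le_left (by positivity) e2
      · have : ∑ j, ((((a j : ℕ) * q j : ℕ) : ℤ) - (((a' j : ℕ) * q j : ℕ) : ℤ)) • u j = v' - v := by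
          simp only [sub_smul, Finset.sum_sub_distrib]
          rw [sub_eq_sub_iff_add_eq_add, heq, add_comm]
        rw [this]
        have := p.sub_le v' v
        linarith [hv.2, hv'.2]
  have c2 : T.card ≤ N' * (bb A p p (1/8) (1/8)).card := by
    refine cov_diff_count hs (msum A w) hN T _ (Finset.filter_subset _ _) ?_
    intro x hx y hy hxy
    have := p.sub_le x y
    have h1 := (Finset.mem_filter.1 hx).2
    have h2 := (Finset.mem_filter.1 hy).2
    exact mem_bb.2 ⟨hxy, by linarith, by linarith⟩
  have c3 := hH p p hpA hpA hh (1/8) (1/8) (by norm_num) (by norm_num)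
  have c4 : (bb A p p (1/8/2^(ρ*hh)) (1/8/2^(ρ*hh))).card ≤ B.card := by
    apply Finset.card_le_card
    intro v hv
    have := mem_bb.1 hv
    refine Finset.mem_filter.2 ⟨msum_mono h0 h.1 this.1, ?_⟩
    rw [hτ, ← div_div]; exact this.2.1
  have c5 : 0 < B.card := Finset.card_pos.2 ⟨0, Finset.mem_filter.2 ⟨msum_zero_mem h0 w, by rw [p.zero']; exact hτ0.le⟩⟩
  have c6 : Θ^M ≤ N' * K^(2*ρ*hh) := by
    rw [Finset.card_product] at c1
    simp only [Finset.card_univ, Fintype.card_fun, Fintype.card_fin] at c1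
    refine Nat.le_of_mul_le_mul_right ?_ c5
    calc Θ^M * B.card ≤ N' * (bb A p p (1/8) (1/8)).card := c1.trans c2
      _ ≤ N' * (K^(2*ρ*hh) * B.card) := Nat.mul_le_mul_left _ (c3.trans (Nat.mul_le_mul_left _ c4))
      _ = _ := by ring
  have c7 : (Θ * 2^e)^(2*M) ≤ N'^2 * 2^(M*(ρ*hh)) * 2^(2*e*M) := by
    calc (Θ * 2^e)^(2*M) = (Θ^M)^2 * 2^(2*e*M) := by
          rw [mul_pow, ← pow_mul, ← pow_mul]; congr 2 <;> ring
      _ ≤ (N' * K^(2*ρ*hh))^2 * 2^(2*e*M) := by gcongr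
      _ = N'^2 * (K^4)^(ρ*hh) * 2^(2*e*M) := by rw [mul_pow, ← pow_mul, ← pow_mul]; congr 3; ring
      _ ≤ N'^2 * (2^M)^(ρ*hh) * 2^(2*e*M) := by gcongr
      _ = _ := by rw [← pow_mul]
  rw [hΘe, ← pow_mul] at c7
  have c8 : N'^2 < 2^(2*N') := by
    have := Nat.lt_two_pow_self (n := N')
    rw [mul_comm, pow_mul]
    exact Nat.pow_lt_pow_left this (by norm_num)
  have c9 : 2^(ρ*hh*(2*M)) < 2^(2*N' + M*(ρ*hh) + 2*e*M) := by
    refine c7.trans_lt ?_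
    rw [pow_add, pow_add]
    have : 0 < 2^(M*(ρ*hh)) := by positivity
    have : 0 < 2^(2*e*M) := by positivity
    gcongr
  have c10 := (Nat.pow_lt_pow_iff_right (by norm_num)).1 c9
  have c11 : hh ≤ M*(ρ*hh) := by
    have : 1 * hh ≤ (M*ρ) * hh := Nat.mul_le_mul_right _ (by nlinarith)
    calc hh = 1*hh := by ring
      _ ≤ _ := this
      _ = _ := by ring
  have c12 : ρ*hh*(2*M) = M*(ρ*hh) + M*(ρ*hh) := by ring
  omega
end Nil2


section Nil3
variable {R : Type u} [NonUnitalRing R]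

/-- the kernel of the norm -/
def Ker0 {A : Finset R} (hA : BA A) {w : ℕ} {p : LN R} (h : GoodW A w p) : AddSubgroup R where
  carrier := {v | v ∈ msum A w ∧ p.f v = 0}
  zero_mem' := ⟨msum_zero_mem hA.h0 w, p.zero'⟩
  add_mem' := by
    rintro a b ⟨ha, ha'⟩ ⟨hb, hb'⟩
    have h1 := p.add_le a b
    have h2 := p.nonneg (a+b)
    exact ⟨h.add hA.h0 ha hb (by linarith), by linarith⟩
  neg_mem' := by
    rintro a ⟨ha, ha'⟩
    exact ⟨msum_neg hA.hs ha, by rw [p.neg, ha']⟩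

lemma mem_Ker0 {A : Finset R} (hA : BA A) {w : ℕ} {p : LN R} (h : GoodW A w p) {v : R} :
    v ∈ Ker0 hA h ↔ v ∈ msum A w ∧ p.f v = 0 := Iff.rfl

set_option maxHeartbeats 1000000 in
lemma nil_prod {A : Finset R} (hA : BA A) {w : ℕ} {p : LN R} (h : GoodW A w p)
    {M K ρ e hh N' : ℕ} (hM : 1 ≤ M) (hKM : K^4 ≤ 2^M) (hρ : 1 ≤ ρ) (he : 520 * M ≤ 2^e) (hhe : hh = 2*e*M+2*N')
    (hH : HG A K ρ) (hpA : ∀ a ∈ A, p.f a ≤ (1/2)^(ρ+6)) (hN : Cov N' (msum A w : Set R) A)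
    {τ κ : ℝ} (hτ : τ = 1/(8*2^(ρ*hh))) (hτ16 : τ ≤ 1/16) (hκ : 0 ≤ κ) (hκM : κ * (32 * M) < 1) (Y : Set R)
    (hYV : ∀ y ∈ Y, y ∈ msum A w ∧ p.f y ≤ τ)
    (hY : ∀ y ∈ Y, ∀ v ∈ msum A w, p.f v ≤ 1/16 → v * y ∈ msum A w ∧ p.f (v * y) ≤ κ * p.f v) :
    ∀ v ∈ mulIter Y (M-1), v ∈ Ker0 hA h := by
  classical
  have hM' : (1:ℝ) ≤ M := by exact_mod_cast hM
  have hτ0 : 0 < τ := by rw [hτ]; positivity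
  obtain ⟨ball, hball⟩ : ∃ B : Finset R, B = (msum A w).filter (fun v => p.f v ≤ τ) := ⟨_, rfl⟩
  have mb : ∀ v, v ∈ ball ↔ v ∈ msum A w ∧ p.f v ≤ τ := by intro v; rw [hball, Finset.mem_filter]
  have hu : ∀ W : AddSubgroup R, ∃ u : R, (∃ v ∈ ball, v ∉ W) →
      u ∈ ball ∧ u ∉ W ∧ ∀ v ∈ ball, v ∉ W → p.f u ≤ p.f v := by
    intro W
    by_cases hex : ∃ v ∈ ball, v ∉ W
    · obtain ⟨v, hv, hvW⟩ := hex
      obtain ⟨u, h1, h2⟩ := (ball.filter (fun v => v ∉ W)).exists_min_image p.f ⟨v, Finset.mem_filter.2 ⟨hv, hvW⟩⟩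
      have h3 := Finset.mem_filter.1 h1
      exact ⟨u, fun _ => ⟨h3.1, h3.2, fun v hv hvW => h2 v (Finset.mem_filter.2 ⟨hv, hvW⟩)⟩⟩
    · exact ⟨0, fun hc => absurd hc hex⟩
  choose u hu using hu
  obtain ⟨W, W0, WS⟩ : ∃ W : ℕ → AddSubgroup R, W 0 = Ker0 hA h ∧
      ∀ n, W (n+1) = AddSubgroup.closure {v | v ∈ ball ∧ p.f v ≤ 32 * M * p.f (u (W n))} :=
    ⟨fun n => Nat.rec (Ker0 hA h)
      (fun _ W => AddSubgroup.closure {v | v ∈ ball ∧ p.f v ≤ 32 * M * p.f (u W)}) n, rfl, fun n => rfl⟩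
  -- kernel is inside everything
  have Kb : ∀ v ∈ Ker0 hA h, v ∈ ball := by
    intro v hv
    rw [mem_Ker0] at hv
    rw [mb]
    exact ⟨hv.1, by rw [hv.2]; exact hτ0.le⟩
  have KW : ∀ n, Ker0 hA h ≤ W n := by
    intro n
    cases n with
    | zero => exact W0.ge
    | succ n =>
      intro v hv
      rw [WS]
      refine AddSubgroup.subset_closure ⟨Kb v hv, ?_⟩
      rw [((mem_Ker0 hA h).1 hv).2]
      have := p.nonneg (u (W n))
      positivity
  have tpos : ∀ n, (∃ v ∈ ball, v ∉ W n) → 0 < p.f (u (W n)) := by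
    intro n hn
    obtain ⟨h1, h2, h3⟩ := hu _ hn
    rcases (p.nonneg (u (W n))).eq_or_lt with h4 | h4
    · exact absurd (KW n ((mem_Ker0 hA h).2 ⟨((mb _).1 h1).1, h4.symm⟩)) h2
    · exact h4
  have step : ∀ n, (∃ v ∈ ball, v ∉ W (n+1)) → 32 * M * p.f (u (W n)) ≤ p.f (u (W (n+1))) := by
    intro n hn
    obtain ⟨h1, h2, h3⟩ := hu _ hn
    by_contra hc
    push Not at hc
    apply h2
    rw [WS]
    rw [WS] at h1 hc
    exact AddSubgroup.subset_closure ⟨h1, hc.le⟩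
  have mulY : ∀ n, (∃ v ∈ ball, v ∉ W n) → ∀ y ∈ Y, ∀ v ∈ W (n+1), v * y ∈ W n := by
    intro n hn y hy v hv
    obtain ⟨h1, h2, h3⟩ := hu _ hn
    have ht := tpos n hn
    rw [WS] at hv
    induction hv using AddSubgroup.closure_induction with
    | mem v hv =>
      obtain ⟨hv1, hv2⟩ := hv
      rw [mb] at hv1
      obtain ⟨g1, g2⟩ := hY y hy v hv1.1 (by linarith [hv1.2])
      by_contra hc
      have hκ1 : κ ≤ 1 := by nlinarith
      have hlt : p.f (v*y) < p.f (u (W n)) := by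
        calc p.f (v*y) ≤ κ * p.f v := g2
          _ ≤ κ * (32 * M * p.f (u (W n))) := by gcongr
          _ = κ * (32*M) * p.f (u (W n)) := by ring
          _ < 1 * p.f (u (W n)) := by gcongr
          _ = _ := one_mul _
      have := h3 (v*y) ((mb _).2 ⟨g1, (hlt.le.trans ((mb _).1 h1).2)⟩) hc
      linarith
    | zero => rw [zero_mul]; exact AddSubgroup.zero_mem _
    | add a b _ _ ha hb => rw [add_mul]; exact AddSubgroup.add_mem _ ha hb
    | neg a _ ha => rw [neg_mul]; exact AddSubgroup.neg_mem _ ha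
  have mulY0 : ∀ y ∈ Y, ∀ v ∈ Ker0 hA h, v * y ∈ Ker0 hA h := by
    intro y hy v hv
    rw [mem_Ker0] at hv ⊢
    obtain ⟨g1, g2⟩ := hY y hy v hv.1 (by rw [hv.2]; norm_num)
    rw [hv.2, mul_zero] at g2
    exact ⟨g1, le_antisymm g2 (p.nonneg _)⟩
  by_cases hex : ∃ m : ℕ, m < M ∧ ∀ v : R, v ∈ ball → v ∈ W m
  · have hf := Nat.find_spec hex
    obtain ⟨m, hm⟩ : ∃ m, m = Nat.find hex := ⟨_, rfl⟩
    rw [← hm] at hf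
    have hlt : ∀ i < m, ∃ v ∈ ball, v ∉ W i := by
      intro i hi
      rw [hm] at hi
      have := Nat.find_min hex hi
      by_contra hc
      push Not at hc
      refine this ⟨by omega, hc⟩
    have h1 : ∀ i ≤ m, ∀ v ∈ mulIter Y i, v ∈ W (m-i) := by
      intro i
      induction i with
      | zero => intro _ v hv; exact hf.2 v ((mb v).2 (hYV v hv))
      | succ i ih =>
        rintro hi _ ⟨a, ha, b, hb, rfl⟩
        refine mulY (m-(i+1)) (hlt _ (by omega)) b hb a ?_
        have : m - (i+1) + 1 = m - i := by omega
        rw [this]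
        exact ih (by omega) a ha
    have h2 : ∀ k, ∀ v ∈ mulIter Y (m+k), v ∈ Ker0 hA h := by
      intro k
      induction k with
      | zero => intro v hv; have := h1 m le_rfl v hv; rwa [Nat.sub_self, W0] at this
      | succ k ih =>
        rintro _ ⟨a, ha, b, hb, rfl⟩
        exact mulY0 b hb a (ih a ha)
    intro v hv
    refine h2 (M-1-m) v ?_
    have : m + (M-1-m) = M-1 := by omega
    rwa [this]
  · exfalso
    push Not at hex
    have stepj : ∀ i k, i + k + 1 < M → 32 * M * p.f (u (W i)) ≤ p.f (u (W (i+k+1))) := by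
      intro i k
      induction k with
      | zero => intro hi; exact step i (hex _ hi)
      | succ k ih =>
        intro hi
        have h1 := ih (by omega)
        have h2 := step (i+k+1) (hex _ (by omega))
        have h3 := p.nonneg (u (W (i+k+1)))
        have : p.f (u (W (i+k+1))) ≤ 32 * M * p.f (u (W (i+k+1))) := le_mul_of_one_le_left h3 (by linarith)
        exact h1.trans (this.trans h2)
    have Wmono : ∀ i, i + 1 < M → W i ≤ W (i+1) := by
      intro i hi
      cases i with
      | zero => rw [W0]; exact KW 1
      | succ i =>
        rw [WS i, WS (i+1)]
        refine AddSubgroup.closure_mono ?_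
        rintro v ⟨hv1, hv2⟩
        refine ⟨hv1, hv2.trans ?_⟩
        have h1 := step i (hex (i+1) (by omega))
        have h3 := p.nonneg (u (W (i+1)))
        exact h1.trans (le_mul_of_one_le_left h3 (by linarith))
    have Wu : ∀ i k, i + k + 1 < M → u (W i) ∈ W (i+k+1) := by
      intro i k
      induction k with
      | zero =>
        intro hi
        rw [Nat.add_zero, WS]
        have h3 := p.nonneg (u (W i))
        exact AddSubgroup.subset_closure ⟨(hu _ (hex i (by omega))).1, le_mul_of_one_le_left h3 (by linarith)⟩
      | succ k ih => intro hi; exact Wmono (i+k+1) hi (ih (by omega))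
    refine nil_count hA.h0 hA.hs h hM hKM hρ he hhe hH hpA hN (fun i : Fin M => u (W i)) ?_ hτ ?_ ?_ ?_
      (fun i => W i) ?_ ?_ ?_
    · intro i; exact ((mb _).1 (hu _ (hex i i.2)).1).1
    · intro i; exact tpos i (hex i i.2)
    · intro i; exact ((mb _).1 (hu _ (hex i i.2)).1).2
    · intro i j hij
      have hij : (i:ℕ) < j := hij
      have := stepj i (j-i-1) (by have := j.2; omega)
      rwa [show (i:ℕ) + (j-i-1) + 1 = j by omega] at this
    · intro i j hij
      have hij : (i:ℕ) < j := hij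
      have := Wu i (j-i-1) (by have := j.2; omega)
      rwa [show (i:ℕ) + (j-i-1) + 1 = j by omega] at this
    · intro k; exact (hu _ (hex k k.2)).2.1
    · intro k v hv hv1 hv2
      by_contra hc
      have := (hu _ (hex k k.2)).2.2 v ((mb v).2 ⟨hv, hv1⟩) hc
      linarith
end Nil3


section Ideal
variable {R : Type u} [NonUnitalRing R]

/-- span of long monomials -/
def Tk (Y : Set R) (k : ℕ) : AddSubgroup R := AddSubgroup.closure {v | ∃ j, k ≤ j ∧ v ∈ mulIter Y j}

lemma Tk_anti (Y : Set R) {k l : ℕ} (h : k ≤ l) : Tk Y l ≤ Tk Y k := by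
  refine AddSubgroup.closure_mono ?_
  rintro v ⟨j, hj, hv⟩
  exact ⟨j, h.trans hj, hv⟩

lemma Tk_mul (Y : Set R) {s : R} (hs : s ∈ NonUnitalSubring.closure Y) :
    ∀ (k : ℕ), ∀ t ∈ Tk Y k, t * s ∈ Tk Y (k+1) := by
  induction hs using NonUnitalSubring.closure_induction with
  | mem y hy =>
    intro k t ht
    induction ht using AddSubgroup.closure_induction with
    | mem v hv =>
      obtain ⟨j, hj, hv⟩ := hv
      exact AddSubgroup.subset_closure ⟨j+1, by omega, v, hv, y, hy, rfl⟩
    | zero => rw [zero_mul]; exact AddSubgroup.zero_mem _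
    | add a b _ _ ha hb => rw [add_mul]; exact AddSubgroup.add_mem _ ha hb
    | neg a _ ha => rw [neg_mul]; exact AddSubgroup.neg_mem _ ha
  | zero => intro k t _; rw [mul_zero]; exact AddSubgroup.zero_mem _
  | add a b _ _ ha hb => intro k t ht; rw [mul_add]; exact AddSubgroup.add_mem _ (ha k t ht) (hb k t ht)
  | neg a _ ha => intro k t ht; rw [mul_neg]; exact AddSubgroup.neg_mem _ (ha k t ht)
  | mul a b _ _ ha hb =>
    intro k t ht
    rw [← mul_assoc]
    exact Tk_anti Y (by omega) (hb _ _ (ha k t ht))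

lemma Tk_zero (Y : Set R) {s : R} (hs : s ∈ NonUnitalSubring.closure Y) : s ∈ Tk Y 0 := by
  induction hs using NonUnitalSubring.closure_induction with
  | mem y hy => exact AddSubgroup.subset_closure ⟨0, le_rfl, hy⟩
  | zero => exact AddSubgroup.zero_mem _
  | add a b _ _ ha hb => exact AddSubgroup.add_mem _ ha hb
  | neg a _ ha => exact AddSubgroup.neg_mem _ ha
  | mul a b _ hb' ha hb => exact Tk_anti Y (by omega) (Tk_mul Y hb' 0 a ha)

lemma mulIter_Tk (Y : Set R) (k : ℕ) : ∀ v ∈ mulIter (NonUnitalSubring.closure Y : Set R) k, v ∈ Tk Y k := by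
  induction k with
  | zero => intro v hv; exact Tk_zero Y hv
  | succ k ih =>
    rintro _ ⟨a, ha, b, hb, rfl⟩
    exact Tk_mul Y hb k a (ih a ha)

lemma iterX_closure (Y : Set R) (n : ℕ) : iterX Y n ⊆ (NonUnitalSubring.closure Y : Set R) := by
  induction n with
  | zero => exact NonUnitalSubring.subset_closure
  | succ n ih =>
    rintro _ ⟨_, ⟨a, ha, b, hb, rfl⟩, _, ⟨c, hc, d, hd, rfl⟩, rfl⟩
    exact add_mem (add_mem (ih ha) (ih hb)) (mul_mem (ih hc) (ih hd))

lemma mulIter_iterX {Y : Set R} (hY : AddSymm Y) (k : ℕ) : mulIter Y k ⊆ iterX Y k := by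
  induction k with
  | zero => exact subset_rfl
  | succ k ih =>
    rintro _ ⟨a, ha, b, hb, rfl⟩
    exact iterX_mul hY (ih ha) (iterX_mono hY (Nat.zero_le k) hb)

lemma ideal_main {Y : Set R} (hY : AddSymm Y) (I0 : AddSubgroup R) (M N : ℕ) (hM1 : 1 ≤ M)
    (hl : ∀ y ∈ Y, ∀ v ∈ I0, y * v ∈ I0) (hr : ∀ y ∈ Y, ∀ v ∈ I0, v * y ∈ I0)
    (hc : Cov N (I0 : Set R) Y) (hM : ∀ v ∈ mulIter Y (M-1), v ∈ I0) :
    ∃ I : Set R, IsTwoSidedIdealIn I (NonUnitalSubring.closure Y : Set R) ∧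
      I ⊆ iterX Y (M + 2 * N + 2) ∧ mulIter (NonUnitalSubring.closure Y : Set R) (M-1) ⊆ I := by
  classical
  obtain ⟨F, hF, hcov⟩ := hc
  let E : ℕ → Finset R := fun n => F.filter (fun e => ∃ i ∈ I0, i - e ∈ Y ∧ i ∈ iterX Y n)
  have Emono : ∀ m n, m ≤ n → E m ⊆ E n := by
    intro m n hmn e he
    obtain ⟨h1, i, h2, h3, h4⟩ := Finset.mem_filter.1 he
    exact Finset.mem_filter.2 ⟨h1, i, h2, h3, iterX_mono hY hmn h4⟩
  obtain ⟨k, hk, hE⟩ : ∃ k ≤ N, E (M + 2*k) = E (M+2*k+2) := by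
    by_contra hcon
    push Not at hcon
    have : ∀ k ≤ N+1, k ≤ (E (M+2*k)).card := by
      intro k
      induction k with
      | zero => intro _; omega
      | succ k ih =>
        intro hk
        have h1 := ih (by omega)
        have h2 := hcon k (by omega)
        have h3 := Finset.card_lt_card ((Emono (M+2*k) (M+2*k+2) (by omega)).ssubset_of_ne h2)
        have : M + 2*(k+1) = M+2*k+2 := by ring
        rw [this]
        omega
    have h1 := this (N+1) le_rfl
    have h2 : (E (M+2*(N+1))).card ≤ N := (Finset.card_filter_le _ _).trans hF
    omega
  obtain ⟨n, hn⟩ : ∃ n, n = M + 2*k := ⟨_, rfl⟩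
  rw [← hn] at hE
  have key : ∀ i ∈ I0, i ∈ iterX Y (n+2) → i ∈ iterX Y (n+1) := by
    intro i hi hi2
    obtain ⟨e, he, y, hy, hey⟩ := hcov hi
    simp only at hey
    have : e ∈ E (n+2) := Finset.mem_filter.2 ⟨he, i, hi, by rw [← hey]; simpa using hy, hi2⟩
    rw [← hE] at this
    obtain ⟨-, i', hi', hy', hi'n⟩ := Finset.mem_filter.1 this
    have e1 : i' + (-(i'-e) + y) = i := by rw [← hey]; abel
    rw [← e1]
    refine iterX_add hY hi'n ?_
    exact iterX_mono hY (show 1 ≤ n by omega) (iterX_add hY (n := 0) (hY.neg_mem hy') hy)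
  have hsymm := iterX_symm hY (n+1)
  have Hl : ∀ r ∈ NonUnitalSubring.closure Y, ∀ x, x ∈ I0 ∧ x ∈ iterX Y (n+1) →
      (r * x ∈ I0 ∧ r * x ∈ iterX Y (n+1)) ∧ (x * r ∈ I0 ∧ x * r ∈ iterX Y (n+1)) := by
    intro r hr'
    have Hadd : ∀ a b : R, a ∈ I0 ∧ a ∈ iterX Y (n+1) → b ∈ I0 ∧ b ∈ iterX Y (n+1) →
        a + b ∈ I0 ∧ a + b ∈ iterX Y (n+1) := fun a b ha hb =>
      ⟨I0.add_mem ha.1 hb.1, key _ (I0.add_mem ha.1 hb.1) (iterX_add hY ha.2 hb.2)⟩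
    induction hr' using NonUnitalSubring.closure_induction with
    | mem y hy =>
      intro x hx
      have hy' : y ∈ iterX Y (n+1) := iterX_mono hY (Nat.zero_le _) hy
      exact ⟨⟨hl y hy x hx.1, key _ (hl y hy x hx.1) (iterX_mul hY hy' hx.2)⟩,
        ⟨hr y hy x hx.1, key _ (hr y hy x hx.1) (iterX_mul hY hx.2 hy')⟩⟩
    | zero =>
      intro x hx
      rw [zero_mul, mul_zero]
      exact ⟨⟨I0.zero_mem, hsymm.1⟩, ⟨I0.zero_mem, hsymm.1⟩⟩
    | add a b _ _ ha hb =>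
      intro x hx
      rw [add_mul, mul_add]
      exact ⟨Hadd _ _ (ha x hx).1 (hb x hx).1, Hadd _ _ (ha x hx).2 (hb x hx).2⟩
    | neg a _ ha =>
      intro x hx
      rw [neg_mul, mul_neg]
      exact ⟨⟨I0.neg_mem (ha x hx).1.1, hsymm.neg_mem (ha x hx).1.2⟩,
        ⟨I0.neg_mem (ha x hx).2.1, hsymm.neg_mem (ha x hx).2.2⟩⟩
    | mul a b _ _ ha hb =>
      intro x hx
      rw [mul_assoc, ← mul_assoc x]
      exact ⟨(ha _ (hb x hx).1).1, (hb _ (ha x hx).2).2⟩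
  let H : AddSubgroup R :=
    { carrier := {x | x ∈ I0 ∧ x ∈ iterX Y (n+1)}
      zero_mem' := ⟨I0.zero_mem, hsymm.1⟩
      add_mem' := fun {a b} ha hb => ⟨I0.add_mem ha.1 hb.1, key _ (I0.add_mem ha.1 hb.1) (iterX_add hY ha.2 hb.2)⟩
      neg_mem' := fun {a} ha => ⟨I0.neg_mem ha.1, hsymm.neg_mem ha.2⟩ }
  have mH : ∀ x, x ∈ H ↔ x ∈ I0 ∧ x ∈ iterX Y (n+1) := fun x => Iff.rfl
  refine ⟨(H : Set R), ⟨?_, H.zero_mem, fun x hx y hy => H.add_mem hx hy, fun x hx => H.neg_mem hx, ?_⟩, ?_, ?_⟩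
  · intro x hx
    exact iterX_closure Y _ hx.2
  · intro r hr' x hx
    exact Hl r hr' x hx
  · intro x hx
    exact iterX_mono hY (by omega) hx.2
  · intro v hv
    have h1 := mulIter_Tk Y _ v hv
    have h2 : Tk Y (M-1) ≤ H := by
      refine (AddSubgroup.closure_le _).2 ?_
      rintro v ⟨j, hj, hv⟩
      obtain ⟨d, rfl⟩ := Nat.exists_eq_add_of_le hj
      clear hj
      induction d generalizing v with
      | zero =>
        exact ⟨hM v hv, iterX_mono hY (by omega) (mulIter_iterX hY _ hv)⟩
      | succ d ih =>
        obtain ⟨a, ha, b, hb, rfl⟩ := hv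
        exact (Hl b (NonUnitalSubring.subset_closure hb) a (ih ha)).2
    exact h2 h1
end Ideal


set_option maxHeartbeats 2000000 in
lemma main_two (K M : ℕ) (hK : 2 ≤ K) (hM : 1 ≤ M) (hKM : K^4 ≤ 2^M) : ∃ N₂ N₃ : ℕ,
    ∀ (R : Type u) [NonUnitalRing R] (X : Finset R), IsApproxSubringWith K (X : Set R) →
      ∃ Y : Finset R, (Y : Set R) ⊆ (X:Set R) + (X:Set R) ∧ IsApproxSubringWith (K^13 + K^7) (Y:Set R) ∧
        NCommensurable N₂ (Y:Set R) X ∧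
        ∃ I : Set R, IsTwoSidedIdealIn I (NonUnitalSubring.closure (Y:Set R) : Set R) ∧
          I ⊆ iterX (Y:Set R) N₃ ∧ mulIter (NonUnitalSubring.closure (Y:Set R) : Set R) (M-1) ⊆ I := by
  obtain ⟨NA0, hst⟩ := stage1.{u} K (by omega)
  obtain ⟨NA, hNA⟩ : ∃ n : ℕ, n = NA0 + 1 := ⟨_, rfl⟩
  obtain ⟨KA, hKA⟩ : ∃ n : ℕ, n = NA*NA*K*NA := ⟨_, rfl⟩
  obtain ⟨CA, hCA⟩ : ∃ n : ℕ, n = 1*(NA*NA*K)*K := ⟨_, rfl⟩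
  obtain ⟨ρ, hρ⟩ : ∃ n : ℕ, n = NA*CA+2 := ⟨_, rfl⟩
  have hNA1 : 1 ≤ NA := by omega
  have hKA1 : 1 ≤ KA := by rw [hKA]; exact Nat.succ_le_of_lt (by positivity)
  have hρ2 : 2 ≤ ρ := by omega
  have hρK : NA*CA ≤ K^(ρ-2) := by
    rw [hρ, Nat.add_sub_cancel]
    exact (Nat.lt_pow_self (by omega)).le
  obtain ⟨Wm, hsel⟩ := select.{u} K KA ρ hK hKA1 (by omega)
  obtain ⟨N', hN'⟩ : ∃ n : ℕ, n = KA^(Wm+1) := ⟨_, rfl⟩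
  have hN'1 : 1 ≤ N' := by rw [hN']; exact Nat.one_le_pow _ _ hKA1
  obtain ⟨e, he⟩ : ∃ n : ℕ, n = 520*M := ⟨_, rfl⟩
  have he2 : 520 * M ≤ 2^e := by rw [← he]; exact Nat.lt_two_pow_self.le
  obtain ⟨hh, hhe⟩ : ∃ n : ℕ, n = 2*e*M+2*N' := ⟨_, rfl⟩
  obtain ⟨τ, hτ⟩ : ∃ t : ℝ, t = 1/(8*2^(ρ*hh)) := ⟨_, rfl⟩
  have hτ0 : 0 < τ := by rw [hτ]; positivity
  have hτ16 : τ ≤ 1/16 := by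
    rw [hτ]
    apply one_div_le_one_div_of_le (by norm_num)
    have h1 : 1 ≤ ρ*hh := Nat.succ_le_of_lt (Nat.mul_pos (by omega) (by rw [hhe]; omega))
    have : (2:ℝ)^1 ≤ 2^(ρ*hh) := pow_le_pow_right₀ (by norm_num) h1
    linarith
  obtain ⟨C, hC⟩ : ∃ n : ℕ, n = N'*K^(2*ρ) := ⟨_, rfl⟩
  have hC1 : 1 ≤ C := by rw [hC]; exact Nat.succ_le_of_lt (by positivity)
  obtain ⟨j, hj⟩ : ∃ n : ℕ, n = 96*C + 48*C*Wm + 2048*Wm + 1024*Wm*M + 1 := ⟨_, rfl⟩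
  obtain ⟨L, hL⟩ : ∃ n : ℕ, n = 2^(ρ*j) := ⟨_, rfl⟩
  have hLj : j ≤ L := by
    rw [hL]
    refine Nat.lt_two_pow_self.le.trans (Nat.pow_le_pow_right (by norm_num) ?_)
    nlinarith
  obtain ⟨J0, hJ0⟩ : ∃ n : ℕ, n = N'*K^(2*ρ)*2^(ρ*j) := ⟨_, rfl⟩
  have hJCL : J0 = C*L := by rw [hJ0, hC, hL]
  have hL1 : 1 ≤ L := by omega
  have hJ1 : 1 ≤ J0 := by rw [hJCL]; exact Nat.succ_le_of_lt (by positivity)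
  obtain ⟨s, hs⟩ : ∃ t : ℝ, t = 1/2^(2*ρ*j) := ⟨_, rfl⟩
  have hsL : s = 1/(L:ℝ)^2 := by
    rw [hs, hL]; push_cast; rw [← pow_mul]; congr 2; ring
  have hLr : (1:ℝ) ≤ L := by exact_mod_cast hL1
  have hCr : (1:ℝ) ≤ C := by exact_mod_cast hC1
  have hJr : (J0:ℝ) = C*L := by rw [hJCL]; push_cast; ring
  have hs0 : 0 < s := by rw [hs]; positivity
  have hLL : (L:ℝ) ≤ L^2 := by nlinarith
  have b1 : (96:ℝ)*C ≤ L := by exact_mod_cast (show 96*C ≤ L by omega)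
  have b2 : (48:ℝ)*C*Wm ≤ L := by exact_mod_cast (show 48*C*Wm ≤ L by omega)
  have b3 : (2048:ℝ)*Wm ≤ L := by exact_mod_cast (show 2048*Wm ≤ L by omega)
  have b4 : (1024:ℝ)*Wm*M < L := by exact_mod_cast (show 1024*Wm*M < L by omega)
  obtain ⟨g, hg⟩ : ∃ t : ℝ, t = 1/(16*J0) := ⟨_, rfl⟩
  obtain ⟨em, hem⟩ : ∃ t : ℝ, t = s/J0 := ⟨_, rfl⟩
  have hJr1 : (1:ℝ) ≤ J0 := by exact_mod_cast hJ1
  have hem0 : 0 < em := by rw [hem]; positivity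
  have g1 : 6*s ≤ g := by
    rw [hg, hsL, hJr, mul_one_div, div_le_div_iff₀ (by positivity) (by positivity)]
    nlinarith
  have g2 : 3*s*Wm ≤ g := by
    have : 3*s*Wm = (3*Wm)/(L:ℝ)^2 := by rw [hsL]; ring
    rw [hg, this, hJr, div_le_div_iff₀ (by positivity) (by positivity)]
    nlinarith
  have g3 : g ≤ 1/16 := by
    rw [hg]; apply one_div_le_one_div_of_le (by norm_num); linarith
  have hs16 : s ≤ 1/16 := by linarith
  have g4 : em ≤ 1/16 := by
    rw [hem]; exact (div_le_self hs0.le hJr1).trans hs16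
  have g5 : 64*Wm*s ≤ 1/32 := by
    have : 64*Wm*s = (64*Wm)/(L:ℝ)^2 := by rw [hsL]; ring
    rw [this, div_le_div_iff₀ (by positivity) (by norm_num)]
    nlinarith
  obtain ⟨κ, hκ⟩ : ∃ t : ℝ, t = 32*(Wm*s) := ⟨_, rfl⟩
  have hκ0 : 0 ≤ κ := by rw [hκ]; positivity
  have hκM : κ * (32*M) < 1 := by
    have : κ * (32*M) = (1024*Wm*M)/(L:ℝ)^2 := by rw [hκ, hsL]; ring
    rw [this, div_lt_one (by positivity)]
    linarith
  obtain ⟨x0, hx0⟩ : ∃ t : ℝ, t = min (em/2) τ := ⟨_, rfl⟩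
  have hx00 : 0 < x0 := by rw [hx0]; exact lt_min (by linarith) hτ0
  have hx0e : 2*x0 ≤ em := by
    have := min_le_left (em/2) τ
    rw [← hx0] at this; linarith
  have hx0τ : x0 ≤ τ := by rw [hx0]; exact min_le_right _ _
  obtain ⟨h', hh'⟩ := exists_pow_lt_of_lt_one (show 0 < min (x0/8^(ρ*(N'+1))) (3*s) from lt_min (by positivity) (by positivity))
    (show (1/2:ℝ) < 1 by norm_num)
  have hh2 : (1:ℝ)/2^(ρ*h') ≤ (1/2)^h' := by
    rw [one_div_pow]
    apply one_div_le_one_div_of_le (by positivity)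
    exact pow_le_pow_right₀ (by norm_num) (by nlinarith)
  have hh3 := hh2.trans (hh'.le.trans (min_le_left _ _))
  have hh4 := hh2.trans (hh'.le.trans (min_le_right _ _))
  obtain ⟨N₂, hN₂⟩ : ∃ n : ℕ, n = max K (CA*NA*K^(2*ρ*h')) := ⟨_, rfl⟩
  refine ⟨N₂, M + 2*(N'*(NA*N₂)) + 2, fun R _ X hX => ?_⟩
  obtain ⟨A, hA0, hAs, hAm, cAX, cXA⟩ := hst R X hX
  have hA : BA A := ⟨hA0, hAs, hAm⟩
  obtain ⟨hXm, hXa⟩ := approx_cov hX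
  replace cAX : Cov NA (A:Set R) X := cAX.mono (by omega) subset_rfl
  replace cXA : Cov NA (X:Set R) A := cXA.mono (by omega) subset_rfl
  have cAAX : Cov (NA*NA*K) ((A:Set R)+(A:Set R)) X := cAX.add_same cAX hXa
  have cAA : Cov KA ((A:Set R)+(A:Set R)) A := by rw [hKA]; exact cAAX.trans cXA
  have hCA' : ∀ D : Finset R, (∀ d ∈ D, ∃ x ∈ X, ∃ a ∈ msum A 2, d = x + a) → D.card ≤ CA * X.card := by
    intro D hD
    have c1 : Cov (1*(NA*NA*K)*K) ((X:Set R) + ((A:Set R)+(A:Set R))) X := (Cov.self (X:Set R)).add_same cAAX hXa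
    rw [← hCA] at c1
    refine (c1.mono le_rfl (S' := (D:Set R)) ?_).card
    intro d hd
    obtain ⟨x, hx, a, ha, rfl⟩ := hD d hd
    obtain ⟨y, hy, z, hz, rfl⟩ := mem_msum_two.1 ha
    exact ⟨x, hx, _, ⟨y, hy, z, hz, rfl⟩, rfl⟩
  have hH : HG A K ρ := fun p q hp hq k s s' hs hs' =>
    growth_iter X A K NA CA ρ hXa hX.1.1 hA0 hAs cXA hCA' hρ2 hρK p q hp hq k s s' hs hs'
  obtain ⟨w', w, p', p, S⟩ := hsel j (by omega) R A hA cAA hH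
  have covm : ∀ m, m ≤ Wm + 2 → Cov N' (msum A m : Set R) A := by
    intro m hm
    have := msum_cov cAA (Wm+1)
    rw [← hN'] at this
    refine this.mono le_rfl ?_
    intro v hv
    exact msum_mono hA0 hm hv
  have ww := S.ww
  have wW := S.wW
  have hG : GapD A Wm w' w p' p s g em :=
    { g' := S.g', gd := S.g, ww := S.ww, wW := S.wW, small := S.small
      gap := fun y hy h1 h2 => gap hA S hH hρ2 (covm _ (by omega)) s hs hJ0 hJ1 hy (by rw [← hem]; exact h1) (by rw [← hg]; exact h2)
      spos := hs0, gs := g1, gw := g2, g16 := g3, em16 := g4, sW := g5 }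
  obtain ⟨x, hx1, hx2, hxc⟩ := pigeon_x hA hG hH hK (by omega) S.e' S.e (covm w' (by omega)) x0 hx00 hx0e
  have hxpos : 0 < x := lt_of_lt_of_le (by positivity) hx1
  have hxem : 6*x ≤ em := by linarith
  have hYapp := YY_approx hX hA hG hxpos hxem hxc
  obtain ⟨hYc1, hYc2⟩ := YY_comm hX hA hG hH S.e' S.e cXA hCA' hxpos hxem (hh3.trans hx1) hh4
  obtain ⟨Y, hYdef⟩ : ∃ Y : Finset R, Y = YY X A w' p' p s (2*x) := ⟨_, rfl⟩
  rw [← hYdef] at hYapp hYc1 hYc2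
  have memY : ∀ y ∈ (Y:Set R), y ∈ UU A w' p' p s (2*x) := by
    intro y hy
    rw [hYdef] at hy
    exact (mem_YY.1 hy).2
  have contr := fun y hy v hv hpv => UU_contr hA hG (memY y hy) (v := v) hv hpv
  rw [← hκ] at contr
  have hYV : ∀ y ∈ (Y:Set R), y ∈ msum A w ∧ p.f y ≤ τ := by
    intro y hy
    have := mem_UU.1 (memY y hy)
    refine ⟨msum_mono hA0 ww this.1, ?_⟩
    have h1 := bigP_self A p y
    linarith [this.2.1]
  have hYc2' : Cov N₂ (X:Set R) Y := hYc2.mono (by rw [hN₂]; exact le_max_right _ _) subset_rfl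
  refine ⟨Y, ?_, hYapp, ⟨hYc1.mono (by rw [hN₂]; exact le_max_left _ _) subset_rfl, hYc2'⟩, ?_⟩
  · intro y hy
    rw [hYdef] at hy
    obtain ⟨⟨a, ha, b, hb, rfl⟩, -⟩ := mem_YY.1 hy
    exact ⟨a, ha, b, hb, rfl⟩
  · refine ideal_main hYapp.1 (Ker0 hA S.g) M (N'*(NA*N₂)) hM ?_ ?_ ?_ ?_
    · intro y hy v hv
      rw [mem_Ker0] at hv ⊢
      obtain ⟨⟨h1, h2⟩, -⟩ := contr y hy v hv.1 (by rw [hv.2]; norm_num)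
      rw [hv.2, mul_zero] at h2
      exact ⟨h1, le_antisymm h2 (p.nonneg _)⟩
    · intro y hy v hv
      rw [mem_Ker0] at hv ⊢
      obtain ⟨-, ⟨h1, h2⟩⟩ := contr y hy v hv.1 (by rw [hv.2]; norm_num)
      rw [hv.2, mul_zero] at h2
      exact ⟨h1, le_antisymm h2 (p.nonneg _)⟩
    · refine Cov.mono ((covm w (by omega)).trans (cAX.trans hYc2')) le_rfl ?_
      intro v hv
      exact ((mem_Ker0 hA S.g).1 hv).1
    · exact nil_prod hA S.g hM hKM (by omega) he2 hhe hH S.e (covm w (by omega)) hτ hτ16 hκ0 hκM Y hYV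
        (fun y hy v hv hpv => (contr y hy v hv hpv).2)

/-- Structure theorem for finite approximate subrings (second regime): `I ⊆ Y_{N₃(K)}` and
the nilpotency class is bounded by `⌊4·log₂ K⌋`. -/
theorem stmt2 (K : ℕ) (hK : 1 ≤ K) :
    ∃ N₂ N₃ : ℕ, ∀ (R : Type u) [NonUnitalRing R] (X : Set R),
      X.Finite → IsApproxSubringWith K X →
      ∃ Y : Set R,
        Y ⊆ (X + X + X + X) + X * (X + X + X + X) ∧ Y.Finite ∧
        IsApproxSubringWith (K ^ 510 + K ^ 22) Y ∧
        NCommensurable N₂ Y X ∧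
        ∃ I : Set R, IsTwoSidedIdealIn I (NonUnitalSubring.closure Y : Set R) ∧
          I ⊆ iterX Y N₃ ∧
          mulIter (NonUnitalSubring.closure Y : Set R)
            (Nat.floor ((4 : ℝ) * Real.logb 2 (K : ℝ))) ⊆ I := by
  rcases hK.eq_or_lt with rfl | hK2
  · refine ⟨1, 0, fun R _ X hfin hX => ?_⟩
    obtain ⟨X, rfl⟩ : ∃ F : Finset R, X = (F:Set R) := ⟨hfin.toFinset, by simp⟩
    obtain ⟨hm, ha⟩ := approx_cov hX
    have h0 := hX.1.1
    have hadd : ∀ a ∈ (X:Set R), ∀ b ∈ (X:Set R), a + b ∈ (X:Set R) := by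
      classical
      intro a ha' b hb'
      have hc : Cov 1 ((X + X : Finset R):Set R) X := by rw [Finset.coe_add]; exact ha
      have h1 := hc.card
      have h2 : X ⊆ X + X := fun x hx => Finset.mem_add.2 ⟨x, hx, 0, h0, add_zero x⟩
      have h3 := Finset.eq_of_subset_of_card_le h2 (by omega)
      have : a + b ∈ X + X := Finset.add_mem_add ha' hb'
      rw [← h3] at this
      exact this
    have hneg : ∀ a ∈ (X:Set R), -a ∈ (X:Set R) := fun a ha => hX.1.neg_mem ha
    have hmul : ∀ a ∈ (X:Set R), ∀ b ∈ (X:Set R), a * b ∈ (X:Set R) := by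
      obtain ⟨F, hF, hc⟩ := hm
      intro a ha b hb
      obtain ⟨f, hf, x, hx, e⟩ := hc ⟨a, ha, b, hb, rfl⟩
      obtain ⟨f', hf', x', hx', e'⟩ := hc ⟨0, h0, 0, h0, rfl⟩
      simp only at e e'
      have hff : f = f' := Finset.card_le_one.1 hF f hf f' hf'
      rw [mul_zero] at e'
      rw [← e, hff, eq_neg_of_add_eq_zero_left e']
      exact hadd _ (hneg _ hx') _ hx
    have hcl : (NonUnitalSubring.closure (X:Set R) : Set R) = X := by
      refine Set.Subset.antisymm ?_ NonUnitalSubring.subset_closure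
      intro v hv
      induction (show v ∈ NonUnitalSubring.closure (X:Set R) from hv) using NonUnitalSubring.closure_induction with
      | mem y hy => exact hy
      | zero => exact h0
      | add a b ha' hb' ha hb => exact hadd a (ha ha') b (hb hb')
      | neg a ha' ha => exact hneg a (ha ha')
      | mul a b ha' hb' ha hb => exact hmul a (ha ha') b (hb hb')
    refine ⟨X, ?_, X.finite_toSet, ?_, ⟨Cov.self _, Cov.self _⟩, X, ?_, subset_rfl, ?_⟩
    · intro x hx
      exact ⟨x, ⟨x, ⟨x, ⟨x, hx, 0, h0, by simp⟩, 0, h0, by simp⟩, 0, h0, by simp⟩, 0,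
        ⟨0, h0, 0, ⟨0, ⟨0, ⟨0, h0, 0, h0, by simp⟩, 0, h0, by simp⟩, 0, h0, by simp⟩, by simp⟩, by simp⟩
    · obtain ⟨h1, F, hF, h2⟩ := hX
      exact ⟨h1, F, by simp; omega, h2⟩
    · rw [hcl]
      exact ⟨subset_rfl, h0, hadd, hneg, fun r hr x hx => ⟨hmul r hr x hx, hmul x hx r hr⟩⟩
    · rw [hcl]
      simp [mulIter]
  · have hKr : (0:ℝ) < K := by exact_mod_cast (show 0 < K by omega)
    obtain ⟨m, hm⟩ : ∃ m : ℕ, m = Nat.floor ((4 : ℝ) * Real.logb 2 (K : ℝ)) := ⟨_, rfl⟩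
    have hKM : K^4 ≤ 2^(m+1) := by
      have h1 := (Nat.lt_floor_add_one ((4 : ℝ) * Real.logb 2 (K : ℝ))).le
      rw [← hm] at h1
      have h2 : (K:ℝ)^4 = (2:ℝ)^((4 : ℝ) * Real.logb 2 (K : ℝ)) := by
        rw [mul_comm, Real.rpow_mul (by norm_num), Real.rpow_logb (by norm_num) (by norm_num) hKr]
        norm_cast
      have h3 : (2:ℝ)^((4 : ℝ) * Real.logb 2 (K : ℝ)) ≤ 2^((m+1 : ℕ):ℝ) := by
        apply Real.rpow_le_rpow_of_exponent_le (by norm_num)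
        push_cast; exact h1
      rw [Real.rpow_natCast, ← h2] at h3
      exact_mod_cast h3
    obtain ⟨N₂, N₃, H⟩ := main_two.{u} K (m+1) hK2 (by omega) hKM
    refine ⟨N₂, N₃, fun R _ X hfin hX => ?_⟩
    obtain ⟨X, rfl⟩ : ∃ F : Finset R, X = (F:Set R) := ⟨hfin.toFinset, by simp⟩
    obtain ⟨Y, h1, h2, h3, I, h4, h5, h6⟩ := H R X hX
    have h0 := hX.1.1
    refine ⟨Y, ?_, Y.finite_toSet, ?_, h3, I, h4, h5, ?_⟩
    · intro y hy
      obtain ⟨a, ha, b, hb, rfl⟩ := h1 hy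
      exact ⟨a + b, ⟨a + b, ⟨a + b, ⟨a, ha, b, hb, rfl⟩, 0, h0, by simp⟩, 0, h0, by simp⟩, 0,
        ⟨0, h0, 0, ⟨0, ⟨0, ⟨0, h0, 0, h0, by simp⟩, 0, h0, by simp⟩, 0, h0, by simp⟩, by simp⟩, by simp⟩
    · obtain ⟨g1, F, hF, g2⟩ := h2
      refine ⟨g1, F, hF.trans ?_, g2⟩
      gcongr <;> omega
    · rw [← hm]; exact h6
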